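/- Let m = 2 or m = 3, let α, β be locally integrable and γ-periodic, and assume 0 < β_1 ≤ (−1)^m·β(t) ≤ β_2 for almost every t ∈ ℝ, for some constants β_1, β_2. Let (λ_k)_{k≥1} be an ordered enumeration of the Floquet multipliers, and let x^1,…,x^m be linearly independent real-valued solutions of (∗) on all of ℝ with each initial segment x^j_0 belonging to H = {Re ψ : ψ ∈ span(⋃_{|λ| ≥ |λ_m|} G_λ)}. Then there exist a constant C and constants 0 < C_1 ≤ C_2 such that C_1·u_m(θ) ≤ C·det[(x^i(t+θ_j))_{i,j=1}^m] ≤ C_2·u_m(θ) for every t ∈ [0, γ] and every θ = (θ_1,…,θ_m) ∈ T_m. -/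

import Mathlib

open MeasureTheory

noncomputable section

abbrev I01 : Set ℝ := Set.Icc (-1 : ℝ) 0

abbrev CC := C(I01, ℂ)

/-- A complex-valued solution of `x'(t) = -α(t) x(t) - β(t) x(t-1)` on `[τ-1, T]`. -/
def IsSolutionC (a c : ℝ → ℝ) (τ T : ℝ) (x : ℝ → ℂ) : Prop :=
  ContinuousOn x (Set.Icc (τ - 1) T) ∧
  ∀ t ∈ Set.Icc τ T, x t = x τ - ∫ s in τ..t, ((a s : ℂ) * x s + (c s : ℂ) * x (s - 1))

/-- A real solution of `x'(t) = -α(t) x(t) - β(t) x(t-1)` on `[τ-1, T]`. -/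
def IsSolution (a c : ℝ → ℝ) (τ T : ℝ) (x : ℝ → ℝ) : Prop :=
  ContinuousOn x (Set.Icc (τ - 1) T) ∧
  ∀ t ∈ Set.Icc τ T, x t = x τ - ∫ s in τ..t, (a s * x s + c s * x (s - 1))

/-- A solution on all of `ℝ`. -/
def IsGlobalSolution (a c : ℝ → ℝ) (x : ℝ → ℝ) : Prop :=
  ∀ τ T : ℝ, τ ≤ T → IsSolution a c τ T x

/-- `M` is the monodromy operator of the `γ`-periodic delay equation. -/
def IsMonodromy (a c : ℝ → ℝ) (γ : ℝ) (M : CC →L[ℂ] CC) : Prop :=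
  ∀ (φ : CC) (x : ℝ → ℂ), IsSolutionC a c 0 γ x →
    (∀ θ : I01, x (θ : ℝ) = φ θ) → ∀ θ : I01, M φ θ = x (γ + (θ : ℝ))

/-- A Floquet multiplier: a nonzero eigenvalue of the monodromy operator. -/
def IsFloquetMult (M : CC →L[ℂ] CC) (μ : ℂ) : Prop :=
  μ ≠ 0 ∧ ∃ φ : CC, φ ≠ 0 ∧ M φ = μ • φ

/-- The generalized eigenspace `G_μ = ⋃ₙ ker (M - μ I)^n`. -/
def genEig (M : CC →L[ℂ] CC) (μ : ℂ) : Submodule ℂ CC :=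
  ⨆ n : ℕ, LinearMap.ker ((M - μ • (1 : CC →L[ℂ] CC)) ^ n).toLinearMap

/-- The algebraic multiplicity of `μ`. -/
def algMult (M : CC →L[ℂ] CC) (μ : ℂ) : ℕ :=
  Module.finrank ℂ (genEig M μ)

/-- An ordered enumeration `(Λ k)_{k ≥ 1}` of the Floquet multipliers,
with repetitions according to algebraic multiplicity. -/
def IsOrderedEnum (M : CC →L[ℂ] CC) (Λ : ℕ → ℂ) : Prop :=
  (∀ k : ℕ, 1 ≤ k → ‖Λ (k + 1)‖ ≤ ‖Λ k‖) ∧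
  (∀ k : ℕ, 1 ≤ k → IsFloquetMult M (Λ k)) ∧
  (∀ μ : ℂ, IsFloquetMult M μ → Nat.card {k : ℕ | 1 ≤ k ∧ Λ k = μ} = algMult M μ)

/-- The span of the generalized eigenspaces of all Floquet multipliers `μ`
with `|μ| ≥ |Λ m|`; the space `H` of the statement is `{re ∘ ψ | ψ ∈ Hspan M Λ m}`. -/
def Hspan (M : CC →L[ℂ] CC) (Λ : ℕ → ℂ) (m : ℕ) : Submodule ℂ CC :=
  ⨆ μ ∈ {μ : ℂ | IsFloquetMult M μ ∧ ‖Λ m‖ ≤ ‖μ‖}, genEig M μ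

/-- The fundamental simplex `T_m` of ordered tuples in `[-1,0]^m`. -/
def TsetR (m : ℕ) : Set (Fin m → ℝ) :=
  {θ | (∀ i, θ i ∈ Set.Icc (-1 : ℝ) 0) ∧ Monotone θ}

/-- The polynomial `u_m(θ) = (∏_{1 ≤ i < j ≤ m} (θ_j - θ_i)) (∏_{1 ≤ i < j ≤ m-1} (1 + θ_i - θ_j))`
(here with `0`-indexed coordinates). -/
def umFun (m : ℕ) (θ : Fin m → ℝ) : ℝ :=
  (∏ p ∈ Finset.univ.filter (fun p : Fin m × Fin m => p.1 < p.2), (θ p.2 - θ p.1)) *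
  (∏ p ∈ Finset.univ.filter (fun p : Fin m × Fin m => p.1 < p.2 ∧ (p.2 : ℕ) + 2 ≤ m),
    (1 + θ p.1 - θ p.2))

/-- A locally integrable coefficient which is a.e. bounded between two positive constants. -/
structure PosCoef (a : ℝ → ℝ) (b₁ b₂ : ℝ) : Prop where
  locInt : LocallyIntegrable a volume
  pos : 0 < b₁
  bounds : ∀ᵐ t ∂volume, b₁ ≤ a t ∧ a t ≤ b₂

namespace PosCoef

variable {a : ℝ → ℝ} {b₁ b₂ : ℝ}

lemma pos_right (h : PosCoef a b₁ b₂) : 0 < b₂ := by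
  obtain ⟨t, ht⟩ := h.bounds.exists
  linarith [h.pos]

lemma intervalIntegrable_mul (h : PosCoef a b₁ b₂) {g : ℝ → ℝ} (hg : Continuous g) (s t : ℝ) :
    IntervalIntegrable (fun q => a q * g q) volume s t :=
  ((h.locInt.integrableOn_isCompact isCompact_uIcc).intervalIntegrable).mul_continuousOn hg.continuousOn

lemma integral_nonneg (h : PosCoef a b₁ b₂) {g : ℝ → ℝ} {s t : ℝ} (hst : s ≤ t)
    (hg : ∀ q ∈ Set.Icc s t, 0 ≤ g q) : 0 ≤ ∫ q in s..t, a q * g q := by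
  apply intervalIntegral.integral_nonneg_of_ae_restrict hst
  filter_upwards [ae_restrict_mem measurableSet_Icc, ae_restrict_of_ae h.bounds] with q hq hb
  exact mul_nonneg (h.pos.le.trans hb.1) (hg q hq)

lemma le_integral (h : PosCoef a b₁ b₂) {g : ℝ → ℝ} (hc : Continuous g) {s t u v c : ℝ}
    (hsu : s ≤ u) (huv : u ≤ v) (hvt : v ≤ t) (hc0 : 0 ≤ c)
    (hg : ∀ q ∈ Set.Icc s t, 0 ≤ g q) (hgc : ∀ q ∈ Set.Icc u v, c ≤ g q) :
    b₁ * c * (v - u) ≤ ∫ q in s..t, a q * g q := by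
  have i := h.intervalIntegrable_mul hc
  have h1 := h.integral_nonneg hsu (fun q hq => hg q ⟨hq.1, hq.2.trans (huv.trans hvt)⟩)
  have h2 := h.integral_nonneg hvt (fun q hq => hg q ⟨(hsu.trans huv).trans hq.1, hq.2⟩)
  have h3 : b₁ * c * (v - u) ≤ ∫ q in u..v, a q * g q := by
    have : ∫ _ in u..v, b₁ * c = b₁ * c * (v - u) := by simp; ring
    rw [← this]
    apply intervalIntegral.integral_mono_ae_restrict huv (by simp) (i u v)
    filter_upwards [ae_restrict_mem measurableSet_Icc, ae_restrict_of_ae h.bounds] with q hq hb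
    exact mul_le_mul hb.1 (hgc q hq) hc0 (h.pos.le.trans hb.1)
  have h4 := intervalIntegral.integral_add_adjacent_intervals (i s u) (i u v)
  have h5 := intervalIntegral.integral_add_adjacent_intervals (i s v) (i v t)
  linarith

lemma integral_pos (h : PosCoef a b₁ b₂) {g : ℝ → ℝ} (hc : Continuous g) {s t x : ℝ}
    (hst : s < t) (hg : ∀ q ∈ Set.Icc s t, 0 ≤ g q) (hx : x ∈ Set.Icc s t) (hgx : 0 < g x) :
    0 < ∫ q in s..t, a q * g q := by
  obtain ⟨ε, hε, hball⟩ := Metric.continuousAt_iff.1 (hc.continuousAt (x := x)) (g x / 2)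
    (by positivity)
  have key : ∀ u v : ℝ, s ≤ u → u < v → v ≤ t → (∀ q ∈ Set.Icc u v, |q - x| < ε) →
      0 < ∫ q in s..t, a q * g q := by
    intro u v hu huv hv hq
    have := h.le_integral hc hu huv.le hv (c := g x / 2) (by positivity) hg (fun q hq' => by
      have := hball (x := q) (by rw [Real.dist_eq]; exact hq q hq')
      rw [Real.dist_eq, abs_lt] at this
      linarith)
    have h2 : 0 < b₁ * (g x / 2) * (v - u) :=
      mul_pos (mul_pos h.pos (by positivity)) (by linarith)
    linarith
  rcases hx.2.lt_or_eq with hxt | hxt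
  · refine key x (min t (x + ε / 2)) hx.1 (by simp [hxt, hε]) (min_le_left _ _) fun q hq => ?_
    have := hq.2.trans (min_le_right _ _)
    rw [abs_lt]; constructor <;> linarith [hq.1]
  · refine key (max s (x - ε / 2)) x (le_max_left _ _) ?_ hx.2 fun q hq => ?_
    · simp [hε, hxt, hst]
    · have := (le_max_right _ _).trans hq.1
      rw [abs_lt]; constructor <;> linarith [hq.2]

lemma abs_integral_le (h : PosCoef a b₁ b₂) {g : ℝ → ℝ} {s t S : ℝ} (hst : s ≤ t)
    (hg : ∀ q ∈ Set.Icc s t, |g q| ≤ S) : |∫ q in s..t, a q * g q| ≤ b₂ * S * (t - s) := by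
  have := intervalIntegral.norm_integral_le_of_norm_le_const_ae
    (f := fun q => a q * g q) (C := b₂ * S) (a := s) (b := t) (by
      filter_upwards [h.bounds] with q hb hq
      rw [Set.uIoc_of_le hst] at hq
      rw [Real.norm_eq_abs, abs_mul, abs_of_nonneg (h.pos.le.trans hb.1)]
      exact mul_le_mul hb.2 (hg q ⟨hq.1.le, hq.2⟩) (abs_nonneg _) h.pos_right.le)
  rwa [abs_of_nonneg (sub_nonneg.2 hst)] at this

end PosCoef

/-- Two-variable kernels evolving under the equation in their last variable. -/
structure Evol2 (a : ℝ → ℝ) (k : ℝ → ℝ → ℝ) : Prop where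
  cont : Continuous fun p : ℝ × ℝ => k p.1 p.2
  diag : ∀ s, k s s = 0
  evol : ∀ s τ t, 0 ≤ τ → τ ≤ t → k s t = k s τ + ∫ q in τ..t, a q * k (q - 1) s

/-- Three-variable kernels evolving under the equation in their last variable. -/
structure Evol3 (a : ℝ → ℝ) (k : ℝ → ℝ → ℝ → ℝ) : Prop where
  cont : Continuous fun p : ℝ × ℝ × ℝ => k p.1 p.2.1 p.2.2
  diag : ∀ r s, k r s s = 0
  diag' : ∀ r t, k r r t = 0
  evol : ∀ r s τ t, 0 ≤ τ → τ ≤ t → k r s t = k r s τ + ∫ q in τ..t, a q * k (q - 1) r s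

namespace Evol2

variable {a : ℝ → ℝ} {b₁ b₂ : ℝ} {k : ℝ → ℝ → ℝ}

lemma cont_left (hk : Evol2 a k) (s : ℝ) : Continuous fun q => k (q - 1) s :=
  hk.cont.comp (f := fun q : ℝ => (q - 1, s)) (by fun_prop)

lemma nonneg (ha : PosCoef a b₁ b₂) (hk : Evol2 a k)
    (h0 : ∀ s t, -1 ≤ s → s ≤ t → t ≤ 0 → 0 ≤ k s t) {s t : ℝ}
    (hs : -1 ≤ s) (hst : s ≤ t) (hts : t ≤ s + 1) : 0 ≤ k s t := by
  suffices H : ∀ N : ℕ, ∀ s t : ℝ, -1 ≤ s → s ≤ t → t ≤ s + 1 → t ≤ N → 0 ≤ k s t by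
    obtain ⟨N, hN⟩ := exists_nat_ge t
    exact H N s t hs hst hts hN
  clear hs hst hts s t
  intro N
  induction N with
  | zero => intro s t h1 h2 _ h4; exact h0 s t h1 h2 (by simpa using h4)
  | succ N ih =>
    push_cast
    have hN : (0 : ℝ) ≤ N := N.cast_nonneg
    have A : ∀ s t : ℝ, -1 ≤ s → s ≤ t → t ≤ s + 1 → t ≤ N + 1 → s ≤ N → 0 ≤ k s t := by
      intro s t h1 h2 h3 h4 h5
      rcases le_total t N with h6 | h6
      · exact ih s t h1 h2 h3 h6
      · rw [hk.evol s N t hN h6]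
        refine add_nonneg (ih s N h1 h5 (by linarith) le_rfl)
          (ha.integral_nonneg h6 fun q hq => ?_)
        exact ih _ _ (by linarith [hq.1]) (by linarith [hq.2]) (by linarith [hq.1]) h5
    intro s t h1 h2 h3 h4
    rcases le_total s N with h5 | h5
    · exact A s t h1 h2 h3 h4 h5
    · rw [hk.evol s s t (hN.trans h5) h2, hk.diag, zero_add]
      refine ha.integral_nonneg h2 fun q hq => ?_
      exact A _ _ (by linarith [hq.1]) (by linarith [hq.2]) (by linarith [hq.1])
        (by linarith [hq.1]) (by linarith [hq.2])

lemma abs_le (ha : PosCoef a b₁ b₂) (hk : Evol2 a k) {s t S : ℝ} (hs : 0 ≤ s) (hst : s ≤ t)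
    (hS : ∀ q ∈ Set.Icc s t, |k (q - 1) s| ≤ S) : |k s t| ≤ b₂ * S * (t - s) := by
  rw [hk.evol s s t hs hst, hk.diag, zero_add]
  exact ha.abs_integral_le hst hS

lemma pos_step (ha : PosCoef a b₁ b₂) (hk : Evol2 a k)
    (h0 : ∀ s t, -1 ≤ s → s ≤ t → t ≤ s + 1 → 0 ≤ k s t) {p₁ p₂ w : ℝ} (h1 : -1 ≤ p₁)
    (h2 : p₁ < p₂) (h3 : p₂ ≤ p₁ + 1) (hw : p₁ + 1 < w) (hw' : w ≤ p₂ + 1) (hp : 0 < k p₁ p₂) :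
    0 < k p₂ w := by
  have hm : max p₂ 0 ≤ p₁ + 1 := max_le h3 (by linarith)
  have hm1 := le_max_left p₂ 0
  have hm2 := le_max_right p₂ 0
  rw [hk.evol p₂ (max p₂ 0) w hm2 (by linarith)]
  refine add_pos_of_nonneg_of_pos (h0 _ _ (by linarith) hm1 (by linarith)) ?_
  refine ha.integral_pos (hk.cont_left p₂) (x := p₁ + 1) (by linarith) (fun q hq => ?_)
    ⟨hm, hw.le⟩ (by simpa using hp)
  exact h0 _ _ (by linarith [hq.1]) (by linarith [hq.2]) (by linarith [hq.1])

lemma pos_path (ha : PosCoef a b₁ b₂) (hk : Evol2 a k)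
    (h0 : ∀ s t, -1 ≤ s → s ≤ t → t ≤ s + 1 → 0 ≤ k s t) {p₁ p₂ d₁ d₂ : ℝ} (n : ℕ)
    (h1 : -1 ≤ p₁) (h3 : p₂ ≤ p₁ + 1) (hd₁ : 0 < d₁) (hd₂ : 0 < d₂)
    (hg : d₁ ≤ p₂ - p₁) (hg' : d₁ ≤ (p₂ + n * d₂) - (p₁ + n * d₁))
    (h3' : p₂ + n * d₂ ≤ p₁ + n * d₁ + 1) (hp : 0 < k p₁ p₂) :
    0 < k (p₁ + n * d₁ + n) (p₂ + n * d₂ + n) := by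
  induction n generalizing p₁ p₂ with
  | zero => simpa using hp
  | succ n ih =>
    push_cast at *
    have hn : (0 : ℝ) ≤ n := n.cast_nonneg
    have c1 : d₁ ≤ (p₂ + d₂) - (p₁ + d₁) := by
      rcases le_total d₁ d₂ with h | h
      · linarith
      · nlinarith
    have c2 : p₂ + d₂ ≤ p₁ + d₁ + 1 := by
      rcases le_total d₁ d₂ with h | h
      · nlinarith
      · linarith
    have s1 := pos_step ha hk h0 (w := p₁ + d₁ + 1) h1 (by linarith) h3 (by linarith)
      (by linarith) hp
    have s2 := pos_step ha hk h0 (w := p₂ + d₂ + 1) (by linarith) (by linarith) (by linarith)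
      (by linarith) (by linarith) s1
    have := ih (p₁ := p₁ + d₁ + 1) (p₂ := p₂ + d₂ + 1) (by linarith) (by linarith) (by linarith)
      (by linarith) (by linarith) s2
    convert this using 2 <;> ring

lemma pos_of_gap (ha : PosCoef a b₁ b₂) (hk : Evol2 a k)
    (h0 : ∀ s t, -1 ≤ s → s ≤ t → t ≤ s + 1 → 0 ≤ k s t) {p₁ p₂ g : ℝ} (h1 : -1 ≤ p₁)
    (h2 : p₁ < p₂) (h3 : p₂ ≤ 0) (hp : 0 < k p₁ p₂) (hg : 0 < g) :
    ∃ T : ℝ, 1 ≤ T ∧ ∀ s t, T ≤ t → g ≤ t - s → t ≤ s + 1 → 0 < k s t := by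
  set g' := min g (p₂ - p₁) with hg'
  have hg0 : 0 < g' := lt_min hg (by linarith)
  refine ⟨3 / g' + 3, by have : 0 < 3 / g' := by positivity
                         linarith, fun s t hT hgap hts => ?_⟩
  have h4 : 0 < 3 / g' := by positivity
  obtain ⟨n, hn⟩ : ∃ n : ℕ, ⌈t⌉₊ = n + 2 := ⟨⌈t⌉₊ - 2, by
    have : 2 < ⌈t⌉₊ := Nat.lt_ceil.2 (by push_cast; linarith)
    omega⟩
  have e1 : t ≤ n + 2 := by simpa [hn] using Nat.le_ceil t
  have e2 : (n : ℝ) + 2 < t + 1 := by simpa [hn] using Nat.ceil_lt_add_one (show 0 ≤ t by linarith)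
  have hn0 : (0 : ℝ) < n := by linarith
  have hn3 : 3 ≤ n * g' := by
    rw [← div_le_iff₀ hg0]; linarith
  have d1 : 0 < (s - n - p₁) / n := div_pos (by linarith) hn0
  have d2 : 0 < (t - n - p₂) / n := div_pos (by linarith) hn0
  have d3 : (s - n - p₁) / n ≤ g' := by rw [div_le_iff₀ hn0]; linarith
  have i1 : n * ((s - n - p₁) / n) = s - n - p₁ := by field_simp
  have i2 : n * ((t - n - p₂) / n) = t - n - p₂ := by field_simp
  have := pos_path ha hk h0 (p₁ := p₁) (p₂ := p₂) n h1 (by linarith) d1 d2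
    (d3.trans (min_le_right _ _))
    (by rw [i1, i2]; linarith [min_le_left g (p₂ - p₁)]) (by rw [i1, i2]; linarith) hp
  rw [i1, i2] at this
  convert this using 1
  congr 1 <;> ring

theorem lower_bound (ha : PosCoef a b₁ b₂) (hk : Evol2 a k)
    (h0 : ∀ s t, -1 ≤ s → s ≤ t → t ≤ s + 1 → 0 ≤ k s t) {p₁ p₂ : ℝ} (h1 : -1 ≤ p₁)
    (h2 : p₁ ≤ p₂) (h3 : p₂ ≤ 0) (hp : 0 < k p₁ p₂) :
    ∃ T : ℝ, ∀ T' : ℝ, ∃ c > 0, ∀ s t, T ≤ t → t ≤ T' → s ≤ t → t ≤ s + 1 →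
      c * (t - s) ≤ k s t := by
  have h2' : p₁ < p₂ := lt_of_le_of_ne h2 (by rintro rfl; simp [hk.diag] at hp)
  obtain ⟨T, hT1, hT⟩ := pos_of_gap ha hk h0 h1 h2' h3 hp (g := 1 / 2) (by norm_num)
  refine ⟨T + 1, fun T' => ?_⟩
  have hcomp : IsCompact {p : ℝ × ℝ | T ≤ p.2 ∧ p.2 ≤ T' ∧ 1 / 2 ≤ p.2 - p.1 ∧ p.2 ≤ p.1 + 1} := by
    refine (isCompact_Icc (a := ((T - 1, T) : ℝ × ℝ)) (b := (T', T'))).of_isClosed_subset ?_ ?_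
    · simp only [Set.ofPred_and]
      refine IsClosed.inter (isClosed_le (by fun_prop) (by fun_prop)) ?_
      refine IsClosed.inter (isClosed_le (by fun_prop) (by fun_prop)) ?_
      exact IsClosed.inter (isClosed_le (by fun_prop) (by fun_prop))
        (isClosed_le (by fun_prop) (by fun_prop))
    · rintro ⟨x, y⟩ ⟨a1, a2, a3, a4⟩
      simp only at a1 a2 a3 a4
      constructor <;> constructor <;> simp only <;> linarith
  obtain ⟨c, hc, hck⟩ := hcomp.exists_forall_le' hk.cont.continuousOn (a := 0)
    (fun p hp => hT _ _ hp.1 hp.2.2.1 hp.2.2.2)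
  refine ⟨b₁ * c / 2, div_pos (mul_pos ha.pos hc) two_pos, fun s t a1 a2 a3 a4 => ?_⟩
  rw [hk.evol s s t (by linarith) a3, hk.diag, zero_add]
  have := ha.le_integral (hk.cont_left s) (s := s) (t := t) (u := s) (v := (s + t) / 2) (c := c)
    le_rfl (by linarith) (by linarith) hc.le
    (fun q hq => h0 _ _ (by linarith [hq.1]) (by linarith [hq.2]) (by linarith [hq.1]))
    (fun q hq => hck (q - 1, s) ⟨by linarith, by linarith, by simp only; linarith [hq.2],
      by simp only; linarith [hq.1]⟩)
  linarith

end Evol2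

namespace Evol3

variable {a : ℝ → ℝ} {b₁ b₂ : ℝ} {k : ℝ → ℝ → ℝ → ℝ}

lemma cont_left (hk : Evol3 a k) (r s : ℝ) : Continuous fun q => k (q - 1) r s :=
  hk.cont.comp (f := fun q : ℝ => (q - 1, r, s)) (by fun_prop)

lemma nonneg (ha : PosCoef a b₁ b₂) (hk : Evol3 a k)
    (h0 : ∀ r s t, -1 ≤ r → r ≤ s → s ≤ t → t ≤ 0 → 0 ≤ k r s t) {r s t : ℝ}
    (hr : -1 ≤ r) (hrs : r ≤ s) (hst : s ≤ t) (hts : t ≤ r + 1) : 0 ≤ k r s t := by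
  suffices H : ∀ N : ℕ, ∀ r s t : ℝ, -1 ≤ r → r ≤ s → s ≤ t → t ≤ r + 1 → t ≤ N → 0 ≤ k r s t by
    obtain ⟨N, hN⟩ := exists_nat_ge t
    exact H N r s t hr hrs hst hts hN
  clear hr hrs hst hts r s t
  intro N
  induction N with
  | zero => intro r s t h1 h2 h3 _ h4; exact h0 r s t h1 h2 h3 (by simpa using h4)
  | succ N ih =>
    push_cast
    have hN : (0 : ℝ) ≤ N := N.cast_nonneg
    have A : ∀ r s t : ℝ, -1 ≤ r → r ≤ s → s ≤ t → t ≤ r + 1 → t ≤ N + 1 → s ≤ N →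
        0 ≤ k r s t := by
      intro r s t h1 h2 h3 h4 h5 h6
      rcases le_total t N with h7 | h7
      · exact ih r s t h1 h2 h3 h4 h7
      · rw [hk.evol r s N t hN h7]
        refine add_nonneg (ih r s N h1 h2 h6 (by linarith) le_rfl)
          (ha.integral_nonneg h7 fun q hq => ?_)
        exact ih _ _ _ (by linarith [hq.1]) (by linarith [hq.2]) h2 (by linarith [hq.1]) h6
    have B : ∀ r s t : ℝ, -1 ≤ r → r ≤ s → s ≤ t → t ≤ r + 1 → t ≤ N + 1 → r ≤ N →
        0 ≤ k r s t := by
      intro r s t h1 h2 h3 h4 h5 h6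
      rcases le_total s N with h7 | h7
      · exact A r s t h1 h2 h3 h4 h5 h7
      · rw [hk.evol r s s t (hN.trans h7) h3, hk.diag, zero_add]
        refine ha.integral_nonneg h3 fun q hq => ?_
        exact A _ _ _ (by linarith [hq.1]) (by linarith [hq.2]) h2 (by linarith [hq.1])
          (by linarith) h6
    intro r s t h1 h2 h3 h4 h5
    rcases le_total r N with h6 | h6
    · exact B r s t h1 h2 h3 h4 h5 h6
    · rw [hk.evol r s s t (hN.trans (h6.trans h2)) h3, hk.diag, zero_add]
      refine ha.integral_nonneg h3 fun q hq => ?_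
      exact B _ _ _ (by linarith [hq.1]) (by linarith [hq.2]) h2 (by linarith [hq.1])
        (by linarith) (by linarith [hq.2])

lemma abs_le (ha : PosCoef a b₁ b₂) (hk : Evol3 a k) {r s t S : ℝ} (hs : 0 ≤ s) (hst : s ≤ t)
    (hS : ∀ q ∈ Set.Icc s t, |k (q - 1) r s| ≤ S) : |k r s t| ≤ b₂ * S * (t - s) := by
  rw [hk.evol r s s t hs hst, hk.diag, zero_add]
  exact ha.abs_integral_le hst hS

lemma upper_bound (ha : PosCoef a b₁ b₂) (hk : Evol3 a k) {N S : ℝ}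
    (hS : ∀ r s t, -1 ≤ r → r ≤ N → -1 ≤ s → s ≤ N → -1 ≤ t → t ≤ N → |k r s t| ≤ S)
    {r s t : ℝ} (hr : 1 ≤ r) (hrs : r ≤ s) (hst : s ≤ t) (htr : t ≤ r + 1) (htN : t ≤ N) :
    |k r s t| ≤ b₂ ^ 4 * S * ((s - r) * (t - r) * (t - s) * (1 + r - s)) := by
  have hS0 : 0 ≤ S := (abs_nonneg _).trans (hS 0 0 0 (by norm_num) (by linarith) (by norm_num)
    (by linarith) (by norm_num) (by linarith))
  have hb := ha.pos_right
  have h := hk.abs_le ha (r := r) (S := b₂ * (b₂ * (b₂ * S * (t - r)) * (1 + r - s)) * (s - r))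
    (by linarith) hst fun q hq =>
    hk.abs_le ha (by linarith) hrs fun q' hq' =>
    (hk.abs_le ha (S := b₂ * S * (t - r)) (by linarith [hq.1]) (by linarith [hq.2])
      fun q'' hq'' =>
      (hk.abs_le ha (S := S) (by linarith [hq'.1]) (by linarith [hq'.2, hq.1]) fun q₃ hq₃ =>
        hS _ _ _ (by linarith [hq'.1, hq₃.1]) (by linarith [hq₃.2, hq.2])
          (by linarith [hq''.1, hq.1]) (by linarith [hq''.2])
          (by linarith [hq'.1]) (by linarith [hq'.2])).trans
        (mul_le_mul_of_nonneg_left (by linarith [hq.2, hq'.1]) (by positivity))).trans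
      (mul_le_mul_of_nonneg_left (by linarith [hq.1]) (mul_nonneg hb.le (mul_nonneg
        (by positivity) (by linarith))))
  refine h.trans (le_of_eq (by ring))

lemma pos_step (ha : PosCoef a b₁ b₂) (hk : Evol3 a k)
    (h0 : ∀ r s t, -1 ≤ r → r ≤ s → s ≤ t → t ≤ r + 1 → 0 ≤ k r s t) {p₁ p₂ p₃ w : ℝ}
    (h1 : -1 ≤ p₁) (h2 : p₁ < p₂) (h2' : p₂ < p₃) (h3 : p₃ ≤ p₁ + 1) (hw : p₁ + 1 < w)
    (hw' : w ≤ p₂ + 1) (hp : 0 < k p₁ p₂ p₃) : 0 < k p₂ p₃ w := by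
  have hm : max p₃ 0 ≤ p₁ + 1 := max_le h3 (by linarith)
  have hm1 := le_max_left p₃ 0
  have hm2 := le_max_right p₃ 0
  rw [hk.evol p₂ p₃ (max p₃ 0) w hm2 (by linarith)]
  refine add_pos_of_nonneg_of_pos (h0 _ _ _ (by linarith) h2'.le hm1 (by linarith)) ?_
  refine ha.integral_pos (hk.cont_left p₂ p₃) (x := p₁ + 1) (by linarith) (fun q hq => ?_)
    ⟨hm, hw.le⟩ (by simpa using hp)
  exact h0 _ _ _ (by linarith [hq.1]) (by linarith [hq.2]) h2'.le (by linarith [hq.1])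

lemma pos_path (ha : PosCoef a b₁ b₂) (hk : Evol3 a k)
    (h0 : ∀ r s t, -1 ≤ r → r ≤ s → s ≤ t → t ≤ r + 1 → 0 ≤ k r s t)
    {p₁ p₂ p₃ d₁ d₂ d₃ : ℝ} (n : ℕ)
    (h1 : -1 ≤ p₁) (h3 : p₃ ≤ p₁ + 1) (hd₁ : 0 < d₁) (hd₂ : 0 < d₂) (hd₃ : 0 < d₃)
    (hg : d₁ ≤ p₂ - p₁) (hg' : d₁ ≤ (p₂ + n * d₂) - (p₁ + n * d₁))
    (hgg : d₂ ≤ p₃ - p₂) (hgg' : d₂ ≤ (p₃ + n * d₃) - (p₂ + n * d₂))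
    (h3' : p₃ + n * d₃ ≤ p₁ + n * d₁ + 1) (hp : 0 < k p₁ p₂ p₃) :
    0 < k (p₁ + n * d₁ + n) (p₂ + n * d₂ + n) (p₃ + n * d₃ + n) := by
  induction n generalizing p₁ p₂ p₃ with
  | zero => simpa using hp
  | succ n ih =>
    push_cast at *
    have hn : (0 : ℝ) ≤ n := n.cast_nonneg
    have c1 : d₁ ≤ (p₂ + d₂) - (p₁ + d₁) := by
      rcases le_total d₁ d₂ with h | h
      · linarith
      · nlinarith
    have c1' : d₂ ≤ (p₃ + d₃) - (p₂ + d₂) := by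
      rcases le_total d₂ d₃ with h | h
      · linarith
      · nlinarith
    have c2 : p₃ + d₃ ≤ p₁ + d₁ + 1 := by
      rcases le_total d₁ d₃ with h | h
      · nlinarith
      · linarith
    have s1 := pos_step ha hk h0 (w := p₁ + d₁ + 1) h1 (by linarith) (by linarith) h3
      (by linarith) (by linarith) hp
    have s2 := pos_step ha hk h0 (w := p₂ + d₂ + 1) (by linarith) (by linarith) (by linarith)
      (by linarith) (by linarith) (by linarith) s1
    have s3 := pos_step ha hk h0 (w := p₃ + d₃ + 1) (by linarith) (by linarith) (by linarith)
      (by linarith) (by linarith) (by linarith) s2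
    have := ih (p₁ := p₁ + d₁ + 1) (p₂ := p₂ + d₂ + 1) (p₃ := p₃ + d₃ + 1) (by linarith)
      (by linarith) (by linarith) (by linarith) (by linarith) (by linarith) (by linarith) s3
    convert this using 2 <;> ring

lemma pos_of_gap (ha : PosCoef a b₁ b₂) (hk : Evol3 a k)
    (h0 : ∀ r s t, -1 ≤ r → r ≤ s → s ≤ t → t ≤ r + 1 → 0 ≤ k r s t) {p₁ p₂ p₃ g : ℝ}
    (h1 : -1 ≤ p₁) (h2 : p₁ < p₂) (h2' : p₂ < p₃) (h3 : p₃ ≤ 0) (hp : 0 < k p₁ p₂ p₃)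
    (hg : 0 < g) : ∃ T : ℝ, 1 ≤ T ∧ ∀ r s t, T ≤ t → g ≤ s - r → g ≤ t - s → t ≤ r + 1 →
      0 < k r s t := by
  set g' := min g (min (p₂ - p₁) (p₃ - p₂)) with hg'
  have hg0 : 0 < g' := lt_min hg (lt_min (by linarith) (by linarith))
  have l1 : g' ≤ g := min_le_left _ _
  have l2 : g' ≤ p₂ - p₁ := (min_le_right _ _).trans (min_le_left _ _)
  have l3 : g' ≤ p₃ - p₂ := (min_le_right _ _).trans (min_le_right _ _)
  have h4 : 0 < 3 / g' := by positivity
  refine ⟨3 / g' + 3, by linarith, fun r s t hT hgap hgap' hts => ?_⟩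
  obtain ⟨n, hn⟩ : ∃ n : ℕ, ⌈t⌉₊ = n + 2 := ⟨⌈t⌉₊ - 2, by
    have : 2 < ⌈t⌉₊ := Nat.lt_ceil.2 (by push_cast; linarith)
    omega⟩
  have e1 : t ≤ n + 2 := by simpa [hn] using Nat.le_ceil t
  have e2 : (n : ℝ) + 2 < t + 1 := by simpa [hn] using Nat.ceil_lt_add_one (show 0 ≤ t by linarith)
  have hn0 : (0 : ℝ) < n := by linarith
  have hn3 : 3 ≤ n * g' := by
    rw [← div_le_iff₀ hg0]; linarith
  have d1 : 0 < (r - n - p₁) / n := div_pos (by linarith) hn0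
  have d2 : 0 < (s - n - p₂) / n := div_pos (by linarith) hn0
  have d3 : 0 < (t - n - p₃) / n := div_pos (by linarith) hn0
  have d4 : (r - n - p₁) / n ≤ g' := by rw [div_le_iff₀ hn0]; linarith
  have d5 : (s - n - p₂) / n ≤ g' := by rw [div_le_iff₀ hn0]; linarith
  have i1 : n * ((r - n - p₁) / n) = r - n - p₁ := by field_simp
  have i2 : n * ((s - n - p₂) / n) = s - n - p₂ := by field_simp
  have i3 : n * ((t - n - p₃) / n) = t - n - p₃ := by field_simp
  have := pos_path ha hk h0 (p₁ := p₁) (p₂ := p₂) (p₃ := p₃) n h1 (by linarith) d1 d2 d3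
    (d4.trans l2) (by rw [i1, i2]; linarith) (d5.trans l3) (by rw [i2, i3]; linarith)
    (by rw [i1, i3]; linarith) hp
  rw [i1, i2, i3] at this
  convert this using 1
  congr 1 <;> ring

/-- `k r s t ≥ c * f (s - r) (t - s)` on the part of the window with `T ≤ t ≤ T'` cut out by `R`. -/
def Low (k : ℝ → ℝ → ℝ → ℝ) (T T' : ℝ) (R : ℝ → ℝ → Prop) (f : ℝ → ℝ → ℝ) : Prop :=
  ∃ c > 0, ∀ r s t, T ≤ t → t ≤ T' → r ≤ s → s ≤ t → t ≤ r + 1 → R (s - r) (t - s) →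
    c * f (s - r) (t - s) ≤ k r s t

lemma low_step (ha : PosCoef a b₁ b₂) (hk : Evol3 a k)
    (h0 : ∀ r s t, -1 ≤ r → r ≤ s → s ≤ t → t ≤ r + 1 → 0 ≤ k r s t) {T T' : ℝ} (hT : 1 ≤ T)
    {R R' : ℝ → ℝ → Prop} {f f' : ℝ → ℝ → ℝ} (hL : Low k T T' R f) {c₀ : ℝ} (hc₀ : 0 < c₀)
    (H : ∀ A B, 0 ≤ A → 0 ≤ B → A + B ≤ 1 → R' A B → ∃ x₁ x₂ v, 0 ≤ x₁ ∧ x₁ ≤ x₂ ∧ x₂ ≤ B ∧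
      0 ≤ v ∧ c₀ * f' A B ≤ v * (x₂ - x₁) ∧ ∀ x, x₁ ≤ x → x ≤ x₂ → R (1 - A - x) A ∧
        v ≤ f (1 - A - x) A) : Low k (T + 1) T' R' f' := by
  obtain ⟨c, hc, hL⟩ := hL
  refine ⟨b₁ * c * c₀, mul_pos (mul_pos ha.pos hc) hc₀, fun r s t a1 a2 a3 a4 a5 hR => ?_⟩
  obtain ⟨x₁, x₂, v, e1, e2, e3, e4, e5, e6⟩ := H (s - r) (t - s) (by linarith) (by linarith)
    (by linarith) hR
  rw [hk.evol r s s t (by linarith) a4, hk.diag, zero_add]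
  have := ha.le_integral (hk.cont_left r s) (s := s) (t := t) (u := s + x₁) (v := s + x₂)
    (c := c * v) (by linarith) (by linarith) (by linarith) (by positivity)
    (fun q hq => h0 _ _ _ (by linarith [hq.1]) (by linarith [hq.2]) a3 (by linarith [hq.1]))
    (fun q hq => by
      have h1 := e6 (q - s) (by linarith [hq.1]) (by linarith [hq.2])
      have h2 : 1 - (s - r) - (q - s) = r - (q - 1) := by ring
      rw [h2] at h1
      exact (mul_le_mul_of_nonneg_left h1.2 hc.le).trans
        (hL (q - 1) r s (by linarith) (by linarith) (by linarith [hq.2]) a3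
        (by linarith [hq.1]) h1.1))
  refine le_trans ?_ this
  have h3 := mul_le_mul_of_nonneg_left e5 (mul_pos ha.pos hc).le
  linarith

theorem lower_bound (ha : PosCoef a b₁ b₂) (hk : Evol3 a k)
    (h0 : ∀ r s t, -1 ≤ r → r ≤ s → s ≤ t → t ≤ r + 1 → 0 ≤ k r s t) {p₁ p₂ p₃ : ℝ}
    (h1 : -1 ≤ p₁) (h2 : p₁ ≤ p₂) (h2' : p₂ ≤ p₃) (h3 : p₃ ≤ 0) (hp : 0 < k p₁ p₂ p₃) :
    ∃ T : ℝ, ∀ T' : ℝ, ∃ c > 0, ∀ r s t, T ≤ t → t ≤ T' → r ≤ s → s ≤ t → t ≤ r + 1 →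
      c * ((s - r) * (t - r) * (t - s) * (1 + r - s)) ≤ k r s t := by
  have h4 : p₁ < p₂ := lt_of_le_of_ne h2 (by rintro rfl; simp [hk.diag'] at hp)
  have h5 : p₂ < p₃ := lt_of_le_of_ne h2' (by rintro rfl; simp [hk.diag] at hp)
  obtain ⟨T, hT1, hT⟩ := pos_of_gap ha hk h0 h1 h4 h5 h3 hp (g := 1 / 12) (by norm_num)
  refine ⟨T + 1 + 1 + 1 + 1, fun T' => ?_⟩
  have hcomp : IsCompact {p : ℝ × ℝ × ℝ | T ≤ p.2.2 ∧ p.2.2 ≤ T' ∧ 1 / 12 ≤ p.2.1 - p.1 ∧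
      1 / 12 ≤ p.2.2 - p.2.1 ∧ p.2.2 ≤ p.1 + 1} := by
    refine (isCompact_Icc (a := ((T - 1, T - 1, T) : ℝ × ℝ × ℝ))
      (b := (T', T', T'))).of_isClosed_subset ?_ ?_
    · simp only [Set.ofPred_and]
      refine IsClosed.inter (isClosed_le (by fun_prop) (by fun_prop)) ?_
      refine IsClosed.inter (isClosed_le (by fun_prop) (by fun_prop)) ?_
      refine IsClosed.inter (isClosed_le (by fun_prop) (by fun_prop)) ?_
      exact IsClosed.inter (isClosed_le (by fun_prop) (by fun_prop))
        (isClosed_le (by fun_prop) (by fun_prop))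
    · rintro ⟨x, y, z⟩ ⟨a1, a2, a3, a4, a5⟩
      simp only at a1 a2 a3 a4 a5
      refine ⟨⟨?_, ?_, ?_⟩, ?_, ?_, ?_⟩ <;> simp only <;> linarith
  have k1 : Low k T T' (fun A B => 1 / 12 ≤ A ∧ 1 / 12 ≤ B) (fun _ _ => 1) := by
    obtain ⟨c, hc, hck⟩ := hcomp.exists_forall_le' hk.cont.continuousOn (a := 0)
      (fun p hp => hT _ _ _ hp.1 hp.2.2.1 hp.2.2.2.1 hp.2.2.2.2)
    refine ⟨c, hc, fun r s t a1 a2 a3 a4 a5 hR => ?_⟩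
    simpa using hck (r, s, t) ⟨a1, a2, hR.1, hR.2, a5⟩
  have k2 : Low k (T + 1) T' (fun A _ => 1 / 12 ≤ A ∧ A ≤ 1 - 2 / 12) (fun _ B => B) := by
    refine low_step ha hk h0 hT1 k1 (c₀ := 1 / 2) (by norm_num) fun A B hA hB hAB hR =>
      ⟨0, B / 2, 1, le_rfl, by linarith, by linarith, by norm_num, by linarith,
        fun x hx hx' => ⟨⟨by linarith [hR.2], hR.1⟩, le_rfl⟩⟩
  have k3 : Low k (T + 1 + 1) T' (fun A B => A ≤ 1 - 2 / 12 ∧ (2 / 12 ≤ A ∨ 4 / 12 ≤ B))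
      (fun A B => A * B) := by
    refine low_step ha hk h0 (by linarith) k2 (c₀ := 1 / 4) (by norm_num)
      fun A B hA hB hAB ⟨hR, hR'⟩ => ?_
    have := mul_nonneg hA hB
    rcases hR' with h | h
    · exact ⟨0, B / 2, A, le_rfl, by linarith, by linarith, hA, by linarith,
        fun x hx hx' => ⟨⟨by linarith, by linarith⟩, le_rfl⟩⟩
    · exact ⟨B / 2, 3 * B / 4, A, by linarith, by linarith, by linarith, hA, by linarith,
        fun x hx hx' => ⟨⟨by linarith, by linarith⟩, le_rfl⟩⟩
  have k4 : Low k (T + 1 + 1 + 1) T' (fun A _ => 4 / 12 ≤ A) (fun A B => A * B * (1 - A)) := by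
    refine low_step ha hk h0 (by linarith) k3 (c₀ := 1 / 4) (by norm_num)
      fun A B hA hB hAB hR => ?_
    exact ⟨0, B / 2, A * (1 - A) / 2, le_rfl, by linarith, by linarith,
      div_nonneg (mul_nonneg hA (by linarith)) two_pos.le, by linarith,
      fun x hx hx' => ⟨⟨by linarith, Or.inr hR⟩, by nlinarith⟩⟩
  have k5 : Low k (T + 1 + 1 + 1 + 1) T' (fun A _ => A ≤ 4 / 12)
      (fun A B => A * B * (A + B)) := by
    refine low_step ha hk h0 (by linarith) k4 (c₀ := 1 / 48) (by norm_num)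
      fun A B hA hB hAB hR => ?_
    refine ⟨B / 4, B / 2, A * (A + B) / 12, by linarith, by linarith, by linarith,
      div_nonneg (mul_nonneg hA (by linarith)) (by norm_num), by linarith,
      fun x hx hx' => ⟨by linarith, ?_⟩⟩
    have e1 : 1 / 3 * A ≤ (1 - A - x) * A := mul_le_mul_of_nonneg_right (by linarith) hA
    have e2 : (A + B) / 4 ≤ 1 - (1 - A - x) := by linarith
    have := mul_le_mul e1 e2 (by linarith) (mul_nonneg (by linarith) hA)
    linarith
  obtain ⟨c, hc, hL⟩ := k4
  obtain ⟨c', hc', hL'⟩ := k5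
  refine ⟨min c c', lt_min hc hc', fun r s t a1 a2 a3 a4 a5 => ?_⟩
  have g1 : 0 ≤ s - r := by linarith
  have g2 : 0 ≤ t - s := by linarith
  have g3 : 0 ≤ t - r := by linarith
  have g4 : 0 ≤ 1 + r - s := by linarith
  rcases le_total (4 / 12) (s - r) with h | h
  · refine le_trans ?_ (hL r s t (by linarith) a2 a3 a4 a5 h)
    refine mul_le_mul (min_le_left _ _) ?_ (by positivity) hc.le
    change _ ≤ (s - r) * (t - s) * (1 - (s - r))
    have e : 1 - (s - r) = 1 + r - s := by ring
    rw [e]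
    have : (s - r) * (t - r) ≤ (s - r) := by nlinarith
    gcongr
  · refine le_trans ?_ (hL' r s t (by linarith) a2 a3 a4 a5 h)
    refine mul_le_mul (min_le_right _ _) ?_ (by positivity) hc'.le
    change _ ≤ (s - r) * (t - s) * ((s - r) + (t - s))
    have e : (s - r) + (t - s) = t - r := by ring
    rw [e]
    have : (s - r) * (t - r) * (t - s) * (1 + r - s) ≤ (s - r) * (t - r) * (t - s) * 1 := by
      gcongr; linarith
    linarith

end Evol3

/-- A locally integrable, essentially bounded coefficient. -/
structure BddCoef (b : ℝ → ℝ) (B : ℝ) : Prop where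
  locInt : LocallyIntegrable b volume
  nonneg : 0 ≤ B
  bound : ∀ᵐ t ∂volume, |b t| ≤ B

/-- Continuous functions on `ℝ` solving `y'(t) = -b(t) y(t-1)` for `t ≥ 0`. -/
structure Sol {E : Type*} [NormedAddCommGroup E] [NormedSpace ℝ E] (b : ℝ → ℝ) (y : ℝ → E) :
    Prop where
  cont : Continuous y
  eqn : ∀ τ t, 0 ≤ τ → τ ≤ t → y t = y τ - ∫ q in τ..t, b q • y (q - 1)

namespace BddCoef

variable {E : Type*} [NormedAddCommGroup E] [NormedSpace ℝ E] {b : ℝ → ℝ} {B : ℝ}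

lemma intervalIntegrable_smul (h : BddCoef b B) {g : ℝ → E} (hg : Continuous g) (s t : ℝ) :
    IntervalIntegrable (fun q => b q • g q) volume s t :=
  ((h.locInt.integrableOn_isCompact isCompact_uIcc).intervalIntegrable).smul_continuousOn
    hg.continuousOn

lemma norm_integral_le (h : BddCoef b B) {g : ℝ → E} {s t S : ℝ} (hst : s ≤ t)
    (hg : ∀ q ∈ Set.Icc s t, ‖g q‖ ≤ S) : ‖∫ q in s..t, b q • g q‖ ≤ B * S * (t - s) := by
  have := intervalIntegral.norm_integral_le_of_norm_le_const_ae
    (f := fun q => b q • g q) (C := B * S) (a := s) (b := t) (by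
      filter_upwards [h.bound] with q hb hq
      rw [Set.uIoc_of_le hst] at hq
      rw [norm_smul, Real.norm_eq_abs]
      exact mul_le_mul hb (hg q ⟨hq.1.le, hq.2⟩) (norm_nonneg _) h.nonneg)
  rwa [abs_of_nonneg (sub_nonneg.2 hst)] at this

end BddCoef

namespace Sol

variable {E : Type*} [NormedAddCommGroup E] [NormedSpace ℝ E] {b : ℝ → ℝ} {B : ℝ} {y z : ℝ → E}

lemma cont_delay (hy : Sol b y) : Continuous fun q => y (q - 1) :=
  hy.cont.comp (by fun_prop)

lemma zero : Sol b (fun _ => (0 : E)) := ⟨continuous_const, by simp⟩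

lemma add (hb : BddCoef b B) (hy : Sol b y) (hz : Sol b z) : Sol b (fun t => y t + z t) := by
  refine ⟨hy.cont.add hz.cont, fun τ t h1 h2 => ?_⟩
  rw [hy.eqn τ t h1 h2, hz.eqn τ t h1 h2]
  simp only [smul_add]
  rw [intervalIntegral.integral_add (hb.intervalIntegrable_smul hy.cont_delay _ _)
    (hb.intervalIntegrable_smul hz.cont_delay _ _)]
  abel

lemma clm {F : Type*} [NormedAddCommGroup F] [NormedSpace ℝ F] [CompleteSpace E] [CompleteSpace F]
    (hb : BddCoef b B)
    (L : E →L[ℝ] F) (hy : Sol b y) : Sol b (fun t => L (y t)) := by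
  refine ⟨L.continuous.comp hy.cont, fun τ t h1 h2 => ?_⟩
  rw [hy.eqn τ t h1 h2, map_sub,
    ← L.intervalIntegral_comp_comm (hb.intervalIntegrable_smul hy.cont_delay _ _)]
  simp only [map_smul]

lemma const_mul {𝕜 : Type*} [RCLike 𝕜] {y : ℝ → 𝕜} (hb : BddCoef b B) (c : 𝕜) (hy : Sol b y) :
    Sol b (fun t => c * y t) :=
  hy.clm hb (ContinuousLinearMap.mul ℝ 𝕜 c)

lemma sum (hb : BddCoef b B) {ι : Type*} (s : Finset ι) {y : ι → ℝ → E}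
    (hy : ∀ i ∈ s, Sol b (y i)) : Sol b (fun t => ∑ i ∈ s, y i t) := by
  classical
  induction s using Finset.induction_on with
  | empty => simpa using zero
  | insert i s hi ih =>
    simp only [Finset.sum_insert hi]
    exact (hy i (by simp)).add hb (ih fun j hj => hy j (by simp [hj]))

lemma neg (hy : Sol b y) : Sol b (fun t => - y t) := by
  refine ⟨hy.cont.neg, fun τ t h1 h2 => ?_⟩
  rw [hy.eqn τ t h1 h2]
  simp only [smul_neg, intervalIntegral.integral_neg]
  abel

lemma sub (hb : BddCoef b B) (hy : Sol b y) (hz : Sol b z) : Sol b (fun t => y t - z t) := by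
  simpa [sub_eq_add_neg] using hy.add hb hz.neg

lemma norm_le (hb : BddCoef b B) (hy : Sol b y) {S : ℝ} (h0 : ∀ t ∈ I01, ‖y t‖ ≤ S) (N : ℕ)
    {t : ℝ} (ht : -1 ≤ t) (htN : t ≤ N) : ‖y t‖ ≤ (1 + B) ^ N * S := by
  have hS : 0 ≤ S := (norm_nonneg _).trans (h0 0 (by simp [I01]))
  have hB := hb.nonneg
  induction N generalizing t with
  | zero => simpa using h0 t ⟨ht, by simpa using htN⟩
  | succ N ih =>
    push_cast at htN
    have hN : (0 : ℝ) ≤ N := N.cast_nonneg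
    have hle : (1 + B) ^ N * S ≤ (1 + B) ^ (N + 1) * S := by
      gcongr <;> linarith
    rcases le_total t N with h | h
    · exact (ih ht h).trans hle
    · rw [hy.eqn N t hN h]
      have h1 := hb.norm_integral_le (g := fun q => y (q - 1)) h
        (fun q hq => ih (t := q - 1) (by linarith [hq.1]) (by linarith [hq.2]))
      have h2 := ih (t := N) (by linarith) le_rfl
      have h3 : B * ((1 + B) ^ N * S) * (t - N) ≤ B * ((1 + B) ^ N * S) * 1 := by
        gcongr; linarith
      calc _ ≤ ‖y N‖ + _ := norm_sub_le _ _
        _ ≤ (1 + B) ^ N * S + B * ((1 + B) ^ N * S) * 1 := add_le_add h2 (h1.trans h3)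
        _ = _ := by ring

lemma lipschitz (hb : BddCoef b B) (hy : Sol b y) {S N : ℝ}
    (hS : ∀ t, -1 ≤ t → t ≤ N → ‖y t‖ ≤ S) {τ t : ℝ} (hτ : 0 ≤ τ) (h : τ ≤ t) (ht : t ≤ N) :
    ‖y t - y τ‖ ≤ B * S * (t - τ) := by
  rw [hy.eqn τ t hτ h, sub_sub_cancel_left, norm_neg]
  exact hb.norm_integral_le h fun q hq => hS _ (by linarith [hq.1]) (by linarith [hq.2])

lemma eq_of_eq (hb : BddCoef b B) (hy : Sol b y) (hz : Sol b z) (h0 : ∀ t ∈ I01, y t = z t)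
    {t : ℝ} (ht : -1 ≤ t) : y t = z t := by
  obtain ⟨N, hN⟩ := exists_nat_ge t
  have := (hy.sub hb hz).norm_le hb (S := 0) (fun t ht => by simp [h0 t ht]) N ht hN
  simpa [sub_eq_zero] using this

lemma shift {γ : ℝ} (hγ : 0 ≤ γ) (hper : ∀ᵐ t ∂volume, b (t + γ) = b t) (hy : Sol b y) :
    Sol b (fun t => y (γ + t)) := by
  refine ⟨hy.cont.comp (by fun_prop), fun τ t h1 h2 => ?_⟩
  rw [hy.eqn (γ + τ) (γ + t) (by linarith) (by linarith)]
  congr 1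
  rw [show γ + τ = τ + γ by ring, show γ + t = t + γ by ring,
    ← intervalIntegral.integral_comp_add_right]
  refine intervalIntegral.integral_congr_ae ?_
  filter_upwards [hper] with q hq _
  rw [hq]
  congr 2
  ring

lemma shift_nat {γ : ℝ} (hγ : 0 ≤ γ) (hper : ∀ᵐ t ∂volume, b (t + γ) = b t) (hy : Sol b y)
    (n : ℕ) : Sol b (fun t => y (n * γ + t)) := by
  induction n with
  | zero => simpa using hy
  | succ n ih =>
    have := ih.shift hγ hper
    convert this using 3
    push_cast; ring

end Sol

section Existence

variable {E : Type*} [NormedAddCommGroup E] [NormedSpace ℝ E] {b : ℝ → ℝ} {B : ℝ}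

/-- One step of the method of steps. -/
def stepMap (b : ℝ → ℝ) (φ y : ℝ → E) (t : ℝ) : E :=
  φ (min t 0) - ∫ q in (0 : ℝ)..max t 0, b q • y (q - 1)

lemma continuous_stepMap (hb : BddCoef b B) {φ y : ℝ → E} (hφ : Continuous φ)
    (hy : Continuous y) : Continuous (stepMap b φ y) := by
  refine (hφ.comp (by fun_prop)).sub ?_
  refine (intervalIntegral.continuous_primitive (fun s t => ?_) 0).comp (by fun_prop)
  exact hb.intervalIntegrable_smul (g := fun q => y (q - 1)) (hy.comp (by fun_prop)) s t

/-- Iterates of the method of steps, stabilizing on `(-∞, n]` at stage `n`. -/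
def stepIter (b : ℝ → ℝ) (φ : ℝ → E) : ℕ → ℝ → E
  | 0 => fun t => φ (min t 0)
  | n + 1 => stepMap b φ (stepIter b φ n)

lemma continuous_stepIter (hb : BddCoef b B) {φ : ℝ → E} (hφ : Continuous φ) (n : ℕ) :
    Continuous (stepIter b φ n) := by
  induction n with
  | zero => exact hφ.comp (by fun_prop)
  | succ n ih => exact continuous_stepMap hb hφ ih

lemma stepIter_succ_eq (φ : ℝ → E) (n : ℕ) {t : ℝ} (ht : t ≤ n) :
    stepIter b φ (n + 1) t = stepIter b φ n t := by
  induction n generalizing t with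
  | zero =>
    have ht : t ≤ 0 := by simpa using ht
    simp [stepIter, stepMap, ht]
  | succ n ih =>
    change stepMap b φ (stepIter b φ (n + 1)) t = stepMap b φ (stepIter b φ n) t
    unfold stepMap
    congr 1
    refine intervalIntegral.integral_congr fun q hq => ?_
    rw [Set.uIcc_of_le (le_max_right _ _)] at hq
    push_cast at ht
    have : q ≤ n + 1 := hq.2.trans (max_le ht (by positivity))
    rw [ih (by linarith)]

lemma stepIter_eq_of_le (φ : ℝ → E) {n k : ℕ} (hnk : n ≤ k) {t : ℝ} (ht : t ≤ n) :
    stepIter b φ k t = stepIter b φ n t := by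
  induction k, hnk using Nat.le_induction with
  | base => rfl
  | succ k hk ih =>
    rw [stepIter_succ_eq φ k (ht.trans (by exact_mod_cast hk)), ih]

theorem exists_sol (hb : BddCoef b B) {φ : ℝ → E} (hφ : Continuous φ) :
    ∃ y : ℝ → E, Sol b y ∧ ∀ t ≤ 0, y t = φ t := by
  have key : ∀ (n : ℕ) (t : ℝ), t ≤ n → stepIter b φ ⌈t⌉₊ t = stepIter b φ n t := fun n t ht =>
    (stepIter_eq_of_le φ (Nat.ceil_le.2 ht) (Nat.le_ceil t)).symm
  have hcont : Continuous fun t : ℝ => stepIter b φ ⌈t⌉₊ t := by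
    rw [continuous_iff_continuousAt]
    intro t
    obtain ⟨n, hn⟩ := exists_nat_gt t
    refine (continuous_stepIter hb hφ n).continuousAt.congr ?_
    filter_upwards [eventually_lt_nhds hn] with s hs
    exact (key n s hs.le).symm
  have h0 : ∀ t, stepIter b φ ⌈t⌉₊ t =
      φ (min t 0) - ∫ q in (0 : ℝ)..max t 0, b q • stepIter b φ ⌈q - 1⌉₊ (q - 1) := by
    intro t
    obtain ⟨n, hn⟩ := exists_nat_ge t
    rw [key (n + 1) t (by push_cast; linarith)]
    change stepMap b φ (stepIter b φ n) t = _
    unfold stepMap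
    congr 1
    refine intervalIntegral.integral_congr fun q hq => ?_
    rw [Set.uIcc_of_le (le_max_right _ _)] at hq
    have : q ≤ n := hq.2.trans (max_le hn (by positivity))
    rw [key n (q - 1) (by linarith)]
  refine ⟨fun t => stepIter b φ ⌈t⌉₊ t, ⟨hcont, fun τ t hτ h => ?_⟩, fun t ht => ?_⟩
  · rw [h0 t, h0 τ, min_eq_right (hτ.trans h), min_eq_right hτ, max_eq_left (hτ.trans h),
      max_eq_left hτ]
    have i := hb.intervalIntegrable_smul (g := fun q => stepIter b φ ⌈q - 1⌉₊ (q - 1))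
      (hcont.comp (by fun_prop : Continuous fun q : ℝ => q - 1))
    rw [← intervalIntegral.integral_add_adjacent_intervals (i 0 τ) (i τ t)]
    abel
  · rw [show (fun t => stepIter b φ ⌈t⌉₊ t) t = _ from h0 t, min_eq_left ht, max_eq_right ht]
    simp

end Existence

/-- Continuous alternating functions of `m` time variables solving the delay equation in each of
them. -/
structure Cls {E : Type*} [NormedAddCommGroup E] [NormedSpace ℝ E] {m : ℕ} (b : ℝ → ℝ)
    (K : (Fin m → ℝ) → E) : Prop where
  cont : Continuous K
  alt : ∀ (σ : Equiv.Perm (Fin m)) (x : Fin m → ℝ),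
    K (x ∘ σ) = ((Equiv.Perm.sign σ : ℤ) : ℝ) • K x
  sol : ∀ (j : Fin m) (x : Fin m → ℝ), Sol b fun t => K (Function.update x j t)

/-- The determinant `det (y i (x j))`. -/
def detOf {𝕜 : Type*} [RCLike 𝕜] {m : ℕ} (y : Fin m → ℝ → 𝕜) (x : Fin m → ℝ) : 𝕜 :=
  (Matrix.of fun i j => y i (x j)).det

lemma cls_detOf {𝕜 : Type*} [RCLike 𝕜] {m : ℕ} {b : ℝ → ℝ} {B : ℝ} (hb : BddCoef b B)
    {y : Fin m → ℝ → 𝕜} (hy : ∀ i, Sol b (y i)) : Cls b (detOf y) := by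
  refine ⟨?_, fun σ x => ?_, fun j x => ?_⟩
  · unfold detOf
    refine Continuous.matrix_det ?_
    refine continuous_matrix fun i j => ?_
    exact (hy i).cont.comp (continuous_apply j)
  · have := Matrix.det_permute' σ (Matrix.of fun i j => y i (x j))
    unfold detOf
    rw [RCLike.real_smul_eq_coe_mul]
    have h2 : (((((Equiv.Perm.sign σ : ℤ) : ℝ)) : 𝕜)) = ((Equiv.Perm.sign σ : ℤ) : 𝕜) := by
      push_cast; rfl
    rw [h2, ← this]
    rfl
  · have : (fun t => detOf y (Function.update x j t)) = fun t => ∑ i,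
        (Matrix.of fun i j => y i (x j)).adjugate j i * y i t := by
      funext t
      have h1 := Matrix.cramer_apply (Matrix.of fun i j => y i (x j)) (fun i => y i t) j
      rw [Matrix.cramer_eq_adjugate_mulVec] at h1
      simp only [Matrix.mulVec, dotProduct] at h1
      rw [h1]
      unfold detOf
      congr 1
      ext i l
      by_cases h : l = j
      · subst h; simp
      · simp [h]
    rw [this]
    exact Sol.sum hb _ fun i _ => (hy i).const_mul hb _

namespace Cls

variable {E : Type*} [NormedAddCommGroup E] [NormedSpace ℝ E] {m : ℕ} {b : ℝ → ℝ} {B : ℝ}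
  {K L : (Fin m → ℝ) → E}

lemma add (hb : BddCoef b B) (hK : Cls b K) (hL : Cls b L) : Cls b (fun x => K x + L x) :=
  ⟨hK.cont.add hL.cont, fun σ x => by rw [hK.alt, hL.alt, smul_add],
    fun j x => (hK.sol j x).add hb (hL.sol j x)⟩

lemma clm {F : Type*} [NormedAddCommGroup F] [NormedSpace ℝ F] [CompleteSpace E] [CompleteSpace F]
    (hb : BddCoef b B) (T : E →L[ℝ] F) (hK : Cls b K) : Cls b (fun x => T (K x)) :=
  ⟨T.continuous.comp hK.cont, fun σ x => by rw [hK.alt, map_smul],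
    fun j x => (hK.sol j x).clm hb T⟩

lemma const_mul {𝕜 : Type*} [RCLike 𝕜] {K : (Fin m → ℝ) → 𝕜} (hb : BddCoef b B) (c : 𝕜)
    (hK : Cls b K) : Cls b (fun x => c * K x) :=
  hK.clm hb (ContinuousLinearMap.mul ℝ 𝕜 c)

lemma shift_nat {γ : ℝ} (hγ : 0 ≤ γ) (hper : ∀ᵐ t ∂volume, b (t + γ) = b t) (hK : Cls b K)
    (n : ℕ) : Cls b (fun x => K (fun i => n * γ + x i)) := by
  refine ⟨hK.cont.comp (by fun_prop), fun σ x => ?_, fun j x => ?_⟩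
  · rw [← hK.alt]; rfl
  · have := (hK.sol j (fun i => n * γ + x i)).shift_nat hγ hper n
    convert this using 3 with t
    ext i
    by_cases h : i = j
    · subst h; simp
    · simp [h]

lemma eq_zero (hK : Cls b K) {x : Fin m → ℝ} {i j : Fin m} (hij : i ≠ j) (hx : x i = x j) :
    K x = 0 := by
  have h := hK.alt (Equiv.swap i j) x
  have h2 : x ∘ Equiv.swap i j = x := by
    ext l
    simp only [Function.comp]
    rcases eq_or_ne l i with rfl | h1
    · simp [hx]
    · rcases eq_or_ne l j with rfl | h3
      · simp [hx]
      · rw [Equiv.swap_apply_of_ne_of_ne h1 h3]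
  rw [h2, Equiv.Perm.sign_swap hij] at h
  have h3 : (2 : ℝ) • K x = 0 := by
    rw [two_smul]
    exact eq_neg_iff_add_eq_zero.1 (by simpa using h)
  simpa using h3

lemma norm_le (hb : BddCoef b B) (hK : Cls b K) {S : ℝ}
    (h0 : ∀ x : Fin m → ℝ, (∀ i, x i ∈ I01) → ‖K x‖ ≤ S) (N : ℕ) {x : Fin m → ℝ}
    (hx : ∀ i, x i ∈ Set.Icc (-1 : ℝ) N) : ‖K x‖ ≤ ((1 + B) ^ N) ^ m * S := by
  suffices H : ∀ (J : Finset (Fin m)) (x : Fin m → ℝ), (∀ i ∈ J, x i ∈ Set.Icc (-1 : ℝ) N) →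
      (∀ i ∉ J, x i ∈ I01) → ‖K x‖ ≤ ((1 + B) ^ N) ^ J.card * S by
    have := H Finset.univ x (fun i _ => hx i) (by simp)
    simpa using this
  intro J
  induction J using Finset.induction_on with
  | empty => intro x _ h2; simpa using h0 x fun i => h2 i (by simp)
  | insert j J hj ih =>
    intro x h1 h2
    have hs := (hK.sol j x).norm_le hb (S := ((1 + B) ^ N) ^ J.card * S) (fun t ht => by
      refine ih _ (fun i hi => ?_) (fun i hi => ?_)
      · have : i ≠ j := by rintro rfl; exact hj hi
        simpa [this] using h1 i (by simp [hi])
      · by_cases hij : i = j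
        · subst hij; simpa using ht
        · simpa [hij] using h2 i (by simp [hij, hi])) N (t := x j) (h1 j (by simp)).1
        (h1 j (by simp)).2
    rw [Function.update_eq_self] at hs
    rw [Finset.card_insert_of_notMem hj, pow_succ]
    linarith [hs, show (1 + B) ^ N * (((1 + B) ^ N) ^ J.card * S) =
      ((1 + B) ^ N) ^ J.card * (1 + B) ^ N * S by ring]

lemma norm_le_of_sorted (hK : Cls b K) {S : ℝ} (h0 : ∀ θ ∈ TsetR m, ‖K θ‖ ≤ S)
    {x : Fin m → ℝ} (hx : ∀ i, x i ∈ I01) : ‖K x‖ ≤ S := by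
  have := h0 (x ∘ Tuple.sort x) ⟨fun i => hx _, Tuple.monotone_sort x⟩
  rw [hK.alt, norm_smul] at this
  rcases Int.units_eq_one_or (Equiv.Perm.sign (Tuple.sort x)) with h | h <;> simpa [h] using this

end Cls

lemma umFun_two (θ : Fin 2 → ℝ) : umFun 2 θ = θ 1 - θ 0 := by
  simp [umFun, Finset.prod_filter, Fintype.prod_prod_type, Fin.prod_univ_succ]

lemma umFun_three (θ : Fin 3 → ℝ) :
    umFun 3 θ = (θ 1 - θ 0) * (θ 2 - θ 0) * (θ 2 - θ 1) * (1 + θ 0 - θ 1) := by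
  simp [umFun, Finset.prod_filter, Fintype.prod_prod_type, Fin.prod_univ_succ]

lemma PosCoef.bddCoef {m : ℕ} {b : ℝ → ℝ} {b₁ b₂ : ℝ}
    (h : PosCoef (fun t => (-1) ^ m * b t) b₁ b₂) : BddCoef b b₂ := by
  have hone : ((-1 : ℝ) ^ m) * (-1) ^ m = 1 := by rw [← mul_pow]; simp
  refine ⟨?_, h.pos_right.le, ?_⟩
  · have := h.locInt.smul ((-1 : ℝ) ^ m)
    convert this using 1
    ext t
    simp [← mul_assoc, hone]
  · filter_upwards [h.bounds] with t ht
    have h1 : |(-1) ^ m * b t| = |b t| := by rw [abs_mul]; simp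
    rw [← h1, abs_of_nonneg (h.pos.le.trans ht.1)]
    exact ht.2

section Real

variable {b : ℝ → ℝ} {b₁ b₂ : ℝ}

lemma Cls.evol2 {K : (Fin 2 → ℝ) → ℝ} (hK : Cls b K) :
    Evol2 (fun t => (-1) ^ 2 * b t) (fun s t => K ![s, t]) := by
  refine ⟨hK.cont.comp (by fun_prop), fun s => hK.eq_zero (i := 0) (j := 1) (by simp) (by simp),
    fun s τ t h1 h2 => ?_⟩
  have := (hK.sol 1 ![s, 0]).eqn τ t h1 h2
  have e1 : ∀ r, Function.update ![s, 0] 1 r = ![s, r] := fun r => by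
    ext i; fin_cases i <;> simp
  simp only [e1] at this
  rw [this, sub_eq_add_neg, ← intervalIntegral.integral_neg]
  congr 2
  funext q
  have h3 := hK.alt (Equiv.swap 0 1) ![q - 1, s]
  rw [Equiv.Perm.sign_swap (by simp)] at h3
  have e2 : ![q - 1, s] ∘ Equiv.swap (0 : Fin 2) 1 = ![s, q - 1] := by
    ext i; fin_cases i <;> simp
  rw [e2] at h3
  rw [h3]
  simp

lemma Cls.evol3 {K : (Fin 3 → ℝ) → ℝ} (hK : Cls b K) :
    Evol3 (fun t => (-1) ^ 3 * b t) (fun r s t => K ![r, s, t]) := by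
  refine ⟨hK.cont.comp (by fun_prop),
    fun r s => hK.eq_zero (i := 1) (j := 2) (by simp) (by simp),
    fun r t => hK.eq_zero (i := 0) (j := 1) (by simp) (by simp),
    fun r s τ t h1 h2 => ?_⟩
  have := (hK.sol 2 ![r, s, 0]).eqn τ t h1 h2
  have e1 : ∀ q, Function.update ![r, s, 0] 2 q = ![r, s, q] := fun q => by
    ext i; fin_cases i <;> rfl
  simp only [e1] at this
  rw [this, sub_eq_add_neg, ← intervalIntegral.integral_neg]
  congr 2
  funext q
  have h3 := hK.alt (finRotate 3) ![q - 1, r, s]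
  rw [sign_finRotate] at h3
  have e2 : ![q - 1, r, s] ∘ finRotate 3 = ![r, s, q - 1] := by
    ext i; fin_cases i <;> rfl
  rw [e2] at h3
  rw [h3]
  norm_num

variable {m : ℕ} {K : (Fin m → ℝ) → ℝ}

lemma fin2_eta (θ : Fin 2 → ℝ) : ![θ 0, θ 1] = θ := by
  ext i; fin_cases i <;> rfl

lemma fin3_eta (θ : Fin 3 → ℝ) : ![θ 0, θ 1, θ 2] = θ := by
  ext i; fin_cases i <;> rfl

lemma mem_TsetR_two {s t : ℝ} (h1 : -1 ≤ s) (h2 : s ≤ t) (h3 : t ≤ 0) : ![s, t] ∈ TsetR 2 := by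
  refine ⟨fun i => ?_, fun i j hij => ?_⟩
  · fin_cases i <;> constructor <;> simp <;> linarith
  · fin_cases i <;> fin_cases j <;> simp_all

lemma mem_TsetR_three {r s t : ℝ} (h1 : -1 ≤ r) (h2 : r ≤ s) (h3 : s ≤ t) (h4 : t ≤ 0) :
    ![r, s, t] ∈ TsetR 3 := by
  refine ⟨fun i => ?_, fun i j hij => ?_⟩
  · fin_cases i <;> constructor <;> simp <;> linarith
  · fin_cases i <;> fin_cases j <;> simp_all
    linarith

theorem Cls.nonneg (hm : m = 2 ∨ m = 3) (ha : PosCoef (fun t => (-1) ^ m * b t) b₁ b₂)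
    (hK : Cls b K) (h0 : ∀ θ ∈ TsetR m, 0 ≤ K θ) {τ : ℝ} (hτ : 0 ≤ τ) {θ : Fin m → ℝ}
    (hθ : θ ∈ TsetR m) : 0 ≤ K (fun i => τ + θ i) := by
  rcases hm with rfl | rfl
  · rw [← fin2_eta fun i => τ + θ i]
    have h01 := hθ.2 (show (0 : Fin 2) ≤ 1 by decide)
    exact hK.evol2.nonneg ha (fun s t h1 h2 h3 => h0 _ (mem_TsetR_two h1 h2 h3))
      (by linarith [(hθ.1 0).1]) (by linarith) (by linarith [(hθ.1 0).1, (hθ.1 1).2])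
  · rw [← fin3_eta fun i => τ + θ i]
    have h01 := hθ.2 (show (0 : Fin 3) ≤ 1 by decide)
    have h12 := hθ.2 (show (1 : Fin 3) ≤ 2 by decide)
    exact hK.evol3.nonneg ha (fun r s t h1 h2 h3 h4 => h0 _ (mem_TsetR_three h1 h2 h3 h4))
      (by linarith [(hθ.1 0).1]) (by linarith) (by linarith)
      (by linarith [(hθ.1 0).1, (hθ.1 2).2])

lemma umFun_nonneg (hm : m = 2 ∨ m = 3) {θ : Fin m → ℝ} (hθ : θ ∈ TsetR m) : 0 ≤ umFun m θ := by
  rcases hm with rfl | rfl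
  · rw [umFun_two]
    linarith [hθ.2 (show (0 : Fin 2) ≤ 1 by decide)]
  · rw [umFun_three]
    have h01 := hθ.2 (show (0 : Fin 3) ≤ 1 by decide)
    have h12 := hθ.2 (show (1 : Fin 3) ≤ 2 by decide)
    have e1 : 0 ≤ θ 1 - θ 0 := by linarith
    have e2 : 0 ≤ θ 2 - θ 1 := by linarith
    have e3 : 0 ≤ θ 2 - θ 0 := by linarith
    have e4 : 0 ≤ 1 + θ 0 - θ 1 := by linarith [(hθ.1 0).1, (hθ.1 1).2]
    positivity

theorem Cls.upper_bound (hm : m = 2 ∨ m = 3) (ha : PosCoef (fun t => (-1) ^ m * b t) b₁ b₂)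
    (T' : ℝ) : ∃ C > 0, ∀ (K : (Fin m → ℝ) → ℝ), Cls b K → ∀ S, (∀ θ ∈ TsetR m, |K θ| ≤ S) →
    ∀ τ, 2 ≤ τ → τ ≤ T' → ∀ θ ∈ TsetR m, |K (fun i => τ + θ i)| ≤ C * S * umFun m θ := by
  obtain ⟨N, hN⟩ := exists_nat_ge T'
  have hb2 := ha.pos_right
  refine ⟨b₂ ^ (3 * m - 5) * ((1 + b₂) ^ N) ^ m, by positivity,
    fun K hK S hS τ h2 hτT θ hθ => ?_⟩
  have hbd := fun x hx => hK.norm_le ha.bddCoef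
    (fun x hx => hK.norm_le_of_sorted (S := S) hS hx) N (x := x) hx
  simp only [Real.norm_eq_abs] at hbd
  rcases hm with rfl | rfl
  · rw [← fin2_eta fun i => τ + θ i]
    have h01 := hθ.2 (show (0 : Fin 2) ≤ 1 by decide)
    have := hK.evol2.abs_le ha (s := τ + θ 0) (t := τ + θ 1) (S := ((1 + b₂) ^ N) ^ 2 * S)
      (by linarith [(hθ.1 0).1])
      (by linarith) (fun q hq => hbd _ (fun i => by
        have e1 := hq.1; have e2 := hq.2
        have e3 := (hθ.1 0).1; have e4 := (hθ.1 1).2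
        fin_cases i <;> constructor <;> simp <;> linarith))
    rw [umFun_two]
    refine this.trans (le_of_eq ?_)
    simp only [Nat.reduceMul, Nat.reduceSub, pow_one]
    ring
  · rw [← fin3_eta fun i => τ + θ i]
    have h01 := hθ.2 (show (0 : Fin 3) ≤ 1 by decide)
    have h12 := hθ.2 (show (1 : Fin 3) ≤ 2 by decide)
    have := hK.evol3.upper_bound ha (N := N) (S := ((1 + b₂) ^ N) ^ 3 * S)
      (fun r s t h1 h2 h3 h4 h5 h6 => hbd _ (fun i => by
        fin_cases i <;> constructor <;> simpa))
      (r := τ + θ 0) (s := τ + θ 1) (t := τ + θ 2) (by linarith [(hθ.1 0).1]) (by linarith)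
      (by linarith) (by linarith [(hθ.1 0).1, (hθ.1 2).2]) (by linarith [(hθ.1 2).2])
    rw [umFun_three]
    refine this.trans (le_of_eq ?_)
    norm_num
    ring

theorem Cls.lower_bound (hm : m = 2 ∨ m = 3) (ha : PosCoef (fun t => (-1) ^ m * b t) b₁ b₂)
    (hK : Cls b K) (h0 : ∀ θ ∈ TsetR m, 0 ≤ K θ) (h1 : ∃ θ ∈ TsetR m, K θ ≠ 0) :
    ∃ T : ℝ, ∀ T' : ℝ, ∃ c > 0, ∀ τ, T ≤ τ → τ ≤ T' → ∀ θ ∈ TsetR m,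
      c * umFun m θ ≤ K (fun i => τ + θ i) := by
  obtain ⟨p, hp, hpK⟩ := h1
  have hp0 : 0 < K p := lt_of_le_of_ne (h0 p hp) hpK.symm
  rcases hm with rfl | rfl
  · rw [← fin2_eta p] at hp0
    obtain ⟨T, hT⟩ := hK.evol2.lower_bound ha (fun s t e1 e2 e3 => hK.evol2.nonneg ha
      (fun s t h1 h2 h3 => h0 _ (mem_TsetR_two h1 h2 h3)) e1 e2 e3) (hp.1 0).1
      (hp.2 (show (0 : Fin 2) ≤ 1 by decide)) (hp.1 1).2 hp0
    refine ⟨T + 1, fun T' => ?_⟩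
    obtain ⟨c, hc, H⟩ := hT T'
    refine ⟨c, hc, fun τ e1 e2 θ hθ => ?_⟩
    have h01 := hθ.2 (show (0 : Fin 2) ≤ 1 by decide)
    rw [← fin2_eta fun i => τ + θ i, umFun_two]
    have := H (τ + θ 0) (τ + θ 1) (by linarith [(hθ.1 1).1]) (by linarith [(hθ.1 1).2])
      (by linarith) (by linarith [(hθ.1 0).1, (hθ.1 1).2])
    rwa [add_sub_add_left_eq_sub] at this
  · rw [← fin3_eta p] at hp0
    obtain ⟨T, hT⟩ := hK.evol3.lower_bound ha (fun r s t e1 e2 e3 e4 => hK.evol3.nonneg ha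
      (fun r s t h1 h2 h3 h4 => h0 _ (mem_TsetR_three h1 h2 h3 h4)) e1 e2 e3 e4) (hp.1 0).1
      (hp.2 (show (0 : Fin 3) ≤ 1 by decide)) (hp.2 (show (1 : Fin 3) ≤ 2 by decide))
      (hp.1 2).2 hp0
    refine ⟨T + 1, fun T' => ?_⟩
    obtain ⟨c, hc, H⟩ := hT T'
    refine ⟨c, hc, fun τ e1 e2 θ hθ => ?_⟩
    have h01 := hθ.2 (show (0 : Fin 3) ≤ 1 by decide)
    have h12 := hθ.2 (show (1 : Fin 3) ≤ 2 by decide)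
    rw [← fin3_eta fun i => τ + θ i, umFun_three]
    have := H (τ + θ 0) (τ + θ 1) (τ + θ 2) (by linarith [(hθ.1 2).1]) (by linarith [(hθ.1 2).2])
      (by linarith) (by linarith) (by linarith [(hθ.1 0).1, (hθ.1 2).2])
    refine le_trans (le_of_eq ?_) this
    ring

end Real

lemma Cls.shift {E : Type*} [NormedAddCommGroup E] [NormedSpace ℝ E] {m : ℕ} {b : ℝ → ℝ}
    {K : (Fin m → ℝ) → E} {γ : ℝ} (hγ : 0 ≤ γ) (hper : ∀ᵐ t ∂volume, b (t + γ) = b t)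
    (hK : Cls b K) : Cls b (fun x => K (fun i => γ + x i)) := by
  simpa using hK.shift_nat hγ hper 1

section Frame

variable {𝕜 : Type*} [RCLike 𝕜] {m : ℕ}

lemma detOf_congr {y z : Fin m → ℝ → 𝕜} {x x' : Fin m → ℝ} (h : ∀ i j, y i (x j) = z i (x' j)) :
    detOf y x = detOf z x' := by
  unfold detOf
  congr 1
  ext i j
  exact h i j

lemma detOf_update (y : Fin m → ℝ → 𝕜) (θ : Fin m → ℝ) (j : Fin m) (t : ℝ) :
    detOf y (Function.update θ j t) =
      (Matrix.of fun i j => y i (θ j)).cramer (fun i => y i t) j := by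
  rw [Matrix.cramer_apply]
  unfold detOf
  congr 1
  ext i l
  by_cases h : l = j
  · subst h; simp
  · simp [h]

/-- The combinations of the `y i` dual to evaluation at the points `θ j`. -/
def frame (y : Fin m → ℝ → 𝕜) (θ : Fin m → ℝ) (j : Fin m) (t : ℝ) : 𝕜 :=
  (detOf y θ)⁻¹ * detOf y (Function.update θ j t)

lemma eq_sum_frame (y : Fin m → ℝ → 𝕜) {θ : Fin m → ℝ} (h : detOf y θ ≠ 0) (i : Fin m) (t : ℝ) :
    y i t = ∑ j, y i (θ j) * frame y θ j t := by
  have h1 := congrFun (Matrix.mulVec_cramer (Matrix.of fun i j => y i (θ j)) (fun i => y i t)) i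
  simp only [Matrix.mulVec, dotProduct, Pi.smul_apply, smul_eq_mul, Matrix.of_apply] at h1
  simp only [frame, detOf_update]
  have h2 : ∑ j, y i (θ j) * ((detOf y θ)⁻¹ *
      (Matrix.of fun i j => y i (θ j)).cramer (fun i => y i t) j) =
      (detOf y θ)⁻¹ * ∑ j, y i (θ j) * (Matrix.of fun i j => y i (θ j)).cramer (fun i => y i t) j := by
    rw [Finset.mul_sum]
    exact Finset.sum_congr rfl fun j _ => by ring
  rw [h2, h1]
  change _ = (detOf y θ)⁻¹ * (detOf y θ * _)
  field_simp

lemma detOf_frame (y : Fin m → ℝ → 𝕜) {θ : Fin m → ℝ} (h : detOf y θ ≠ 0) (x : Fin m → ℝ) :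
    detOf (frame y θ) x = (detOf y θ)⁻¹ * detOf y x := by
  have : (Matrix.of fun i j => y i (x j)) =
      (Matrix.of fun i j => y i (θ j)) * (Matrix.of fun i j => frame y θ i (x j)) := by
    ext i j
    simpa [Matrix.mul_apply] using eq_sum_frame y h i (x j)
  have h2 := congrArg Matrix.det this
  rw [Matrix.det_mul] at h2
  change detOf y x = detOf y θ * detOf (frame y θ) x at h2
  rw [h2]
  field_simp

lemma frame_apply (y : Fin m → ℝ → 𝕜) {θ : Fin m → ℝ} (h : detOf y θ ≠ 0) (i j : Fin m) :
    frame y θ i (θ j) = if i = j then 1 else 0 := by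
  have h1 : (Matrix.of fun i j => y i (θ j)) * (Matrix.of fun i j => frame y θ i (θ j)) =
      (Matrix.of fun i j => y i (θ j)) := by
    ext i j
    simpa [Matrix.mul_apply] using (eq_sum_frame y h i (θ j)).symm
  have hu : IsUnit (Matrix.of fun i j => y i (θ j)) :=
    (Matrix.isUnit_iff_isUnit_det _).2 (isUnit_iff_ne_zero.2 h)
  have h2 : (Matrix.of fun i j => frame y θ i (θ j)) = 1 := by
    exact hu.mul_left_cancel (h1.trans (mul_one _).symm)
  simpa [Matrix.one_apply] using congrFun (congrFun h2 i) j

end Frame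

lemma isCompact_TsetR (m : ℕ) : IsCompact (TsetR m) := by
  refine (isCompact_univ_pi (s := fun _ : Fin m => Set.Icc (-1 : ℝ) 0)
    fun _ => isCompact_Icc).of_isClosed_subset ?_ fun θ hθ i _ => hθ.1 i
  have : TsetR m = (⋂ i, {θ : Fin m → ℝ | θ i ∈ Set.Icc (-1 : ℝ) 0}) ∩
      ⋂ i, ⋂ j, ⋂ (_ : i ≤ j), {θ : Fin m → ℝ | θ i ≤ θ j} := by
    ext θ
    simp [TsetR, Monotone]
  rw [this]
  refine IsClosed.inter (isClosed_iInter fun i => isClosed_Icc.preimage (continuous_apply i)) ?_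
  exact isClosed_iInter fun i => isClosed_iInter fun j => isClosed_iInter fun _ =>
    isClosed_le (continuous_apply i) (continuous_apply j)

lemma exists_umFun_pos {m : ℕ} (hm : m = 2 ∨ m = 3) : ∃ θ ∈ TsetR m, 0 < umFun m θ := by
  rcases hm with rfl | rfl
  · refine ⟨![-1, 0], mem_TsetR_two (by norm_num) (by norm_num) (by norm_num), ?_⟩
    rw [umFun_two]; norm_num
  · refine ⟨![-1, -1 / 2, 0], mem_TsetR_three (by norm_num) (by norm_num) (by norm_num)
      (by norm_num), ?_⟩
    rw [umFun_three]
    change (0 : ℝ) < (-1 / 2 - -1) * (0 - -1) * (0 - -1 / 2) * (1 + -1 - -1 / 2)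
    norm_num

lemma exists_nat_mul_ge {γ : ℝ} (hγ : 0 < γ) (T : ℝ) : ∃ n : ℕ, T ≤ n * γ := by
  obtain ⟨n, hn⟩ := exists_nat_ge (T / γ)
  exact ⟨n, (div_le_iff₀ hγ).1 hn⟩

/-- Solution tuples whose determinant is nonnegative on `T_m`, not identically zero there, and
multiplied by at least `c` over one period. -/
structure Good {m : ℕ} (b : ℝ → ℝ) (γ c : ℝ) (y : Fin m → ℝ → ℝ) : Prop where
  sol : ∀ i, Sol b (y i)
  nonneg : ∀ θ ∈ TsetR m, 0 ≤ detOf y θ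
  ne : ∃ θ ∈ TsetR m, detOf y θ ≠ 0
  le : ∀ θ ∈ TsetR m, c * detOf y θ ≤ detOf y (fun i => γ + θ i)

section Perron

variable {m : ℕ} {b : ℝ → ℝ} {b₁ b₂ γ c : ℝ} {y : Fin m → ℝ → ℝ}

lemma Good.cls (ha : PosCoef (fun t => (-1) ^ m * b t) b₁ b₂) (h : Good b γ c y) :
    Cls b (detOf y) := cls_detOf ha.bddCoef h.sol

lemma Good.cls_sub (hγ : 0 < γ) (hper : ∀ᵐ t ∂volume, b (t + γ) = b t)
    (ha : PosCoef (fun t => (-1) ^ m * b t) b₁ b₂) (h : Good b γ c y) :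
    Cls b (fun x => detOf y (fun i => γ + x i) - c * detOf y x) := by
  have := ((h.cls ha).shift hγ.le hper).add ha.bddCoef ((h.cls ha).const_mul ha.bddCoef (-c))
  simpa [sub_eq_add_neg] using this

lemma Good.exists_max (ha : PosCoef (fun t => (-1) ^ m * b t) b₁ b₂) (h : Good b γ c y) :
    ∃ θ ∈ TsetR m, 0 < detOf y θ ∧ ∀ x : Fin m → ℝ, (∀ i, x i ∈ I01) →
      |detOf y x| ≤ detOf y θ := by
  obtain ⟨p, hp, hpK⟩ := h.ne
  obtain ⟨θ, hθ, hmax⟩ := (isCompact_TsetR m).exists_isMaxOn ⟨p, hp⟩ (h.cls ha).cont.continuousOn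
  refine ⟨θ, hθ, (lt_of_le_of_ne (h.nonneg p hp) hpK.symm).trans_le (hmax hp), fun x hx => ?_⟩
  refine (h.cls ha).norm_le_of_sorted (fun x hx => ?_) hx
  rw [Real.norm_eq_abs, abs_of_nonneg (h.nonneg x hx)]
  exact hmax hx

lemma Good.le_nat (hm : m = 2 ∨ m = 3) (hγ : 0 < γ) (hper : ∀ᵐ t ∂volume, b (t + γ) = b t)
    (ha : PosCoef (fun t => (-1) ^ m * b t) b₁ b₂) (h : Good b γ c y) (n : ℕ) {θ : Fin m → ℝ}
    (hθ : θ ∈ TsetR m) :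
    c * detOf y (fun i => n * γ + θ i) ≤ detOf y (fun i => γ + (n * γ + θ i)) := by
  have := (h.cls_sub hγ hper ha).nonneg hm ha (fun θ hθ => by simpa using h.le θ hθ)
    (τ := n * γ) (by positivity) hθ
  linarith

lemma Good.pow_le (hm : m = 2 ∨ m = 3) (hγ : 0 < γ) (hper : ∀ᵐ t ∂volume, b (t + γ) = b t)
    (ha : PosCoef (fun t => (-1) ^ m * b t) b₁ b₂) (h : Good b γ c y) (hc : 0 < c) (n : ℕ)
    {θ : Fin m → ℝ} (hθ : θ ∈ TsetR m) : c ^ n * detOf y θ ≤ detOf y (fun i => n * γ + θ i) := by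
  induction n with
  | zero => simp
  | succ n ih =>
    have h1 := h.le_nat hm hγ hper ha n hθ
    have e : (fun i => ((n + 1 : ℕ) : ℝ) * γ + θ i) = fun i => γ + (n * γ + θ i) := by
      funext i; push_cast; ring
    rw [e]
    refine le_trans ?_ h1
    rw [pow_succ', mul_assoc]
    exact mul_le_mul_of_nonneg_left ih hc.le

lemma Good.shift (hm : m = 2 ∨ m = 3) (hγ : 0 < γ) (hper : ∀ᵐ t ∂volume, b (t + γ) = b t)
    (ha : PosCoef (fun t => (-1) ^ m * b t) b₁ b₂) (h : Good b γ c y) (hc : 0 < c) (n : ℕ) :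
    Good b γ c (fun i t => y i (n * γ + t)) := by
  obtain ⟨θ, hθ, hpos, -⟩ := h.exists_max ha
  refine ⟨fun i => (h.sol i).shift_nat hγ.le hper n,
    fun θ hθ => (h.cls ha).nonneg hm ha h.nonneg (by positivity) hθ, ⟨θ, hθ, ?_⟩, fun θ hθ => ?_⟩
  · exact ((mul_pos (pow_pos hc n) hpos).trans_le (h.pow_le hm hγ hper ha hc n hθ)).ne'
  · have := h.le_nat hm hγ hper ha n hθ
    refine this.trans (le_of_eq ?_)
    exact detOf_congr fun i j => congrArg (y i) (by ring)

lemma exists_good (hm : m = 2 ∨ m = 3) (hγ : 0 < γ) (hper : ∀ᵐ t ∂volume, b (t + γ) = b t)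
    (ha : PosCoef (fun t => (-1) ^ m * b t) b₁ b₂) :
    ∃ c > 0, ∃ y : Fin m → ℝ → ℝ, Good b γ c y := by
  have hex : ∀ i : Fin m, ∃ y : ℝ → ℝ, Sol b y ∧ ∀ t ≤ 0, y t = t ^ (i : ℕ) := fun i =>
    exists_sol ha.bddCoef (by fun_prop)
  choose y hy hy0 using hex
  have hcls : Cls b (detOf y) := cls_detOf ha.bddCoef hy
  have hdet : ∀ θ ∈ TsetR m, detOf y θ = ∏ i, ∏ j ∈ Finset.Ioi i, (θ j - θ i) := by
    intro θ hθ
    rw [← Matrix.det_vandermonde, ← Matrix.det_transpose]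
    unfold detOf
    congr 1
    ext i j
    simp [Matrix.vandermonde, hy0 i _ (hθ.1 j).2]
  have hnn : ∀ θ ∈ TsetR m, 0 ≤ detOf y θ := fun θ hθ => by
    rw [hdet θ hθ]
    refine Finset.prod_nonneg fun i _ => Finset.prod_nonneg fun j hj => ?_
    exact sub_nonneg.2 (hθ.2 (Finset.mem_Ioi.1 hj).le)
  have hm0 : (0 : ℝ) < m := by rcases hm with rfl | rfl <;> norm_num
  have hne : ∃ θ ∈ TsetR m, detOf y θ ≠ 0 := by
    have hlt : ∀ i : Fin m, ((i : ℕ) : ℝ) ≤ m := fun i => by exact_mod_cast i.2.le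
    have hθ : (fun i : Fin m => ((i : ℕ) : ℝ) / m - 1) ∈ TsetR m := by
      refine ⟨fun i => ⟨?_, ?_⟩, fun i j hij => ?_⟩
      · have : 0 ≤ ((i : ℕ) : ℝ) / m := by positivity
        linarith
      · have : ((i : ℕ) : ℝ) / m ≤ 1 := (div_le_one hm0).2 (hlt i)
        linarith
      · have : ((i : ℕ) : ℝ) ≤ (j : ℕ) := by exact_mod_cast hij
        simp only
        gcongr
    refine ⟨_, hθ, ?_⟩
    rw [hdet _ hθ]
    refine (Finset.prod_pos fun i _ => Finset.prod_pos fun j hj => ?_).ne'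
    have : ((i : ℕ) : ℝ) < (j : ℕ) := by exact_mod_cast Finset.mem_Ioi.1 hj
    rw [sub_pos]
    gcongr
  obtain ⟨T, hT⟩ := hcls.lower_bound hm ha hnn hne
  obtain ⟨n, hn⟩ := exists_nat_mul_ge hγ (max T 2)
  obtain ⟨c, hc, hlow⟩ := hT ((n + 1) * γ)
  obtain ⟨C, hC, hup⟩ := Cls.upper_bound hm ha (n * γ)
  obtain ⟨p, hp, hpmax⟩ := (isCompact_TsetR m).exists_isMaxOn ⟨_, hne.choose_spec.1⟩
    hcls.cont.norm.continuousOn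
  set S := |detOf y p| + 1 with hS
  have hS0 : 0 < S := by positivity
  have hup' := hup _ hcls S (fun θ hθ => (hpmax hθ).trans (by
    rw [hS]; simp)) (n * γ) ((le_max_right _ _).trans hn) le_rfl
  have hTn := (le_max_left _ _).trans hn
  have hlow1 := hlow (n * γ) hTn (by linarith)
  have hlow2 := hlow ((n + 1) * γ) (by linarith) le_rfl
  refine ⟨c / (C * S), by positivity, fun i t => y i (n * γ + t),
    fun i => (hy i).shift_nat hγ.le hper n,
    fun θ hθ => hcls.nonneg hm ha hnn (by positivity) hθ, ?_, fun θ hθ => ?_⟩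
  · obtain ⟨θ, hθ, hu⟩ := exists_umFun_pos hm
    exact ⟨θ, hθ, ((mul_pos hc hu).trans_le (hlow1 θ hθ)).ne'⟩
  · have h1 := (le_abs_self _).trans (hup' θ hθ)
    have h2 := hlow2 θ hθ
    have e : detOf y (fun i => (n + 1) * γ + θ i) =
        detOf (fun i t => y i (n * γ + t)) (fun i => γ + θ i) := detOf_congr fun i j => congrArg (y i) (by ring)
    rw [← e]
    refine le_trans ?_ h2
    rw [div_mul_eq_mul_div, div_le_iff₀ (by positivity)]
    have := mul_le_mul_of_nonneg_left h1 hc.le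
    change c * detOf y (fun i => n * γ + θ i) ≤ _
    linarith

lemma good_bound (ha : PosCoef (fun t => (-1) ^ m * b t) b₁ b₂) (hγ : 0 < γ) :
    ∃ G : ℝ, ∀ c (y : Fin m → ℝ → ℝ), Good b γ c y → c ≤ G := by
  obtain ⟨N, hN⟩ := exists_nat_ge γ
  refine ⟨((1 + b₂) ^ N) ^ m, fun c y h => ?_⟩
  obtain ⟨θ, hθ, hpos, hmax⟩ := h.exists_max ha
  have h1 := (h.cls ha).norm_le ha.bddCoef hmax N (x := fun i => γ + θ i) fun i =>
    ⟨by linarith [(hθ.1 i).1], by linarith [(hθ.1 i).2]⟩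
  have h2 := (h.le θ hθ).trans ((le_abs_self _).trans h1)
  exact le_of_mul_le_mul_right h2 hpos

lemma sol_frame (ha : PosCoef (fun t => (-1) ^ m * b t) b₁ b₂) (hy : ∀ i, Sol b (y i))
    (θ : Fin m → ℝ) (j : Fin m) : Sol b (frame y θ j) :=
  ((cls_detOf ha.bddCoef hy).sol j θ).const_mul ha.bddCoef _

lemma Good.frame (ha : PosCoef (fun t => (-1) ^ m * b t) b₁ b₂) (h : Good b γ c y)
    {θ : Fin m → ℝ} (hpos : 0 < detOf y θ) : Good b γ c (frame y θ) := by
  have hi := inv_pos.2 hpos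
  refine ⟨sol_frame ha h.sol θ, fun x hx => ?_, ?_, fun x hx => ?_⟩
  · rw [detOf_frame y hpos.ne']
    exact mul_nonneg hi.le (h.nonneg x hx)
  · obtain ⟨x, hx, hne⟩ := h.ne
    refine ⟨x, hx, ?_⟩
    rw [detOf_frame y hpos.ne']
    exact mul_ne_zero hi.ne' hne
  · rw [detOf_frame y hpos.ne', detOf_frame y hpos.ne']
    have := mul_le_mul_of_nonneg_left (h.le x hx) hi.le
    linarith

/-- Good tuples can be normalized to be bounded and equi-Lipschitz on `[-1, 0]`. -/
lemma exists_normalized (hm : m = 2 ∨ m = 3) (hγ : 0 < γ)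
    (hper : ∀ᵐ t ∂volume, b (t + γ) = b t) (ha : PosCoef (fun t => (-1) ^ m * b t) b₁ b₂)
    {c₀ : ℝ} (hc₀ : 0 < c₀) : ∃ L : ℝ, ∀ c, c₀ ≤ c → ∀ y : Fin m → ℝ → ℝ, Good b γ c y →
    ∃ z : Fin m → ℝ → ℝ, Good b γ c z ∧ (∃ θ ∈ TsetR m, detOf z θ = 1) ∧
      (∀ j, ∀ t ∈ I01, |z j t| ≤ 1) ∧ ∀ j, ∀ s ∈ I01, ∀ t ∈ I01, |z j s - z j t| ≤ L * |s - t| := by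
  obtain ⟨n, hn⟩ := exists_nat_mul_ge hγ 1
  obtain ⟨N, hN⟩ := exists_nat_ge (n * γ)
  refine ⟨b₂ * (((1 + b₂) ^ N) ^ m / c₀ ^ n), fun c hc y hy => ?_⟩
  have hc0 := hc₀.trans_le hc
  have hb2 := ha.pos_right
  have hs := hy.shift hm hγ hper ha hc0 n
  obtain ⟨p, hp, hppos, hpmax⟩ := hy.exists_max ha
  obtain ⟨θ, hθ, hpos, hmax⟩ := hs.exists_max ha
  set y' : Fin m → ℝ → ℝ := fun i t => y i (n * γ + t) with hy'
  have hup : ∀ (j : Fin m) (t : ℝ), t ∈ I01 → ∀ i, Function.update θ j t i ∈ I01 := by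
    intro j t ht i
    by_cases h : i = j
    · subst h; simpa using ht
    · simpa [h] using hθ.1 i
  have hD : c₀ ^ n * detOf y p ≤ detOf y' θ :=
    (mul_le_mul_of_nonneg_right (pow_le_pow_left₀ hc₀.le hc n) hppos.le).trans
      ((hy.pow_le hm hγ hper ha hc0 n hp).trans
        ((le_abs_self _).trans (hmax p hp.1)))
  have hinv : (detOf y' θ)⁻¹ * detOf y p ≤ (c₀ ^ n)⁻¹ := by
    rw [inv_mul_le_iff₀ hpos, ← div_eq_mul_inv, le_div_iff₀ (by positivity)]
    linarith
  refine ⟨frame y' θ, hs.frame ha hpos, ⟨θ, hθ, ?_⟩, fun j t ht => ?_, fun j => ?_⟩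
  · rw [detOf_frame y' hpos.ne', inv_mul_cancel₀ hpos.ne']
  · rw [frame, abs_mul, abs_of_pos (inv_pos.2 hpos), inv_mul_le_iff₀ hpos, mul_one]
    exact hmax _ (hup j t ht)
  · have key : ∀ s ∈ I01, ∀ t ∈ I01, s ≤ t → |frame y' θ j t - frame y' θ j s| ≤
        b₂ * (((1 + b₂) ^ N) ^ m / c₀ ^ n) * (t - s) := by
      intro s hs t ht hst
      have hsl := (hy.cls ha).sol j (fun i => n * γ + θ i)
      have hl := hsl.lipschitz ha.bddCoef (N := N) (S := ((1 + b₂) ^ N) ^ m * detOf y p)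
        (fun t h1 h2 => (hy.cls ha).norm_le ha.bddCoef hpmax N fun i => by
          by_cases h : i = j
          · subst h; simpa using ⟨h1, h2⟩
          · simp only [ne_eq, h, not_false_eq_true, Function.update_of_ne]
            constructor <;> linarith [(hθ.1 i).1, (hθ.1 i).2])
        (τ := n * γ + s) (t := n * γ + t) (by linarith [hs.1]) (by linarith)
        (by linarith [ht.2])
      have e : ∀ r, detOf y' (Function.update θ j r) =
          detOf y (Function.update (fun i => n * γ + θ i) j (n * γ + r)) := by
        refine fun r => detOf_congr fun i l => ?_
        by_cases h : l = j
        · subst h; simp [hy']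
        · simp [h, hy']
      rw [frame, frame, ← mul_sub, abs_mul, abs_of_pos (inv_pos.2 hpos), e, e]
      rw [Real.norm_eq_abs, add_sub_add_left_eq_sub] at hl
      calc _ ≤ (detOf y' θ)⁻¹ * (b₂ * (((1 + b₂) ^ N) ^ m * detOf y p) * (t - s)) :=
            mul_le_mul_of_nonneg_left hl (inv_pos.2 hpos).le
        _ = b₂ * ((1 + b₂) ^ N) ^ m * (t - s) * ((detOf y' θ)⁻¹ * detOf y p) := by ring
        _ ≤ b₂ * ((1 + b₂) ^ N) ^ m * (t - s) * (c₀ ^ n)⁻¹ :=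
            mul_le_mul_of_nonneg_left hinv
              (mul_nonneg (by positivity) (by linarith))
        _ = _ := by ring
    intro s hs t ht
    rcases le_total s t with h | h
    · rw [abs_sub_comm, abs_sub_comm s t, abs_of_nonneg (sub_nonneg.2 h)]
      exact key s hs t ht h
    · rw [abs_of_nonneg (sub_nonneg.2 h)]
      exact key t ht s hs h

end Perron

section Extension

variable {b : ℝ → ℝ} {B : ℝ}

variable {𝕜 : Type*} [RCLike 𝕜]

lemma exists_sol_extending (hb : BddCoef b B) (φ : C(I01, 𝕜)) :
    ∃ y : ℝ → 𝕜, Sol b y ∧ ∀ t : I01, y (t : ℝ) = φ t := by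
  obtain ⟨y, hy, h⟩ := exists_sol hb (φ := Set.IccExtend (by norm_num : (-1 : ℝ) ≤ 0) φ)
    φ.continuous.Icc_extend'
  exact ⟨y, hy, fun t => by simp [h t t.2.2]⟩

/-- The solution extending a continuous function on `[-1, 0]`. -/
def solExt (hb : BddCoef b B) (φ : C(I01, 𝕜)) : ℝ → 𝕜 := (exists_sol_extending hb φ).choose

lemma sol_solExt (hb : BddCoef b B) (φ : C(I01, 𝕜)) : Sol b (solExt hb φ) :=
  (exists_sol_extending hb φ).choose_spec.1

lemma solExt_apply (hb : BddCoef b B) (φ : C(I01, 𝕜)) (t : I01) :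
    solExt hb φ (t : ℝ) = φ t :=
  (exists_sol_extending hb φ).choose_spec.2 t

lemma solExt_eq (hb : BddCoef b B) {φ : C(I01, 𝕜)} {y : ℝ → 𝕜} (hy : Sol b y)
    (h : ∀ t : I01, y (t : ℝ) = φ t) {t : ℝ} (ht : -1 ≤ t) : solExt hb φ t = y t :=
  (sol_solExt hb φ).eq_of_eq hb hy (fun t ht => by
    rw [h ⟨t, ht⟩]; exact solExt_apply hb φ ⟨t, ht⟩) ht

lemma continuous_solExt (hb : BddCoef b B) {t : ℝ} (ht : -1 ≤ t) :
    Continuous fun φ : C(I01, 𝕜) => solExt hb φ t := by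
  obtain ⟨N, hN⟩ := exists_nat_ge t
  have hB := hb.nonneg
  refine (LipschitzWith.of_dist_le_mul (K := ⟨(1 + B) ^ N, by positivity⟩)
    fun φ ψ => ?_).continuous
  rw [dist_eq_norm, dist_eq_norm]
  exact ((sol_solExt hb φ).sub hb (sol_solExt hb ψ)).norm_le hb (S := ‖φ - ψ‖) (fun s hs => by
    have := (φ - ψ).norm_coe_le_norm ⟨s, hs⟩
    have h1 := solExt_apply hb φ ⟨s, hs⟩
    have h2 := solExt_apply hb ψ ⟨s, hs⟩
    simp only at h1 h2
    simpa [h1, h2] using this) N ht hN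

end Extension

lemma isCompact_lipschitz (L : ℝ) :
    IsCompact {f : C(I01, ℝ) | (∀ t, |f t| ≤ 1) ∧ ∀ s t, |f s - f t| ≤ L * |(s : ℝ) - t|} := by
  set K := {f : C(I01, ℝ) | (∀ t, |f t| ≤ 1) ∧ ∀ s t, |f s - f t| ≤ L * |(s : ℝ) - t|} with hK
  have hlip : ∀ {f : I01 → ℝ}, (∀ s t, |f s - f t| ≤ L * |(s : ℝ) - t|) →
      LipschitzWith (Real.toNNReal L) f := fun h =>
    LipschitzWith.of_dist_le_mul fun s t => (h s t).trans
      (mul_le_mul_of_nonneg_right (Real.le_coe_toNNReal L) (abs_nonneg _))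
  refine ArzelaAscoli.isCompact_of_equicontinuous K ?_ ?_
  · have : ContinuousMap.toFun '' K =
        {f : I01 → ℝ | (∀ t, |f t| ≤ 1) ∧ ∀ s t, |f s - f t| ≤ L * |(s : ℝ) - t|} := by
      ext f
      constructor
      · rintro ⟨g, hg, rfl⟩; exact hg
      · rintro hf
        exact ⟨⟨f, (hlip hf.2).continuous⟩, hf, rfl⟩
    rw [this]
    refine (isCompact_univ_pi (s := fun _ : I01 => Set.Icc (-1 : ℝ) 1)
      fun _ => isCompact_Icc).of_isClosed_subset ?_ fun f hf t _ => abs_le.1 (hf.1 t)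
    simp only [Set.ofPred_and, Set.ofPred_forall]
    refine IsClosed.inter (isClosed_iInter fun t => ?_)
      (isClosed_iInter fun s => isClosed_iInter fun t => ?_)
    · exact isClosed_le (continuous_apply t).abs continuous_const
    · exact isClosed_le ((continuous_apply s).sub (continuous_apply t)).abs continuous_const
  · exact (LipschitzWith.uniformEquicontinuous _ (Real.toNNReal L)
      fun f : K => hlip f.2.2).equicontinuous

lemma continuous_detOf {X : Type*} [TopologicalSpace X] {m : ℕ} {y : X → Fin m → ℝ → ℝ}
    {x : X → Fin m → ℝ} (h : ∀ i j, Continuous fun p => y p i (x p j)) :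
    Continuous fun p => detOf (y p) (x p) := by
  unfold detOf
  exact Continuous.matrix_det (continuous_matrix h)

section Perron

variable {m : ℕ} {b : ℝ → ℝ} {b₁ b₂ γ c : ℝ}

/-- There is a largest growth factor. -/
lemma exists_greatest (hm : m = 2 ∨ m = 3) (hγ : 0 < γ)
    (hper : ∀ᵐ t ∂volume, b (t + γ) = b t) (ha : PosCoef (fun t => (-1) ^ m * b t) b₁ b₂) :
    ∃ c > 0, ∃ y : Fin m → ℝ → ℝ, Good b γ c y ∧
      ∀ c' (y' : Fin m → ℝ → ℝ), Good b γ c' y' → c' ≤ c := by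
  obtain ⟨c₀, hc₀, y₀, hy₀⟩ := exists_good hm hγ hper ha
  obtain ⟨G, hG⟩ := good_bound (m := m) ha hγ
  obtain ⟨L, hL⟩ := exists_normalized hm hγ hper ha hc₀
  have hb := ha.bddCoef
  set 𝒦 := {f : C(I01, ℝ) | (∀ t, |f t| ≤ 1) ∧ ∀ s t, |f s - f t| ≤ L * |(s : ℝ) - t|} with h𝒦
  let X := ℝ × (Fin m → C(I01, ℝ)) × (Fin m → I01)
  let D : X → (Fin m → ℝ) → ℝ := fun p => detOf fun i => solExt hb (p.2.1 i)
  let P : Set X := (Set.Icc c₀ G ×ˢ (Set.univ.pi fun _ => 𝒦) ×ˢ {θ | Monotone θ}) ∩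
    ({p | D p (fun j => p.2.2 j) = 1} ∩
      ((⋂ θ ∈ TsetR m, {p | 0 ≤ D p θ}) ∩
        ⋂ θ ∈ TsetR m, {p | p.1 * D p θ ≤ D p (fun i => γ + θ i)}))
  have hD : ∀ x : Fin m → ℝ, (∀ i, -1 ≤ x i) → Continuous fun p : X => D p x := fun x hx =>
    continuous_detOf fun i j => (continuous_solExt hb (hx j)).comp
      ((continuous_apply i).comp (continuous_fst.comp continuous_snd))
  have hP : IsCompact P := by
    refine IsCompact.inter_right ?_ (IsClosed.inter ?_ (IsClosed.inter ?_ ?_))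
    · refine isCompact_Icc.prod ((isCompact_univ_pi fun _ => isCompact_lipschitz L).prod ?_)
      refine IsClosed.isCompact ?_
      simp only [Monotone, Set.ofPred_forall]
      exact isClosed_iInter fun i => isClosed_iInter fun j => isClosed_iInter fun _ =>
        isClosed_le (continuous_apply i) (continuous_apply j)
    · refine isClosed_eq (continuous_detOf fun i j => ?_) continuous_const
      simp only [solExt_apply]
      fun_prop
    · exact isClosed_biInter fun θ hθ => isClosed_le continuous_const
        (hD θ fun i => (hθ.1 i).1)
    · exact isClosed_biInter fun θ hθ => isClosed_le
        (continuous_fst.mul (hD θ fun i => (hθ.1 i).1))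
        (hD _ fun i => by linarith [(hθ.1 i).1])
  have hmem : ∀ c, c₀ ≤ c → ∀ y : Fin m → ℝ → ℝ, Good b γ c y → ∃ p ∈ P, p.1 = c := by
    intro c hc y hy
    obtain ⟨z, hz, ⟨θ, hθ, h1⟩, h2, h3⟩ := hL c hc y hy
    let φ : Fin m → C(I01, ℝ) := fun i => ⟨fun t => z i t, (hz.sol i).cont.comp continuous_subtype_val⟩
    have hφ : ∀ i t, -1 ≤ t → solExt hb (φ i) t = z i t := fun i t ht =>
      solExt_eq hb (hz.sol i) (fun t => rfl) ht
    have hφ' : ∀ x : Fin m → ℝ, (∀ i, -1 ≤ x i) →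
        detOf (fun i => solExt hb (φ i)) x = detOf z x := fun x hx =>
      detOf_congr fun i j => hφ i _ (hx j)
    refine ⟨(c, φ, fun j => ⟨θ j, hθ.1 j⟩), ⟨⟨⟨hc, hG c y hy⟩, fun i _ => ?_, ?_⟩, ?_, ?_, ?_⟩, rfl⟩
    · exact ⟨fun t => h2 i t t.2, fun s t => h3 i s s.2 t t.2⟩
    · exact fun i j hij => hθ.2 hij
    · exact (hφ' _ fun i => (hθ.1 i).1).trans h1
    · refine Set.mem_iInter₂.2 fun x hx => ?_
      exact (hz.nonneg x hx).trans (hφ' _ fun i => (hx.1 i).1).ge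
    · refine Set.mem_iInter₂.2 fun x hx => ?_
      change c * detOf (fun i => solExt hb (φ i)) x ≤ detOf (fun i => solExt hb (φ i)) _
      rw [hφ' _ fun i => (hx.1 i).1, hφ' _ fun i => by linarith [(hx.1 i).1]]
      exact hz.le x hx
  obtain ⟨p₀, hp₀, -⟩ := hmem c₀ le_rfl y₀ hy₀
  obtain ⟨p, hp, hmax⟩ := hP.exists_isMaxOn ⟨p₀, hp₀⟩ continuous_fst.continuousOn
  obtain ⟨⟨hc, -, hmono⟩, h1, h2, h3⟩ := hp
  refine ⟨p.1, hc₀.trans_le hc.1, fun i => solExt hb (p.2.1 i), ⟨fun i => sol_solExt hb _,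
    fun θ hθ => Set.mem_iInter₂.1 h2 θ hθ, ⟨fun j => p.2.2 j, ⟨fun i => (p.2.2 i).2, hmono⟩, ?_⟩,
    fun θ hθ => Set.mem_iInter₂.1 h3 θ hθ⟩, fun c' y' hy' => ?_⟩
  · exact ne_of_eq_of_ne h1 one_ne_zero
  · rcases le_total c₀ c' with h | h
    · obtain ⟨q, hq, rfl⟩ := hmem c' h y' hy'
      exact hmax hq
    · exact h.trans hc.1

end Perron

/-- Normalized solution tuples whose determinant is multiplied by `Δ` over one period. -/
structure Perron {m : ℕ} (b : ℝ → ℝ) (γ Δ : ℝ) (y : Fin m → ℝ → ℝ) (θ : Fin m → ℝ) : Prop where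
  sol : ∀ i, Sol b (y i)
  nonneg : ∀ x ∈ TsetR m, 0 ≤ detOf y x
  mem : θ ∈ TsetR m
  apply : ∀ i j, y i (θ j) = if i = j then 1 else 0
  pos : 0 < Δ
  shift : ∀ x : Fin m → ℝ, (∀ i, x i ∈ I01) → detOf y (fun i => γ + x i) = Δ * detOf y x

lemma exists_perron {m : ℕ} {b : ℝ → ℝ} {b₁ b₂ γ : ℝ} (hm : m = 2 ∨ m = 3) (hγ : 0 < γ)
    (hper : ∀ᵐ t ∂volume, b (t + γ) = b t) (ha : PosCoef (fun t => (-1) ^ m * b t) b₁ b₂) :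
    ∃ (Δ : ℝ) (y : Fin m → ℝ → ℝ) (θ : Fin m → ℝ), Perron b γ Δ y θ := by
  obtain ⟨c, hc, y, hy, hmax⟩ := exists_greatest hm hγ hper ha
  have hF := hy.cls_sub hγ hper ha
  obtain ⟨p, hp, hppos, hpmax⟩ := hy.exists_max ha
  have hzero : ∀ θ ∈ TsetR m, detOf y (fun i => γ + θ i) - c * detOf y θ = 0 := by
    by_contra! hne
    obtain ⟨T, hT⟩ := hF.lower_bound hm ha (fun θ hθ => sub_nonneg.2 (hy.le θ hθ)) hne
    obtain ⟨n, hn⟩ := exists_nat_mul_ge hγ (max T 2)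
    obtain ⟨c', hc', hlow⟩ := hT (n * γ)
    obtain ⟨C, hC, hup⟩ := Cls.upper_bound hm ha (n * γ)
    set S := detOf y p with hS
    have hs := hy.shift hm hγ hper ha hc n
    have hup' := hup _ (hy.cls ha) S (fun θ hθ => hpmax θ hθ.1) (n * γ)
      ((le_max_right _ _).trans hn) le_rfl
    have hlow' := hlow (n * γ) ((le_max_left _ _).trans hn) le_rfl
    have hgood : Good b γ (c + c' / (C * S)) (fun i t => y i (n * γ + t)) := by
      refine ⟨hs.sol, hs.nonneg, hs.ne, fun θ hθ => ?_⟩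
      have h1 := (le_abs_self _).trans (hup' θ hθ)
      have h2 := hlow' θ hθ
      have e : detOf y (fun i => γ + (n * γ + θ i)) =
          detOf (fun i t => y i (n * γ + t)) (fun i => γ + θ i) :=
        detOf_congr fun i j => congrArg (y i) (by ring)
      rw [← e]
      change (c + c' / (C * S)) * detOf y (fun i => n * γ + θ i) ≤ _
      have h3 : c' / (C * S) * detOf y (fun i => n * γ + θ i) ≤ c' * umFun m θ := by
        rw [div_mul_eq_mul_div, div_le_iff₀ (by positivity)]
        have := mul_le_mul_of_nonneg_left h1 hc'.le
        linarith
      linarith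
    have : 0 < c' / (C * S) := by positivity
    linarith [hmax _ _ hgood]
  refine ⟨c, frame y p, p, sol_frame ha hy.sol p, (hy.frame ha hppos).nonneg, hp,
    frame_apply y hppos.ne', hc, fun x hx => ?_⟩
  have := hF.norm_le_of_sorted (S := 0) (fun θ hθ => by simp [hzero θ hθ]) hx
  rw [detOf_frame y hppos.ne', detOf_frame y hppos.ne', sub_eq_zero.1 (norm_le_zero_iff.1 this)]
  ring

namespace Perron

variable {m : ℕ} {b : ℝ → ℝ} {b₁ b₂ γ Δ : ℝ} {y : Fin m → ℝ → ℝ} {θ : Fin m → ℝ}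

lemma detOf_eq_one (h : Perron b γ Δ y θ) : detOf y θ = 1 := by
  have : (Matrix.of fun i j => y i (θ j)) = 1 := by
    ext i j
    simp [h.apply, Matrix.one_apply]
  simp [detOf, this]

lemma cls (ha : PosCoef (fun t => (-1) ^ m * b t) b₁ b₂) (h : Perron b γ Δ y θ) :
    Cls b (detOf y) := cls_detOf ha.bddCoef h.sol

lemma shift_nat (hγ : 0 < γ) (hper : ∀ᵐ t ∂volume, b (t + γ) = b t)
    (ha : PosCoef (fun t => (-1) ^ m * b t) b₁ b₂) (h : Perron b γ Δ y θ) (n : ℕ)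
    {x : Fin m → ℝ} (hx : ∀ i, -1 ≤ x i) :
    detOf y (fun i => n * γ + x i) = Δ ^ n * detOf y x := by
  have hb := ha.bddCoef
  have hF := ((h.cls ha).shift hγ.le hper).add hb ((h.cls ha).const_mul hb (-Δ))
  have key : ∀ x : Fin m → ℝ, (∀ i, -1 ≤ x i) →
      detOf y (fun i => γ + x i) = Δ * detOf y x := by
    intro x hx
    obtain ⟨N, hN⟩ : ∃ N : ℕ, ∀ i, x i ≤ N := by
      obtain ⟨C, hC⟩ := (Set.finite_range x).bddAbove
      obtain ⟨N, hN⟩ := exists_nat_ge C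
      exact ⟨N, fun i => (hC ⟨i, rfl⟩).trans hN⟩
    have := hF.norm_le hb (S := 0) (fun x hx => by simp [h.shift x hx]) N (x := x)
      fun i => ⟨hx i, hN i⟩
    rw [mul_zero] at this
    linarith [norm_le_zero_iff.1 this]
  induction n with
  | zero => simp
  | succ n ih =>
    rw [pow_succ', mul_assoc, ← ih, ← key]
    · exact detOf_congr fun i j => congrArg (y i) (by push_cast; ring)
    · exact fun i => by nlinarith [hx i, mul_nonneg (Nat.cast_nonneg (α := ℝ) n) hγ.le]

lemma det_ne_zero (h : Perron b γ Δ y θ) :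
    (Matrix.of fun i j => y i (γ + θ j)).det = Δ := by
  have := h.shift θ h.mem.1
  rw [h.detOf_eq_one, mul_one] at this
  exact this

/-- The span of a Perron tuple is invariant under the shift by one period. -/
lemma shift_apply (hγ : 0 < γ) (hper : ∀ᵐ t ∂volume, b (t + γ) = b t)
    (ha : PosCoef (fun t => (-1) ^ m * b t) b₁ b₂) (h : Perron b γ Δ y θ) (i : Fin m) {t : ℝ}
    (ht : -1 ≤ t) : y i (γ + t) = ∑ l, y i (γ + θ l) * y l t := by
  have hb := ha.bddCoef
  refine ((h.sol i).shift hγ.le hper).eq_of_eq hb (Sol.sum hb Finset.univ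
    fun l _ => (h.sol l).const_mul hb (y i (γ + θ l))) (fun t ht => ?_) ht
  have hne : detOf (fun i t => y i (γ + t)) θ ≠ 0 := by
    have := h.det_ne_zero
    exact ne_of_eq_of_ne this h.pos.ne'
  rw [eq_sum_frame (fun i t => y i (γ + t)) hne i t]
  refine Finset.sum_congr rfl fun l _ => ?_
  congr 1
  have hup : ∀ i, Function.update θ l t i ∈ I01 := by
    intro i
    by_cases h' : i = l
    · subst h'; simpa using ht
    · simpa [h'] using h.mem.1 i
  have h1 : detOf (fun i t => y i (γ + t)) θ = Δ := h.det_ne_zero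
  rw [frame, h1, show detOf (fun i t => y i (γ + t)) (Function.update θ l t) =
    Δ * detOf y (Function.update θ l t) from h.shift _ hup, inv_mul_cancel_left₀ h.pos.ne',
    detOf_update]
  have : (Matrix.of fun i j => y i (θ j)) = 1 := by
    ext i j
    simp [h.apply, Matrix.one_apply]
  rw [this, Matrix.cramer_one]
  rfl

lemma exists_bounds (hm : m = 2 ∨ m = 3) (hγ : 0 < γ) (hper : ∀ᵐ t ∂volume, b (t + γ) = b t)
    (ha : PosCoef (fun t => (-1) ^ m * b t) b₁ b₂) (h : Perron b γ Δ y θ) (T₁ : ℝ) :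
    ∃ c > 0, ∃ C > 0, ∀ τ, 0 ≤ τ → τ ≤ T₁ → ∀ x ∈ TsetR m,
      c * umFun m x ≤ detOf y (fun i => τ + x i) ∧
      detOf y (fun i => τ + x i) ≤ C * umFun m x := by
  have hK := h.cls ha
  obtain ⟨T, hT⟩ := hK.lower_bound hm ha h.nonneg ⟨θ, h.mem, by simp [h.detOf_eq_one]⟩
  obtain ⟨n, hn⟩ := exists_nat_mul_ge hγ (max T 2)
  obtain ⟨c, hc, hlow⟩ := hT (n * γ + T₁)
  obtain ⟨C, hC, hup⟩ := Cls.upper_bound hm ha (n * γ + T₁)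
  obtain ⟨p, hp, hmax⟩ := (isCompact_TsetR m).exists_isMaxOn ⟨θ, h.mem⟩ hK.cont.norm.continuousOn
  have hp1 : 1 ≤ |detOf y p| := by
    have := hmax h.mem
    simpa [h.detOf_eq_one] using this
  have hup' := hup _ hK |detOf y p| fun x hx => hmax hx
  have hΔ := pow_pos h.pos n
  refine ⟨c / Δ ^ n, by positivity, C * |detOf y p| / Δ ^ n, by positivity, fun τ h0 h1 x hx => ?_⟩
  have e : detOf y (fun i => (n * γ + τ) + x i) = Δ ^ n * detOf y (fun i => τ + x i) := by
    rw [← h.shift_nat hγ hper ha n fun i => by linarith [(hx.1 i).1]]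
    exact detOf_congr fun i j => congrArg (y i) (by ring)
  have h2 := hlow (n * γ + τ) (by linarith [le_max_left T 2]) (by linarith) x hx
  have h3 := (le_abs_self _).trans
    (hup' (n * γ + τ) (by linarith [le_max_right T 2]) (by linarith) x hx)
  rw [e] at h2 h3
  rw [div_mul_eq_mul_div, div_mul_eq_mul_div, div_le_iff₀ hΔ, le_div_iff₀ hΔ]
  constructor <;> linarith

variable {h : (Fin m → ℝ) → ℂ} {κ : ℂ}

lemma cls_sub (ha : PosCoef (fun t => (-1) ^ m * b t) b₁ b₂) (hP : Perron b γ Δ y θ)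
    (hh : Cls b h) (M : ℝ) (s : ℂ) : Cls b fun x => M * detOf y x - (s * h x).re := by
  have hb := ha.bddCoef
  have := ((hP.cls ha).const_mul hb M).add hb (((hh.const_mul hb s).clm hb Complex.reCLM).const_mul
    hb (-1))
  simpa [sub_eq_add_neg] using this

/-- One-sided bounds by a multiple of the Perron determinant persist in time. -/
lemma re_le (hm : m = 2 ∨ m = 3) (ha : PosCoef (fun t => (-1) ^ m * b t) b₁ b₂)
    (hP : Perron b γ Δ y θ) (hh : Cls b h) {M : ℝ} {s : ℂ}
    (hM : ∀ x ∈ TsetR m, (s * h x).re ≤ M * detOf y x) {τ : ℝ} (hτ : 0 ≤ τ) {x : Fin m → ℝ}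
    (hx : x ∈ TsetR m) :
    (s * h (fun i => τ + x i)).re ≤ M * detOf y (fun i => τ + x i) :=
  sub_nonneg.1 ((hP.cls_sub ha hh M s).nonneg hm ha (fun x hx => sub_nonneg.2 (hM x hx)) hτ hx)

lemma exists_bound_shift (hm : m = 2 ∨ m = 3) (hγ : 0 < γ) (hper : ∀ᵐ t ∂volume, b (t + γ) = b t)
    (ha : PosCoef (fun t => (-1) ^ m * b t) b₁ b₂)
    (hP : Perron b γ Δ y θ) (hh : Cls b h) {n : ℕ} (hn : 2 ≤ n * γ) :
    ∃ M, ∀ x ∈ TsetR m, ‖h (fun i => n * γ + x i)‖ ≤ M * detOf y (fun i => n * γ + x i) := by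
  obtain ⟨C, hC, hup⟩ := Cls.upper_bound hm ha (n * γ)
  obtain ⟨c, hc, C', hC', hlow⟩ := hP.exists_bounds hm hγ hper ha (n * γ)
  obtain ⟨p, hp, hmax⟩ := (isCompact_TsetR m).exists_isMaxOn ⟨θ, hP.mem⟩ hh.cont.norm.continuousOn
  have hb := ha.bddCoef
  have h1 := hup _ (hh.clm hb Complex.reCLM) ‖h p‖
    (fun x hx => (Complex.abs_re_le_norm _).trans (hmax hx)) _ hn le_rfl
  have h2 := hup _ (hh.clm hb Complex.imCLM) ‖h p‖
    (fun x hx => (Complex.abs_im_le_norm _).trans (hmax hx)) _ hn le_rfl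
  refine ⟨2 * (C * ‖h p‖) / c, fun x hx => ?_⟩
  have h3 := (hlow (n * γ) (by positivity) le_rfl x hx).1
  have h4 := (Complex.norm_le_abs_re_add_abs_im _).trans (add_le_add (h1 x hx) (h2 x hx))
  rw [div_mul_eq_mul_div, le_div_iff₀ hc]
  calc _ ≤ 2 * (C * ‖h p‖) * umFun m x * c := by
        refine mul_le_mul_of_nonneg_right (h4.trans (le_of_eq ?_)) hc.le
        ring
    _ ≤ _ := by
        rw [mul_assoc, mul_comm (umFun m x)]
        exact mul_le_mul_of_nonneg_left h3 (by positivity)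

lemma exists_bound (hm : m = 2 ∨ m = 3) (hγ : 0 < γ) (hper : ∀ᵐ t ∂volume, b (t + γ) = b t)
    (ha : PosCoef (fun t => (-1) ^ m * b t) b₁ b₂)
    (hP : Perron b γ Δ y θ) (hh : Cls b h) (hκ : κ ≠ 0) {d : ℂ}
    (hper' : ∀ x : Fin m → ℝ, (∀ i, -1 ≤ x i) →
      h (fun i => γ + x i) = Δ * (κ * h x + d * detOf y x)) :
    ∃ M, ∀ x ∈ TsetR m, ‖h x‖ ≤ M * detOf y x := by
  obtain ⟨n, hn⟩ := exists_nat_mul_ge hγ 2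
  have hΔ := hP.pos
  have hlast := hP.exists_bound_shift hm hγ hper ha hh hn
  clear hn
  induction n with
  | zero => simpa using hlast
  | succ n ih =>
    refine ih ?_
    obtain ⟨M, hM⟩ := hlast
    refine ⟨(M + ‖d‖) / ‖κ‖, fun x hx => ?_⟩
    have h1 := hM x hx
    set x' : Fin m → ℝ := fun i => n * γ + x i with hx'
    have hx1 : ∀ i, -1 ≤ x' i := fun i => by
      have : 0 ≤ n * γ := by positivity
      linarith [(hx.1 i).1]
    have e : (fun i => ((n + 1 : ℕ) : ℝ) * γ + x i) = fun i => γ + x' i := by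
      funext i; rw [hx']; push_cast; ring
    have hK := hP.shift_nat hγ hper ha 1 hx1
    simp only [Nat.cast_one, one_mul, pow_one] at hK
    rw [e, hper' x' hx1, hK, norm_mul, Complex.norm_real, Real.norm_of_nonneg hΔ.le] at h1
    have h2 : ‖κ * h x' + d * (detOf y x' : ℝ)‖ ≤ M * detOf y x' :=
      le_of_mul_le_mul_left (by linarith) hΔ
    have h3 : 0 ≤ detOf y x' := (hP.cls ha).nonneg hm ha hP.nonneg (by positivity) hx
    have h4 : ‖κ‖ * ‖h x'‖ ≤ ‖κ * h x' + d * (detOf y x' : ℝ)‖ + ‖d‖ * detOf y x' := by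
      have := norm_sub_le (κ * h x' + d * (detOf y x' : ℝ)) (d * (detOf y x' : ℝ))
      rwa [add_sub_cancel_right, norm_mul, norm_mul, Complex.norm_real,
        Real.norm_of_nonneg h3] at this
    rw [div_mul_eq_mul_div, le_div_iff₀ (norm_pos_iff.2 hκ)]
    linarith

lemma shift_pow (hγ : 0 < γ)
    (hper' : ∀ x : Fin m → ℝ, (∀ i, -1 ≤ x i) → h (fun i => γ + x i) = Δ * (κ * h x))
    (n : ℕ) {x : Fin m → ℝ} (hx : ∀ i, -1 ≤ x i) :
    h (fun i => n * γ + x i) = Δ ^ n * (κ ^ n * h x) := by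
  induction n with
  | zero => simp
  | succ n ih =>
    have e : (fun i => ((n + 1 : ℕ) : ℝ) * γ + x i) = fun i => γ + (n * γ + x i) := by
      funext i; push_cast; ring
    rw [e, hper', ih]
    · ring
    · intro i
      have : 0 ≤ n * γ := by positivity
      linarith [hx i]

/-- An eigenfunction for an eigenvalue of modulus at least the Perron one is a multiple of the
Perron determinant. -/
lemma rigid_aux (hm : m = 2 ∨ m = 3) (hγ : 0 < γ) (hper : ∀ᵐ t ∂volume, b (t + γ) = b t)
    (ha : PosCoef (fun t => (-1) ^ m * b t) b₁ b₂)
    (hP : Perron b γ Δ y θ) (hh : Cls b h) (hκ : 1 ≤ ‖κ‖)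
    (hper' : ∀ x : Fin m → ℝ, (∀ i, -1 ≤ x i) → h (fun i => γ + x i) = Δ * (κ * h x)) :
    ∃ a : ℂ, ∀ x ∈ TsetR m, h x = a * detOf y x := by
  have hΔ := hP.pos
  have hκ0 : κ ≠ 0 := norm_pos_iff.1 (one_pos.trans_le hκ)
  have hK1 := hP.detOf_eq_one
  have hT1 : ∀ x ∈ TsetR m, ∀ i, -1 ≤ x i := fun x hx i => (hx.1 i).1
  let 𝓜 : Set ℝ := {M | ∀ x ∈ TsetR m, ‖h x‖ ≤ M * detOf y x}
  have hne : 𝓜.Nonempty := hP.exists_bound hm hγ hper ha hh hκ0 (d := 0) (by simpa using hper')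
  have hbd : BddBelow 𝓜 := ⟨0, fun M hM => by
    have := hM θ hP.mem
    rw [hK1, mul_one] at this
    exact (norm_nonneg _).trans this⟩
  have hcl : IsClosed 𝓜 := by
    have : 𝓜 = ⋂ x ∈ TsetR m, {M : ℝ | ‖h x‖ ≤ M * detOf y x} := by
      ext M; simp [𝓜]
    rw [this]
    exact isClosed_biInter fun x _ => isClosed_le continuous_const (by fun_prop)
  set M₀ := sInf 𝓜 with hM₀
  have hmem : ∀ x ∈ TsetR m, ‖h x‖ ≤ M₀ * detOf y x := hcl.csInf_mem hne hbd
  have hleast : ∀ M, (∀ x ∈ TsetR m, ‖h x‖ ≤ M * detOf y x) → M₀ ≤ M := fun M hM => csInf_le hbd hM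
  have hM0 : 0 ≤ M₀ := le_csInf hne fun M hM => by
    have := hM θ hP.mem
    rw [hK1, mul_one] at this
    exact (norm_nonneg _).trans this
  rcases hM0.eq_or_lt with hz | hpos
  · refine ⟨0, fun x hx => ?_⟩
    have := hmem x hx
    rw [← hz, zero_mul] at this
    simpa using norm_le_zero_iff.1 this
  have hre : ∀ s : ℂ, ‖s‖ = 1 → ∀ x ∈ TsetR m, (s * h x).re ≤ M₀ * detOf y x := fun s hs x hx => by
    refine (Complex.re_le_norm _).trans ?_
    rw [norm_mul, hs, one_mul]
    exact hmem x hx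
  have hκ1 : ‖κ‖ = 1 := by
    refine le_antisymm ?_ hκ
    have := hleast (M₀ / ‖κ‖) fun x hx => by
      obtain ⟨s, hs, hse⟩ := Complex.exists_norm_eq_mul_self (h (fun i => γ + x i))
      have h1 := hP.re_le hm ha hh (hre s hs) hγ.le hx
      have h2 := hP.shift x hx.1
      rw [← hse, Complex.ofReal_re, hper' x (hT1 x hx), h2, norm_mul, norm_mul, Complex.norm_real,
        Real.norm_of_nonneg hΔ.le] at h1
      rw [div_mul_eq_mul_div, le_div_iff₀ (norm_pos_iff.2 hκ0)]
      have : ‖κ‖ * ‖h x‖ ≤ M₀ * detOf y x := le_of_mul_le_mul_left (by linarith) hΔ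
      linarith
    rw [le_div_iff₀ (norm_pos_iff.2 hκ0)] at this
    exact le_of_mul_le_mul_left (by linarith) hpos
  by_cases hs : ∃ s : ℂ, ‖s‖ = 1 ∧ ∀ x ∈ TsetR m, M₀ * detOf y x - (s * h x).re = 0
  · obtain ⟨s, hs, hsx⟩ := hs
    have hs0 : s ≠ 0 := norm_pos_iff.1 (by rw [hs]; exact one_pos)
    refine ⟨s⁻¹ * M₀, fun x hx => ?_⟩
    have h1 : (s * h x).re = M₀ * detOf y x := (sub_eq_zero.1 (hsx x hx)).symm
    have h2 : ‖s * h x‖ ≤ (s * h x).re := by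
      rw [norm_mul, hs, one_mul, h1]; exact hmem x hx
    have h3 : s * h x = ((s * h x).re : ℝ) := by
      have := Complex.re_eq_norm.1 (le_antisymm (Complex.re_le_norm _) h2)
      exact Complex.eq_re_of_ofReal_le (r := 0) (by simpa using this)
    rw [h1] at h3
    rw [mul_assoc, eq_inv_mul_iff_mul_eq₀ hs0, h3]
    push_cast
    rfl
  exfalso
  push Not at hs
  let p : Set ℂ → Prop := fun U => ∃ N : ℕ, ∃ ε > 0, ∀ n ≥ N, ∀ s ∈ U, ∀ x ∈ TsetR m,
    ε * detOf y x ≤ M₀ * detOf y x - (s * κ ^ n * h x).re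
  have hp : p (Metric.sphere (0 : ℂ) 1) := by
    refine (isCompact_sphere (0 : ℂ) 1).induction_on (p := p) ⟨0, 1, one_pos, by simp⟩
      (fun U V hUV ⟨N, ε, hε, H⟩ => ⟨N, ε, hε, fun n hn s hs => H n hn s (hUV hs)⟩) ?_ ?_
    · rintro U V ⟨N, ε, hε, H⟩ ⟨N', ε', hε', H'⟩
      refine ⟨max N N', min ε ε', lt_min hε hε', fun n hn s hs x hx => ?_⟩
      have hKx := hP.nonneg x hx
      rcases hs with hs | hs
      · exact (mul_le_mul_of_nonneg_right (min_le_left _ _) hKx).trans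
          (H n (le_of_max_le_left hn) s hs x hx)
      · exact (mul_le_mul_of_nonneg_right (min_le_right _ _) hKx).trans
          (H' n (le_of_max_le_right hn) s hs x hx)
    · intro s hs'
      have hs1 : ‖s‖ = 1 := by simpa using hs'
      have hg := hP.cls_sub ha hh M₀ s
      obtain ⟨T, hT⟩ := hg.lower_bound hm ha (fun x hx => sub_nonneg.2 (hre s hs1 x hx)) (hs s hs1)
      obtain ⟨n₀, hn₀⟩ := exists_nat_mul_ge hγ T
      obtain ⟨c, hc, hlow⟩ := hT (n₀ * γ)
      obtain ⟨c', hc', C, hC, hbds⟩ := hP.exists_bounds hm hγ hper ha 0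
      have hΔn := pow_pos hΔ n₀
      set ε := c / (Δ ^ n₀ * C) with hε
      have hε0 : 0 < ε := by positivity
      have hbase : ∀ x ∈ TsetR m, ε * detOf y x ≤ M₀ * detOf y x - (s * κ ^ n₀ * h x).re := by
        intro x hx
        have h1 := hlow (n₀ * γ) hn₀ le_rfl x hx
        have h2 := (hbds 0 le_rfl le_rfl x hx).2
        simp only [zero_add] at h2
        rw [hP.shift_nat hγ hper ha n₀ (hT1 x hx), shift_pow hγ hper' n₀ (hT1 x hx)] at h1
        have e : (s * ((Δ : ℂ) ^ n₀ * (κ ^ n₀ * h x))).re = Δ ^ n₀ * (s * κ ^ n₀ * h x).re := by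
          rw [← Complex.re_ofReal_mul]; push_cast; congr 1; ring
        rw [e] at h1
        refine le_of_mul_le_mul_left (a := Δ ^ n₀) ?_ hΔn
        refine le_trans ?_ (h1.trans (le_of_eq (by ring)))
        have : Δ ^ n₀ * (ε * detOf y x) = c * (detOf y x / C) := by rw [hε]; field_simp
        rw [this]
        refine mul_le_mul_of_nonneg_left ?_ hc.le
        rw [div_le_iff₀ hC]; linarith
      have hall : ∀ n ≥ n₀, ∀ x ∈ TsetR m,
          ε * detOf y x ≤ M₀ * detOf y x - (s * κ ^ n * h x).re := by
        intro n hn x hx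
        obtain ⟨k, rfl⟩ := Nat.exists_eq_add_of_le hn
        have h1 := hP.re_le hm ha hh (M := M₀ - ε) (s := s * κ ^ n₀)
          (fun x hx => by linarith [hbase x hx]) (τ := k * γ) (by positivity) hx
        rw [hP.shift_nat hγ hper ha k (hT1 x hx), shift_pow hγ hper' k (hT1 x hx)] at h1
        have e : (s * κ ^ n₀ * ((Δ : ℂ) ^ k * (κ ^ k * h x))).re =
            Δ ^ k * (s * κ ^ (n₀ + k) * h x).re := by
          rw [← Complex.re_ofReal_mul]; push_cast; congr 1; ring
        rw [e] at h1
        have := le_of_mul_le_mul_left (b := (s * κ ^ (n₀ + k) * h x).re)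
          (c := (M₀ - ε) * detOf y x) (by linarith) (pow_pos hΔ k)
        linarith
      refine ⟨Metric.ball s (ε / (2 * M₀)), mem_nhdsWithin_of_mem_nhds
        (Metric.ball_mem_nhds _ (by positivity)), n₀, ε / 2, by positivity, fun n hn s' hs' x hx => ?_⟩
      have h1 := hall n hn x hx
      have h2 : (s' * κ ^ n * h x).re - (s * κ ^ n * h x).re ≤ ε / 2 * detOf y x := by
        rw [← Complex.sub_re, ← sub_mul, ← sub_mul]
        refine (Complex.re_le_norm _).trans ?_
        rw [norm_mul, norm_mul, norm_pow, hκ1, one_pow, mul_one]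
        have h3 : ‖s' - s‖ ≤ ε / (2 * M₀) := by
          rw [← dist_eq_norm]; exact (Metric.mem_ball.1 hs').le
        calc _ ≤ ε / (2 * M₀) * (M₀ * detOf y x) :=
              mul_le_mul h3 (hmem x hx) (norm_nonneg _) (by positivity)
          _ = _ := by field_simp
      linarith
  obtain ⟨N, ε, hε, H⟩ := hp
  have := hleast (M₀ - ε) fun x hx => by
    obtain ⟨s, hs, hse⟩ := Complex.exists_norm_eq_mul_self (h x)
    have h1 := H N le_rfl (s * (κ ^ N)⁻¹) (by simp [hs, hκ1]) x hx
    rw [inv_mul_cancel_right₀ (pow_ne_zero N hκ0), ← hse, Complex.ofReal_re] at h1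
    linarith
  linarith

lemma shift_real (hγ : 0 < γ) (hper : ∀ᵐ t ∂volume, b (t + γ) = b t)
    (ha : PosCoef (fun t => (-1) ^ m * b t) b₁ b₂) (hP : Perron b γ Δ y θ)
    {x : Fin m → ℝ} (hx : ∀ i, -1 ≤ x i) : detOf y (fun i => γ + x i) = Δ * detOf y x := by
  simpa using hP.shift_nat hγ hper ha 1 hx

lemma cls_add (ha : PosCoef (fun t => (-1) ^ m * b t) b₁ b₂) (hP : Perron b γ Δ y θ)
    (hh : Cls b h) (a : ℂ) : Cls b fun x => h x + a * detOf y x :=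
  hh.add ha.bddCoef (((hP.cls ha).clm ha.bddCoef Complex.ofRealCLM).const_mul ha.bddCoef a)

lemma rigid (hm : m = 2 ∨ m = 3) (hγ : 0 < γ) (hper : ∀ᵐ t ∂volume, b (t + γ) = b t)
    (ha : PosCoef (fun t => (-1) ^ m * b t) b₁ b₂)
    (hP : Perron b γ Δ y θ) (hh : Cls b h) (hκ : 1 ≤ ‖κ‖) {d : ℂ}
    (hper' : ∀ x : Fin m → ℝ, (∀ i, -1 ≤ x i) →
      h (fun i => γ + x i) = Δ * (κ * h x + d * detOf y x)) :
    ∃ a : ℂ, ∀ x : Fin m → ℝ, (∀ i, x i ∈ I01) → h x = a * detOf y x := by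
  suffices H : ∃ a : ℂ, ∀ x ∈ TsetR m, h x = a * detOf y x by
    obtain ⟨a, H⟩ := H
    refine ⟨a, fun x hx => ?_⟩
    have := (hP.cls_add ha hh (-a)).norm_le_of_sorted (S := 0)
      (fun x hx => by simp [H x hx]) hx
    have := norm_le_zero_iff.1 this
    linear_combination this
  have hκ0 : κ ≠ 0 := norm_pos_iff.1 (one_pos.trans_le hκ)
  have hT1 : ∀ x ∈ TsetR m, ∀ i, -1 ≤ x i := fun x hx i => (hx.1 i).1
  rcases eq_or_ne κ 1 with rfl | hne
  · rcases eq_or_ne d 0 with rfl | hd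
    · exact hP.rigid_aux hm hγ hper ha hh hκ (by simpa using hper')
    exfalso
    obtain ⟨M, hM⟩ := hP.exists_bound hm hγ hper ha hh hκ0 hper'
    obtain ⟨s, hs, hsd⟩ := Complex.exists_norm_eq_mul_self d
    have hn : ∀ n : ℕ, ∀ x ∈ TsetR m,
        h (fun i => n * γ + x i) = Δ ^ n * (h x + n * d * detOf y x) := by
      intro n x hx
      induction n with
      | zero => simp
      | succ n ih =>
        have e : (fun i => ((n + 1 : ℕ) : ℝ) * γ + x i) = fun i => γ + (n * γ + x i) := by
          funext i; push_cast; ring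
        rw [e, hper', ih, hP.shift_nat hγ hper ha n (hT1 x hx)]
        · push_cast; ring
        · intro i
          have : 0 ≤ n * γ := by positivity
          linarith [hT1 x hx i]
    obtain ⟨n, hn'⟩ := exists_nat_gt ((M - (s * h θ).re) / ‖d‖)
    rw [div_lt_iff₀ (norm_pos_iff.2 hd)] at hn'
    have h1 := hP.re_le hm ha hh (M := M) (s := s) (fun x hx => (Complex.re_le_norm _).trans (by
      rw [norm_mul, hs, one_mul]; exact hM x hx)) (τ := n * γ) (by positivity) hP.mem
    rw [hn n θ hP.mem, hP.shift_nat hγ hper ha n (hT1 θ hP.mem), hP.detOf_eq_one] at h1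
    have e : s * ((Δ : ℂ) ^ n * (h θ + n * d * (1 : ℝ))) =
        ((Δ ^ n : ℝ) : ℂ) * (s * h θ + ((n * ‖d‖ : ℝ) : ℂ)) := by
      push_cast
      rw [hsd]; ring
    rw [e, Complex.re_ofReal_mul, Complex.add_re, Complex.ofReal_re] at h1
    have := le_of_mul_le_mul_left (b := (s * h θ).re + n * ‖d‖) (c := M)
      (by linarith) (pow_pos hP.pos n)
    linarith
  · have hne' : κ - 1 ≠ 0 := sub_ne_zero.2 hne
    obtain ⟨a, ha'⟩ := hP.rigid_aux hm hγ hper ha (hP.cls_add ha hh (d / (κ - 1))) hκ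
      fun x hx => by
        rw [hper' x hx, hP.shift_real hγ hper ha hx]
        push_cast
        field_simp
        ring
    refine ⟨a - d / (κ - 1), fun x hx => ?_⟩
    linear_combination ha' x hx

end Perron

lemma Cls.sum {E : Type*} [NormedAddCommGroup E] [NormedSpace ℝ E] {m : ℕ} {b : ℝ → ℝ} {B : ℝ}
    (hb : BddCoef b B) {ι : Type*} (s : Finset ι) {K : ι → (Fin m → ℝ) → E}
    (hK : ∀ i ∈ s, Cls b (K i)) : Cls b (fun x => ∑ i ∈ s, K i x) := by
  classical
  induction s using Finset.induction_on with
  | empty => exact ⟨by simpa using continuous_const, by simp, fun j x => by simpa using Sol.zero (E := E) (b := b)⟩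
  | insert i s hi ih =>
    simp only [Finset.sum_insert hi]
    exact (hK i (by simp)).add hb (ih fun j hj => hK j (by simp [hj]))

lemma IsMonodromy.apply {b : ℝ → ℝ} {γ : ℝ} {M : CC →L[ℂ] CC}
    (hM : IsMonodromy (fun _ => 0) b γ M) {φ : CC} {x : ℝ → ℂ} (hx : Sol b x)
    (h : ∀ t : I01, x (t : ℝ) = φ t) (t : I01) : M φ t = x (γ + t) := by
  refine hM φ x ⟨hx.cont.continuousOn, fun t ht => ?_⟩ h t
  rw [hx.eqn 0 t le_rfl ht.1]
  simp

/-- The determinants `det (y_1, …, z, …, y_m)` combined with weights `c`. -/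
def weightedDet {m : ℕ} (y : Fin m → ℝ → ℂ) (z : ℝ → ℂ) (c : Fin m → ℂ) (x : Fin m → ℝ) : ℂ :=
  (fun j => z (x j)) ⬝ᵥ ((Matrix.of fun i j => y i (x j)).adjugate.mulVec c)

lemma weightedDet_eq_sum {m : ℕ} (y : Fin m → ℝ → ℂ) (z : ℝ → ℂ) (c : Fin m → ℂ)
    (x : Fin m → ℝ) : weightedDet y z c x = ∑ i, c i * detOf (Function.update y i z) x := by
  rw [weightedDet, Matrix.dotProduct_mulVec, dotProduct]
  refine Finset.sum_congr rfl fun i _ => ?_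
  rw [mul_comm, ← Matrix.mulVec_transpose, Matrix.adjugate_transpose,
    ← Matrix.cramer_eq_adjugate_mulVec, Matrix.cramer_transpose_apply, detOf]
  congr 2
  ext k j
  by_cases h : k = i
  · subst h; simp
  · simp [h]

lemma cls_weightedDet {m : ℕ} {b : ℝ → ℝ} {B : ℝ} (hb : BddCoef b B) {y : Fin m → ℝ → ℂ}
    {z : ℝ → ℂ} (hy : ∀ i, Sol b (y i)) (hz : Sol b z) (c : Fin m → ℂ) :
    Cls b (weightedDet y z c) := by
  have := Cls.sum hb Finset.univ (K := fun i x => c i * detOf (Function.update y i z) x)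
    fun i _ => (cls_detOf hb fun k => by
      by_cases h : k = i
      · subst h; simpa using hz
      · simpa [h] using hy k).const_mul hb (c i)
  convert this using 1
  funext x
  exact weightedDet_eq_sum y z c x

lemma weightedDet_add_sum {m : ℕ} (y : Fin m → ℝ → ℂ) (z : ℝ → ℂ) (c d : Fin m → ℂ)
    (x : Fin m → ℝ) : weightedDet y (fun t => z t + ∑ i, d i * y i t) c x =
      weightedDet y z c x + d ⬝ᵥ c * detOf y x := by
  have e : (fun j => z (x j) + ∑ i, d i * y i (x j)) =
      (fun j => z (x j)) + Matrix.vecMul d (Matrix.of fun i j => y i (x j)) := by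
    ext j; simp [Matrix.vecMul, dotProduct]
  rw [weightedDet, e, add_dotProduct, Matrix.dotProduct_mulVec (Matrix.vecMul _ _),
    Matrix.vecMul_vecMul, Matrix.mul_adjugate, Matrix.vecMul_smul, Matrix.vecMul_one,
    smul_dotProduct, smul_eq_mul, mul_comm (Matrix.det _)]
  rfl

/-- Behaviour of `weightedDet` under a linear change of the tuple with eigenvector `c`. -/
lemma weightedDet_mulVec {m : ℕ} {y y' : Fin m → ℝ → ℂ} {z : ℝ → ℂ} {c : Fin m → ℂ}
    {A : Matrix (Fin m) (Fin m) ℂ} {ν : ℂ} (hν : ν ≠ 0) (hc : A.mulVec c = ν • c)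
    {x x' : Fin m → ℝ} (hy : ∀ i j, y' i (x' j) = ∑ l, A i l * y l (x j))
    (z' : ℝ → ℂ) (hz : ∀ j, z' (x' j) = z (x j)) :
    weightedDet y' z' c x' = A.det / ν * weightedDet y z c x := by
  have e : (Matrix.of fun i j => y' i (x' j)) = A * Matrix.of fun i j => y i (x j) := by
    ext i j; simp [Matrix.mul_apply, hy]
  have e2 : A.adjugate.mulVec c = (A.det / ν) • c := by
    have h1 := congrArg A.adjugate.mulVec hc
    rw [Matrix.mulVec_mulVec, Matrix.adjugate_mul, Matrix.smul_mulVec, Matrix.one_mulVec,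
      Matrix.mulVec_smul] at h1
    rw [div_eq_inv_mul, mul_smul, h1, smul_smul, inv_mul_cancel₀ hν, one_smul]
  rw [weightedDet, weightedDet, e, Matrix.adjugate_mul_distrib, ← Matrix.mulVec_mulVec, e2,
    Matrix.mulVec_smul, dotProduct_smul, smul_eq_mul]
  congr 2
  ext j
  exact hz j

lemma detOf_ofReal {m : ℕ} (y : Fin m → ℝ → ℝ) (x : Fin m → ℝ) :
    detOf (fun i t => (y i t : ℂ)) x = (detOf y x : ℝ) := by
  unfold detOf
  rw [← Complex.ofRealHom_eq_coe, RingHom.map_det]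
  rfl

/-- Restriction of a real tuple to `[-1, 0]`, with complex values. -/
def segC {m : ℕ} {b : ℝ → ℝ} {y : Fin m → ℝ → ℝ} (hy : ∀ i, Sol b (y i)) (i : Fin m) : CC :=
  ⟨fun t => (y i t : ℂ), by have := (hy i).cont; fun_prop⟩

namespace Perron

variable {m : ℕ} {b : ℝ → ℝ} {b₁ b₂ γ Δ : ℝ} {y : Fin m → ℝ → ℝ} {θ : Fin m → ℝ}

/-- The complex span of the Perron tuple on `[-1, 0]`. -/
def W (hP : Perron b γ Δ y θ) : Submodule ℂ CC := Submodule.span ℂ (Set.range (segC hP.sol))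

/-- The matrix of the monodromy operator on the span of the Perron tuple. -/
def A (_ : Perron b γ Δ y θ) : Matrix (Fin m) (Fin m) ℂ :=
  Matrix.of fun i j => ((y i (γ + θ j) : ℝ) : ℂ)

lemma det_A (hP : Perron b γ Δ y θ) : hP.A.det = Δ := by
  have h1 := hP.det_ne_zero
  have h2 := detOf_ofReal (fun i t => y i (γ + t)) θ
  rw [show detOf (fun i t => y i (γ + t)) θ = Δ from h1] at h2
  exact h2

lemma monodromy_segC (hγ : 0 < γ) (hper : ∀ᵐ t ∂volume, b (t + γ) = b t)
    (ha : PosCoef (fun t => (-1) ^ m * b t) b₁ b₂) (hP : Perron b γ Δ y θ) {M : CC →L[ℂ] CC}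
    (hM : IsMonodromy (fun _ => 0) b γ M) (i : Fin m) :
    M (segC hP.sol i) = ∑ l, hP.A i l • segC hP.sol l := by
  ext t
  rw [hM.apply ((hP.sol i).clm ha.bddCoef Complex.ofRealCLM) (fun t => rfl)]
  rw [hP.shift_apply hγ hper ha i t.2.1]
  simp [ContinuousMap.coe_sum, A, segC]

lemma mem_W {hP : Perron b γ Δ y θ} {φ : CC} :
    φ ∈ hP.W ↔ ∃ d : Fin m → ℂ, ∀ t : I01, φ t = ∑ i, d i * (y i t : ℂ) := by
  rw [W, Submodule.mem_span_range_iff_exists_fun]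
  refine exists_congr fun d => ?_
  rw [eq_comm, ContinuousMap.ext_iff]
  simp [ContinuousMap.coe_sum, segC]

/-- The span of the Perron tuple splits off from the rest of the spectrum. -/
theorem mem_W_of_sub_mem (hm : m = 2 ∨ m = 3) (hγ : 0 < γ)
    (hper : ∀ᵐ t ∂volume, b (t + γ) = b t)
    (ha : PosCoef (fun t => (-1) ^ m * b t) b₁ b₂) (hP : Perron b γ Δ y θ) {M : CC →L[ℂ] CC}
    (hM : IsMonodromy (fun _ => 0) b γ M) {c : Fin m → ℂ} (hc : c ≠ 0) {ν μ : ℂ} (hν : ν ≠ 0)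
    (hA : hP.A.mulVec c = ν • c) (hμ : ‖ν‖ ≤ ‖μ‖) {z : CC} (hz : M z - μ • z ∈ hP.W) :
    z ∈ hP.W := by
  have hb := ha.bddCoef
  obtain ⟨d, hd⟩ := mem_W.1 hz
  have hZ := sol_solExt hb z
  set Z := solExt hb z with hZdef
  have hZz : ∀ t : I01, Z (t : ℝ) = z t := solExt_apply hb z
  set w : Fin m → ℝ → ℂ := fun i t => (y i t : ℂ) with hw
  have hws : ∀ i, Sol b (w i) := fun i => (hP.sol i).clm hb Complex.ofRealCLM
  have hZγ : ∀ t, -1 ≤ t → Z (γ + t) = μ * (Z t + ∑ i, d i / μ * w i t) := by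
    intro t ht
    have hμ0 : μ ≠ 0 := norm_pos_iff.1 ((norm_pos_iff.2 hν).trans_le hμ)
    refine (hZ.shift hγ.le hper).eq_of_eq hb (((hZ.add hb (Sol.sum hb Finset.univ
      fun i _ => (hws i).const_mul hb (d i / μ))).const_mul hb μ)) (fun t ht => ?_) ht
    have h1 := hd ⟨t, ht⟩
    have h2 := hM.apply hZ hZz ⟨t, ht⟩
    have h3 := hZz ⟨t, ht⟩
    simp only at h2 h3
    rw [ContinuousMap.sub_apply, h2, ContinuousMap.smul_apply, smul_eq_mul, ← h3] at h1
    rw [mul_add, Finset.mul_sum]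
    have : ∑ i, μ * (d i / μ * w i t) = ∑ i, d i * (y i t : ℂ) :=
      Finset.sum_congr rfl fun i _ => by rw [hw]; field_simp
    rw [this, ← h1]
    ring
  have hμ0 : μ ≠ 0 := norm_pos_iff.1 ((norm_pos_iff.2 hν).trans_le hμ)
  obtain ⟨a, ha'⟩ := hP.rigid hm hγ hper ha (cls_weightedDet hb hws hZ c)
    (κ := μ / ν) (d := μ / ν * ((fun i => d i / μ) ⬝ᵥ c))
    (by rw [norm_div, one_le_div (norm_pos_iff.2 hν)]; exact hμ) fun x hx => by
      have h1 := weightedDet_mulVec (y := w) (y' := w) (z := fun t => μ * (Z t + ∑ i, d i / μ * w i t))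
        hν hA (x := x) (x' := fun i => γ + x i) (fun i j => by
          simp [hw, A, hP.shift_apply hγ hper ha i (hx j)]) Z (fun j => hZγ _ (hx j))
      have h2 : weightedDet w (fun t => μ * (Z t + ∑ i, d i / μ * w i t)) c x =
          μ * weightedDet w (fun t => Z t + ∑ i, d i / μ * w i t) c x := by
        simp only [weightedDet, ← smul_eq_mul (a := μ)]
        rw [← smul_dotProduct]
        rfl
      rw [h1, h2, weightedDet_add_sum, hP.det_A, hw, detOf_ofReal]
      field_simp
  set e : Fin m → ℂ := fun j => -Z (θ j) with he
  have hzero : ∀ x : Fin m → ℝ, (∀ i, x i ∈ I01) →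
      weightedDet w (fun t => Z t + ∑ i, e i * w i t) c x = (a + e ⬝ᵥ c) * (detOf y x : ℝ) := by
    intro x hx
    rw [weightedDet_add_sum, ha' x hx, hw, detOf_ofReal]
    ring
  have hZ0 : ∀ j, Z (θ j) + ∑ i, e i * w i (θ j) = 0 := by
    intro j
    simp [hw, hP.apply, he, apply_ite Complex.ofReal]
  have hae : a + e ⬝ᵥ c = 0 := by
    have := hzero θ hP.mem.1
    rw [hP.detOf_eq_one, Complex.ofReal_one, mul_one] at this
    rw [← this, weightedDet]
    simp only [hZ0]
    exact zero_dotProduct _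
  obtain ⟨j, hj⟩ := Function.ne_iff.1 hc
  refine mem_W.2 ⟨-e, fun t => ?_⟩
  have hx : ∀ i, Function.update θ j (t : ℝ) i ∈ I01 := by
    intro i
    by_cases h' : i = j
    · subst h'; simp
    · simpa [h'] using hP.mem.1 i
  have h1 := hzero _ hx
  rw [hae, zero_mul, weightedDet, dotProduct, Finset.sum_eq_single j] at h1
  · rw [← Matrix.cramer_eq_adjugate_mulVec, Matrix.cramer_apply] at h1
    have h2 : (Matrix.of fun i k => w i (Function.update θ j (t : ℝ) k)).updateCol j c =
        (1 : Matrix (Fin m) (Fin m) ℂ).updateCol j c := by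
      ext i k
      by_cases h' : k = j
      · subst h'; simp
      · simp [h', hw, hP.apply, Matrix.one_apply, apply_ite Complex.ofReal]
    rw [h2, ← Matrix.cramer_apply, Matrix.cramer_one, Function.update_self] at h1
    have h3 := (mul_eq_zero.1 h1).resolve_right hj
    rw [← hZz t]
    simp only [Pi.neg_apply, neg_mul, Finset.sum_neg_distrib]
    exact eq_neg_of_add_eq_zero_left h3
  · intro k _ hk
    simp only [Function.update_of_ne hk, hZ0, zero_mul]
  · simp

end Perron

lemma finrank_finset_sup_le {V ι : Type*} [AddCommGroup V] [Module ℂ V] [FiniteDimensional ℂ V]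
    (s : Finset ι) (p : ι → Submodule ℂ V) :
    Module.finrank ℂ (s.sup p : Submodule ℂ V) ≤ ∑ i ∈ s, Module.finrank ℂ (p i) := by
  classical
  induction s using Finset.induction_on with
  | empty => simp
  | insert i s hi ih =>
    rw [Finset.sup_insert, Finset.sum_insert hi]
    exact (Submodule.finrank_add_le_finrank_add_finrank _ _).trans (by gcongr)

lemma finrank_le_sum_maxGenEigenspace {V : Type*} [AddCommGroup V] [Module ℂ V]
    [FiniteDimensional ℂ V] (f : Module.End ℂ V) (s : Finset ℂ)
    (hs : ∀ μ, f.HasEigenvalue μ → μ ∈ s) :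
    Module.finrank ℂ V ≤ ∑ μ ∈ s, Module.finrank ℂ (f.maxGenEigenspace μ) := by
  refine le_trans ?_ (finrank_finset_sup_le s f.maxGenEigenspace)
  have h : s.sup f.maxGenEigenspace = ⊤ := by
    rw [eq_top_iff, ← Module.End.iSup_maxGenEigenspace_eq_top f]
    refine iSup_le fun μ => ?_
    by_cases hμ : μ ∈ s
    · exact Finset.le_sup (f := f.maxGenEigenspace) hμ
    · have : f.maxGenEigenspace μ = ⊥ := by
        by_contra hne
        have : f.HasUnifEigenvalue μ ⊤ := hne
        exact hμ (hs μ (this.lt zero_lt_one))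
      rw [this]
      exact bot_le
  rw [h, finrank_top]

lemma finrank_maxGenEigenspace_le_algMult {V : Type*} [AddCommGroup V] [Module ℂ V]
    {M : CC →L[ℂ] CC} {g : Module.End ℂ V} {ι : V →ₗ[ℂ] CC} (hι : Function.Injective ι)
    (hg : ∀ v, M (ι v) = ι (g v)) (μ : ℂ) [FiniteDimensional ℂ (genEig M μ)] :
    Module.finrank ℂ (g.maxGenEigenspace μ) ≤ algMult M μ := by
  have key : ∀ (n : ℕ) (v : V), ((M - μ • (1 : CC →L[ℂ] CC)) ^ n) (ι v) =
      ι (((g - μ • (1 : Module.End ℂ V)) ^ n) v) := by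
    intro n
    induction n with
    | zero => intro v; simp
    | succ n ih =>
      intro v
      rw [pow_succ, pow_succ, Module.End.mul_apply, ← ih, mul_apply_eq_comp]
      simp [hg]
  rw [(Submodule.equivMapOfInjective ι hι _).finrank_eq]
  refine Submodule.finrank_mono ?_
  rintro _ ⟨v, hv, rfl⟩
  obtain ⟨k, hk⟩ := (Module.End.mem_maxGenEigenspace _ _ _).1 hv
  refine (le_iSup (fun n : ℕ => LinearMap.ker
    ((M - μ • (1 : CC →L[ℂ] CC)) ^ n).toLinearMap) k) ?_
  change ((M - μ • (1 : CC →L[ℂ] CC)) ^ k) (ι v) = 0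
  rw [key, hk, map_zero]

lemma genEig_le_of_sub_mem (M : CC →L[ℂ] CC) (μ : ℂ) {W : Submodule ℂ CC}
    (hW : ∀ z, M z - μ • z ∈ W → z ∈ W) : genEig M μ ≤ W := by
  refine iSup_le fun n => ?_
  induction n with
  | zero =>
    intro z hz
    have : z = 0 := by simpa using hz
    simp [this]
  | succ n ih =>
    intro z hz
    refine hW z (ih ?_)
    have hz' : ((M - μ • (1 : CC →L[ℂ] CC)) ^ (n + 1)) z = 0 := hz
    rw [pow_succ] at hz'
    exact hz'

/-- If the enumeration has fewer than `m` members in a finite set of multipliers, the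
multiplicities in that set sum to less than `m`. -/
lemma sum_algMult_lt {M : CC →L[ℂ] CC} {Λ : ℕ → ℂ} (hΛ : IsOrderedEnum M Λ) {m : ℕ} (hm : 1 ≤ m)
    (s : Finset ℂ) (hs : ∀ μ ∈ s, IsFloquetMult M μ ∧ ‖Λ m‖ < ‖μ‖) :
    ∑ μ ∈ s, algMult M μ < m := by
  classical
  have hanti : ∀ k, m ≤ k → ‖Λ k‖ ≤ ‖Λ m‖ := by
    intro k hk
    induction k, hk using Nat.le_induction with
    | base => exact le_rfl
    | succ k hk ih => exact (hΛ.1 k (hm.trans hk)).trans ih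
  have h1 : ∀ μ ∈ s, algMult M μ = ((Finset.Ico 1 m).filter fun k => Λ k = μ).card := by
    intro μ hμ
    rw [← hΛ.2.2 μ (hs μ hμ).1, Nat.card_coe_set_eq, ← Set.ncard_coe_finset]
    congr 1
    ext k
    simp only [Set.mem_ofPred_eq, Finset.coe_filter, Finset.mem_Ico]
    constructor
    · rintro ⟨hk, rfl⟩
      refine ⟨⟨hk, ?_⟩, rfl⟩
      by_contra! h
      exact absurd (hanti k h) (not_le.2 (hs _ hμ).2)
    · rintro ⟨⟨hk, _⟩, h⟩
      exact ⟨hk, h⟩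
  rw [Finset.sum_congr rfl h1, ← Finset.card_biUnion]
  · calc _ ≤ (Finset.Ico 1 m).card := Finset.card_le_card (by
          intro k hk
          simp only [Finset.mem_biUnion, Finset.mem_filter] at hk
          obtain ⟨_, _, h, _⟩ := hk
          exact h)
      _ < m := by simp; omega
  · intro μ _ μ' _ hne
    rw [Function.onFun, Finset.disjoint_left]
    intro k hk hk'
    simp only [Finset.mem_filter] at hk hk'
    exact hne (hk.2.symm.trans hk'.2)

namespace Perron

variable {m : ℕ} {b : ℝ → ℝ} {b₁ b₂ γ Δ : ℝ} {y : Fin m → ℝ → ℝ} {θ : Fin m → ℝ}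

/-- The parametrization of the Perron span by coefficients. -/
def comb (hP : Perron b γ Δ y θ) : (Fin m → ℂ) →ₗ[ℂ] CC :=
  Fintype.linearCombination ℂ (segC hP.sol)

lemma comb_apply (hP : Perron b γ Δ y θ) (d : Fin m → ℂ) (j : Fin m) :
    hP.comb d ⟨θ j, hP.mem.1 j⟩ = d j := by
  simp [comb, Fintype.linearCombination_apply, ContinuousMap.coe_sum, segC, hP.apply,
    apply_ite Complex.ofReal]

lemma comb_injective (hP : Perron b γ Δ y θ) : Function.Injective hP.comb := by
  intro d e h
  ext j
  rw [← hP.comb_apply d j, h, hP.comb_apply]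

lemma monodromy_comb (hγ : 0 < γ) (hper : ∀ᵐ t ∂volume, b (t + γ) = b t)
    (ha : PosCoef (fun t => (-1) ^ m * b t) b₁ b₂) (hP : Perron b γ Δ y θ) {M : CC →L[ℂ] CC}
    (hM : IsMonodromy (fun _ => 0) b γ M) (d : Fin m → ℂ) :
    M (hP.comb d) = hP.comb (Matrix.toLin' hP.A.transpose d) := by
  simp only [comb, Fintype.linearCombination_apply, map_sum, map_smul,
    hP.monodromy_segC hγ hper ha hM, Finset.smul_sum, Matrix.toLin'_apply,
    Matrix.mulVec_transpose, Matrix.vecMul, dotProduct, Finset.sum_smul, smul_smul]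
  exact Finset.sum_comm

/-- The space attached to the first `m` multipliers is contained in the Perron span. -/
theorem Hspan_le (hm : m = 2 ∨ m = 3) (hγ : 0 < γ) (hper : ∀ᵐ t ∂volume, b (t + γ) = b t)
    (ha : PosCoef (fun t => (-1) ^ m * b t) b₁ b₂) (hP : Perron b γ Δ y θ) {M : CC →L[ℂ] CC}
    (hM : IsMonodromy (fun _ => 0) b γ M) {Λ : ℕ → ℂ} (hΛ : IsOrderedEnum M Λ) :
    Hspan M Λ m ≤ hP.W := by
  have hm1 : 1 ≤ m := by omega
  have : Nonempty (Fin m) := ⟨⟨0, hm1⟩⟩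
  set f : Module.End ℂ (Fin m → ℂ) := Matrix.toLin' hP.A.transpose with hf
  have hfM : ∀ d, M (hP.comb d) = hP.comb (f d) := hP.monodromy_comb hγ hper ha hM
  obtain ⟨ν, hνf, hνmin⟩ := Set.exists_min_image {μ | f.HasEigenvalue μ} (fun μ => ‖μ‖)
    f.finite_hasEigenvalue (Module.End.exists_eigenvalue f)
  have hdet : hP.A.det ≠ 0 := by
    rw [hP.det_A]; exact_mod_cast hP.pos.ne'
  have hvec : ∀ μ, f.HasEigenvalue μ → ∃ v, v ≠ 0 ∧ Matrix.vecMul v hP.A = μ • v := by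
    intro μ hμ
    obtain ⟨v, hv⟩ := Module.End.HasEigenvalue.exists_hasEigenvector hμ
    refine ⟨v, hv.2, ?_⟩
    have := hv.apply_eq_smul
    rwa [hf, Matrix.toLin'_apply, Matrix.mulVec_transpose] at this
  have hne : ∀ μ, f.HasEigenvalue μ → μ ≠ 0 := by
    rintro μ hμ rfl
    obtain ⟨v, hv, h⟩ := hvec 0 hμ
    exact hdet (Matrix.exists_vecMul_eq_zero_iff.1 ⟨v, hv, by rw [h, zero_smul]⟩)
  obtain ⟨c, hc, hAc⟩ : ∃ c, c ≠ 0 ∧ hP.A.mulVec c = ν • c := by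
    obtain ⟨v, hv, h⟩ := hvec ν hνf
    have hsing : (hP.A - ν • 1).det = 0 := Matrix.exists_vecMul_eq_zero_iff.1 ⟨v, hv, by
      rw [Matrix.vecMul_sub, h, Matrix.vecMul_smul, Matrix.vecMul_one, sub_self]⟩
    obtain ⟨c, hc, h'⟩ := Matrix.exists_mulVec_eq_zero_iff.2 hsing
    refine ⟨c, hc, ?_⟩
    rwa [Matrix.sub_mulVec, Matrix.smul_mulVec, Matrix.one_mulVec, sub_eq_zero] at h'
  have hgen : ∀ μ : ℂ, ‖ν‖ ≤ ‖μ‖ → genEig M μ ≤ hP.W := fun μ hμ =>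
    genEig_le_of_sub_mem M μ fun z hz =>
      hP.mem_W_of_sub_mem hm hγ hper ha hM hc (hne ν hνf) hAc hμ hz
  have hflo : ∀ μ, f.HasEigenvalue μ → IsFloquetMult M μ := by
    intro μ hμ
    obtain ⟨v, hv⟩ := Module.End.HasEigenvalue.exists_hasEigenvector hμ
    exact ⟨hne μ hμ, hP.comb v, (map_ne_zero_iff _ hP.comb_injective).2 hv.2, by
      rw [hfM, hv.apply_eq_smul, map_smul]⟩
  have hle : ‖ν‖ ≤ ‖Λ m‖ := by
    by_contra! hlt
    set s := f.finite_hasEigenvalue.toFinset with hs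
    have hmem : ∀ μ, μ ∈ s ↔ f.HasEigenvalue μ := fun μ => by rw [hs]; simp
    have h1 := sum_algMult_lt hΛ hm1 s fun μ hμ =>
      ⟨hflo μ ((hmem μ).1 hμ), hlt.trans_le (hνmin μ ((hmem μ).1 hμ))⟩
    have h2 := finrank_le_sum_maxGenEigenspace f s fun μ hμ => (hmem μ).2 hμ
    rw [Module.finrank_fin_fun] at h2
    refine absurd (h2.trans (Finset.sum_le_sum fun μ hμ => ?_)) (not_le.2 h1)
    have : FiniteDimensional ℂ hP.W := FiniteDimensional.span_of_finite ℂ (Set.finite_range _)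
    have : FiniteDimensional ℂ (genEig M μ) :=
      Submodule.finiteDimensional_of_le (hgen μ (hνmin μ ((hmem μ).1 hμ)))
    exact finrank_maxGenEigenspace_le_algMult hP.comb_injective hfM μ
  exact iSup₂_le fun μ hμ => hgen μ (hle.trans hμ.2)

end Perron

lemma MeasureTheory.LocallyIntegrable.intervalIntegrable_of_real {g : ℝ → ℝ}
    (hg : LocallyIntegrable g volume) (a b : ℝ) : IntervalIntegrable g volume a b :=
  intervalIntegrable_iff.2
    ((hg.integrableOn_isCompact isCompact_uIcc).mono_set Set.uIoc_subset_uIcc)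

lemma AbsolutelyContinuousOnInterval.of_dist_le {X Y : Type*} [PseudoMetricSpace X]
    [PseudoMetricSpace Y] {f : ℝ → X} {h : ℝ → Y} {a b C : ℝ}
    (hh : AbsolutelyContinuousOnInterval h a b)
    (hle : ∀ x ∈ Set.uIcc a b, ∀ y ∈ Set.uIcc a b, dist (f x) (f y) ≤ C * dist (h x) (h y)) :
    AbsolutelyContinuousOnInterval f a b := by
  unfold AbsolutelyContinuousOnInterval at hh ⊢
  refine squeeze_zero' ?_ ?_ (by simpa using hh.const_mul C)
  · exact Filter.Eventually.of_forall fun _ => Finset.sum_nonneg fun i _ => dist_nonneg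
  rw [Filter.eventually_inf_principal]
  refine Filter.Eventually.of_forall fun ⟨n, I⟩ hI => ?_
  rw [Finset.mul_sum]
  exact Finset.sum_le_sum fun i hi => hle _ (hI.1 i hi).1 _ (hI.1 i hi).2

section Primitive

variable {E : Type*} [NormedAddCommGroup E] [NormedSpace ℝ E]

lemma IntervalIntegrable.absolutelyContinuousOnInterval_primitive {g : ℝ → E}
    {a b : ℝ} (hg : IntervalIntegrable g volume a b) :
    AbsolutelyContinuousOnInterval (fun x => ∫ v in a..x, g v) a b := by
  have hn := hg.norm.absolutelyContinuousOnInterval_intervalIntegral (c := a) Set.left_mem_uIcc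
  refine hn.of_dist_le (C := 1) fun x hx y hy => ?_
  have hsub : ∀ z ∈ Set.uIcc a b, IntervalIntegrable g volume a z := fun z hz =>
    hg.mono_set (Set.uIcc_subset_uIcc_left hz)
  rw [one_mul, dist_eq_norm, Real.dist_eq,
    intervalIntegral.integral_interval_sub_left (hsub x hx) (hsub y hy),
    intervalIntegral.integral_interval_sub_left (hsub x hx).norm (hsub y hy).norm]
  exact intervalIntegral.norm_integral_le_abs_integral_norm

variable [CompleteSpace E]

/-- The integrating factor `exp ∘ A` applied to a primitive. -/
lemma exp_smul_primitive {α A : ℝ → ℝ} (hα : LocallyIntegrable α volume)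
    (hA : ∀ t, A t = ∫ s in (0 : ℝ)..t, α s) {f g : ℝ → E} {τ T : ℝ} (hτ : τ ≤ T)
    (hg : IntervalIntegrable g volume τ T)
    (hf : ∀ t ∈ Set.Icc τ T, f t = f τ - ∫ s in τ..t, g s) :
    ∀ t ∈ Set.Icc τ T, Real.exp (A t) • f t =
      Real.exp (A τ) • f τ - ∫ s in τ..t, Real.exp (A s) • (g s - α s • f s) := by
  have hαi : ∀ a b, IntervalIntegrable α volume a b := fun a b => hα.intervalIntegrable_of_real a b
  have hAc : Continuous A := by
    rw [show A = _ from funext hA]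
    exact intervalIntegral.continuous_primitive hαi 0
  have hAac : AbsolutelyContinuousOnInterval A τ T := by
    refine ((hαi τ T).absolutelyContinuousOnInterval_primitive).of_dist_le (C := 1)
      fun x _ y _ => le_of_eq ?_
    rw [one_mul, hA, hA, Real.dist_eq, Real.dist_eq,
      intervalIntegral.integral_interval_sub_left (hαi _ _) (hαi _ _),
      intervalIntegral.integral_interval_sub_left (hαi _ _) (hαi _ _)]
  have hexp : AbsolutelyContinuousOnInterval (fun t => Real.exp (A t)) τ T := by
    obtain ⟨D, hD⟩ := hAac.exists_bound
    have hcd : ContDiffOn ℝ 1 Real.exp (Set.Icc (-D) D) := Real.contDiff_exp.contDiffOn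
    obtain ⟨K, hK⟩ := hcd.exists_lipschitzOnWith (by decide) (convex_Icc _ _) isCompact_Icc
    exact hAac.of_dist_le (C := K) fun x hx y hy =>
      hK.dist_le_mul _ (abs_le.1 (hD x hx)) _ (abs_le.1 (hD y hy))
  set F : ℝ → E := fun t => f τ - ∫ s in τ..t, g s with hF
  have hFac : AbsolutelyContinuousOnInterval F τ T := by
    refine (hg.absolutelyContinuousOnInterval_primitive).of_dist_le (C := 1)
      fun x _ y _ => le_of_eq ?_
    rw [hF, one_mul, dist_sub_left]
  have hFc := hFac.continuousOn
  set G : ℝ → E := fun s => Real.exp (A s) • (g s - α s • F s) with hG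
  have hGi : IntervalIntegrable G volume τ T :=
    (hg.sub ((hαi τ T).smul_continuousOn hFc)).continuousOn_smul
      (Real.continuous_exp.comp hAc).continuousOn
  have hPac := (hexp.fun_smul hFac).fun_add (hGi.absolutelyContinuousOnInterval_primitive)
  obtain ⟨c, hc⟩ := hPac.const_of_ae_hasDerivAt_zero (by
    filter_upwards [LocallyIntegrable.ae_hasDerivAt_integral hα, hg.ae_hasDerivAt_integral,
      hGi.ae_hasDerivAt_integral] with x h1 h2 h3 hx
    have h1' : HasDerivAt A (α x) x := by
      have := h1 0
      rwa [← show A = _ from funext hA] at this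
    have h2' : HasDerivAt F (-g x) x := (h2 hx τ Set.left_mem_uIcc).const_sub _
    have := (h1'.exp.smul h2').add (h3 hx τ Set.left_mem_uIcc)
    refine this.congr_deriv ?_
    simp only [hG, smul_sub, smul_neg, smul_smul]
    abel)
  intro t ht
  have e1 := hc t (by rwa [Set.uIcc_of_le hτ])
  have e2 := hc τ Set.left_mem_uIcc
  have hFt : ∀ s ∈ Set.Icc τ T, F s = f s := fun s hs => (hf s hs).symm
  rw [← e2, hFt t ht, hFt τ ⟨le_rfl, hτ⟩, intervalIntegral.integral_same, add_zero] at e1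
  rw [← e1, eq_sub_iff_add_eq]
  congr 1
  refine intervalIntegral.integral_congr fun s hs => ?_
  rw [Set.uIcc_of_le ht.1] at hs
  simp only [hG, hFt s ⟨hs.1, hs.2.trans ht.2⟩]

end Primitive

/-- The coefficient of the transformed equation without instantaneous term. -/
def reducedCoef (A β : ℝ → ℝ) (t : ℝ) : ℝ := β t * Real.exp (A t - A (t - 1))

lemma IsSolution.exp_mul {α β A : ℝ → ℝ} (hα : LocallyIntegrable α volume)
    (hβ : LocallyIntegrable β volume) (hA : ∀ t, A t = ∫ s in (0 : ℝ)..t, α s) {x : ℝ → ℝ}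
    (hx : Continuous x) {τ T : ℝ} (hτ : τ ≤ T) (h : IsSolution α β τ T x) :
    Real.exp (A T) * x T = Real.exp (A τ) * x τ -
      ∫ s in τ..T, reducedCoef A β s • (Real.exp (A (s - 1)) * x (s - 1)) := by
  have hi : IntervalIntegrable (fun s => α s * x s + β s * x (s - 1)) volume τ T :=
    ((hα.intervalIntegrable_of_real _ _).mul_continuousOn hx.continuousOn).add
      ((hβ.intervalIntegrable_of_real _ _).mul_continuousOn (hx.comp (continuous_sub_right 1)).continuousOn)
  have := exp_smul_primitive hα hA hτ hi h.2 T ⟨hτ, le_rfl⟩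
  simp only [smul_eq_mul] at this
  rw [this]
  congr 1
  refine intervalIntegral.integral_congr fun s _ => ?_
  simp only [reducedCoef, smul_eq_mul, Real.exp_sub]
  field_simp
  ring

lemma IsSolutionC.exp_neg_smul {α β A : ℝ → ℝ} (hα : LocallyIntegrable α volume)
    (hβ : LocallyIntegrable β volume) (hA : ∀ t, A t = ∫ s in (0 : ℝ)..t, α s) {y : ℝ → ℂ}
    {τ T : ℝ} (hτ : τ ≤ T) (h : IsSolutionC (fun _ => 0) (reducedCoef A β) τ T y) :
    IsSolutionC α β τ T (fun t => Real.exp (-A t) • y t) := by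
  have hAc : Continuous A := by
    rw [show A = _ from funext hA]
    exact intervalIntegral.continuous_primitive (fun a b => hα.intervalIntegrable_of_real a b) 0
  refine ⟨(Real.continuous_exp.comp hAc.neg).continuousOn.smul h.1, fun t ht => ?_⟩
  have hyd : ContinuousOn (fun s => Real.exp (A s - A (s - 1)) • y (s - 1)) (Set.uIcc τ T) := by
    have hc : Continuous fun s => Real.exp (A s - A (s - 1)) := by fun_prop
    refine hc.continuousOn.smul (h.1.comp (continuous_sub_right 1).continuousOn fun s hs => ?_)
    rw [Set.uIcc_of_le hτ] at hs
    exact ⟨by linarith [hs.1], by linarith [hs.2]⟩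
  have hi : IntervalIntegrable (fun s => β s • (Real.exp (A s - A (s - 1)) • y (s - 1)))
      volume τ T := (hβ.intervalIntegrable_of_real _ _).smul_continuousOn hyd
  have := exp_smul_primitive (α := fun s => -α s) (A := fun s => -A s) hα.neg
    (fun t => by simp [hA]) hτ hi (f := y) (fun t ht => by
      rw [h.2 t ht]
      congr 1
      refine intervalIntegral.integral_congr fun s _ => ?_
      simp [reducedCoef, mul_assoc]) t ht
  refine this.trans ?_
  congr 1
  refine intervalIntegral.integral_congr fun s _ => ?_
  have e1 : Real.exp (-A s) * (β s * Real.exp (A s - A (s - 1))) =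
      β s * Real.exp (-A (s - 1)) := by
    rw [show A s - A (s - 1) = A s + -A (s - 1) by ring, Real.exp_add, Real.exp_neg (A s)]
    field_simp
  have e2 : ((Real.exp (-A s) * (β s * Real.exp (A s - A (s - 1))) : ℝ) : ℂ) =
      (β s * Real.exp (-A (s - 1)) : ℝ) := by rw [e1]
  push_cast at e2
  simp only [Complex.real_smul]
  push_cast
  linear_combination y (s - 1) * e2

section Conjugation

variable {M N : CC →L[ℂ] CC} {S : CC ≃ₗ[ℂ] CC} {c : ℂ}

lemma genEig_conj (hc : c ≠ 0) (h : ∀ φ, N (S φ) = c • S (M φ)) (μ : ℂ) :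
    genEig N (c * μ) = (genEig M μ).map (S : CC →ₗ[ℂ] CC) := by
  have key : ∀ (n : ℕ) (φ : CC), ((N - (c * μ) • (1 : CC →L[ℂ] CC)) ^ n) (S φ) =
      c ^ n • S (((M - μ • (1 : CC →L[ℂ] CC)) ^ n) φ) := by
    intro n
    induction n with
    | zero => intro φ; simp
    | succ n ih =>
      intro φ
      have h1 : (N - (c * μ) • (1 : CC →L[ℂ] CC)) (S φ) =
          S (c • (M - μ • (1 : CC →L[ℂ] CC)) φ) := by
        simp [h, smul_sub, smul_smul]
      rw [pow_succ, mul_apply_eq_comp, h1, ih, map_smul, map_smul, smul_smul, ← pow_succ,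
        pow_succ (M - μ • 1), mul_apply_eq_comp]
  rw [genEig, genEig, Submodule.map_iSup]
  congr 1
  ext n φ
  obtain ⟨φ, rfl⟩ := S.surjective φ
  have hmap : S φ ∈ (LinearMap.ker ((M - μ • (1 : CC →L[ℂ] CC)) ^ n).toLinearMap).map
      (S : CC →ₗ[ℂ] CC) ↔ φ ∈ LinearMap.ker ((M - μ • (1 : CC →L[ℂ] CC)) ^ n).toLinearMap := by
    rw [Submodule.mem_map_equiv, LinearEquiv.symm_apply_apply]
  rw [hmap, LinearMap.mem_ker, LinearMap.mem_ker]
  change ((N - (c * μ) • (1 : CC →L[ℂ] CC)) ^ n) (S φ) = 0 ↔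
    ((M - μ • (1 : CC →L[ℂ] CC)) ^ n) φ = 0
  rw [key]
  refine ⟨fun h0 => ?_, fun h0 => ?_⟩
  swap
  · rw [h0, map_zero]
    exact smul_zero (A := CC) (c ^ n)
  exact (map_eq_zero_iff _ S.injective).1
    (smul_right_injective CC (pow_ne_zero n hc) (h0.trans (smul_zero _).symm))

lemma isFloquetMult_conj (hc : c ≠ 0) (h : ∀ φ, N (S φ) = c • S (M φ)) (μ : ℂ) :
    IsFloquetMult N (c * μ) ↔ IsFloquetMult M μ := by
  refine and_congr (by simp [hc]) ⟨?_, ?_⟩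
  · rintro ⟨φ, hφ, he⟩
    obtain ⟨φ, rfl⟩ := S.surjective φ
    refine ⟨φ, fun h0 => hφ (by rw [h0, map_zero]), S.injective ?_⟩
    rw [h, mul_smul] at he
    rw [map_smul]
    exact smul_right_injective CC hc he
  · rintro ⟨φ, hφ, he⟩
    exact ⟨S φ, (map_ne_zero_iff _ S.injective).2 hφ, by rw [h, he, map_smul, smul_smul]⟩

lemma IsOrderedEnum.conj (hc : c ≠ 0) (h : ∀ φ, N (S φ) = c • S (M φ)) {Λ : ℕ → ℂ}
    (hΛ : IsOrderedEnum M Λ) : IsOrderedEnum N (fun k => c * Λ k) := by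
  refine ⟨fun k hk => ?_, fun k hk => (isFloquetMult_conj hc h _).2 (hΛ.2.1 k hk), fun μ hμ => ?_⟩
  · rw [norm_mul, norm_mul]
    exact mul_le_mul_of_nonneg_left (hΛ.1 k hk) (norm_nonneg _)
  · obtain ⟨μ, rfl⟩ : ∃ ν, μ = c * ν := ⟨c⁻¹ * μ, by field_simp⟩
    have : {k : ℕ | 1 ≤ k ∧ c * Λ k = c * μ} = {k : ℕ | 1 ≤ k ∧ Λ k = μ} := by
      simp only [mul_right_inj' hc]
    rw [this, hΛ.2.2 μ ((isFloquetMult_conj hc h μ).1 hμ), algMult, algMult, genEig_conj hc h]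
    exact (LinearEquiv.finrank_map_eq S _).symm

lemma Hspan_conj (hc : c ≠ 0) (h : ∀ φ, N (S φ) = c • S (M φ)) {Λ : ℕ → ℂ} {m : ℕ} {ψ : CC}
    (hψ : ψ ∈ Hspan M Λ m) : S ψ ∈ Hspan N (fun k => c * Λ k) m := by
  have hle : Hspan M Λ m ≤ (Hspan N (fun k => c * Λ k) m).comap (S : CC →ₗ[ℂ] CC) := by
    refine iSup₂_le fun μ hμ => Submodule.map_le_iff_le_comap.1 ?_
    rw [← genEig_conj hc h]
    refine le_iSup₂_of_le (c * μ) ⟨(isFloquetMult_conj hc h μ).2 hμ.1, ?_⟩ le_rfl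
    rw [norm_mul, norm_mul]
    exact mul_le_mul_of_nonneg_left hμ.2 (norm_nonneg _)
  exact hle hψ

end Conjugation

/-- Multiplication by `exp ∘ A` on `C([-1, 0], ℂ)`. -/
def expMul {A : ℝ → ℝ} (hA : Continuous A) : CC ≃ₗ[ℂ] CC where
  toFun φ := ⟨fun t => (Real.exp (A t) : ℂ) * φ t, by fun_prop⟩
  invFun φ := ⟨fun t => (Real.exp (-A t) : ℂ) * φ t, by fun_prop⟩
  map_add' φ ψ := by ext t; simp [mul_add]
  map_smul' k φ := by ext t; simp; ring
  left_inv φ := by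
    ext t
    simp only [ContinuousMap.coe_mk]
    rw [← mul_assoc, ← Complex.ofReal_mul, ← Real.exp_add]
    simp
  right_inv φ := by
    ext t
    simp only [ContinuousMap.coe_mk]
    rw [← mul_assoc, ← Complex.ofReal_mul, ← Real.exp_add]
    simp

lemma expMul_apply {A : ℝ → ℝ} (hA : Continuous A) (φ : CC) (t : I01) :
    expMul hA φ t = (Real.exp (A t) : ℂ) * φ t := rfl

lemma expMul_symm_apply {A : ℝ → ℝ} (hA : Continuous A) (φ : CC) (t : I01) :
    (expMul hA).symm φ t = (Real.exp (-A t) : ℂ) * φ t := rfl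

lemma continuous_expMul {A : ℝ → ℝ} (hA : Continuous A) : Continuous (expMul hA) := by
  change Continuous fun φ : CC =>
    (⟨fun t => (Real.exp (A t) : ℂ), by fun_prop⟩ : CC) * φ
  fun_prop

lemma continuous_expMul_symm {A : ℝ → ℝ} (hA : Continuous A) : Continuous (expMul hA).symm := by
  change Continuous fun φ : CC =>
    (⟨fun t => (Real.exp (-A t) : ℂ), by fun_prop⟩ : CC) * φ
  fun_prop

/-- The monodromy operator of the transformed equation. -/
def reducedMonodromy {A : ℝ → ℝ} (hA : Continuous A) (γ : ℝ) (M : CC →L[ℂ] CC) : CC →L[ℂ] CC :=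
  (Real.exp (A γ) : ℂ) •
    ((⟨(expMul hA : CC →ₗ[ℂ] CC), continuous_expMul hA⟩ : CC →L[ℂ] CC) ∘L M ∘L
      (⟨((expMul hA).symm : CC →ₗ[ℂ] CC), continuous_expMul_symm hA⟩ : CC →L[ℂ] CC))

lemma reducedMonodromy_apply {A : ℝ → ℝ} (hA : Continuous A) (γ : ℝ) (M : CC →L[ℂ] CC) (φ : CC) :
    reducedMonodromy hA γ M φ =
      (Real.exp (A γ) : ℂ) • expMul hA (M ((expMul hA).symm φ)) := rfl

section Primitive

variable {α A : ℝ → ℝ} {γ : ℝ}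

lemma continuous_of_primitive (hα : LocallyIntegrable α volume)
    (hA : ∀ t, A t = ∫ s in (0 : ℝ)..t, α s) : Continuous A := by
  rw [show A = _ from funext hA]
  exact intervalIntegral.continuous_primitive (fun a b => hα.intervalIntegrable_of_real a b) 0

lemma primitive_add_period (hα : LocallyIntegrable α volume)
    (hA : ∀ t, A t = ∫ s in (0 : ℝ)..t, α s) (hper : ∀ᵐ t ∂volume, α (t + γ) = α t) (t : ℝ) :
    A (t + γ) = A t + A γ := by
  have hi := hα.intervalIntegrable_of_real
  have h1 : ∫ s in γ..(t + γ), α s = A t := by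
    have h2 : ∫ s in (0 : ℝ)..t, α (s + γ) = ∫ s in (0 : ℝ)..t, α s :=
      intervalIntegral.integral_congr_ae (hper.mono fun s hs _ => hs)
    rw [hA, ← h2, intervalIntegral.integral_comp_add_right, zero_add]
  rw [← h1, hA γ, hA, add_comm (∫ s in γ.._, α s), intervalIntegral.integral_add_adjacent_intervals (hi _ _) (hi _ _)]

lemma IsMonodromy.reduced {β : ℝ → ℝ} (hα : LocallyIntegrable α volume)
    (hβ : LocallyIntegrable β volume) (hA : ∀ t, A t = ∫ s in (0 : ℝ)..t, α s) (hγ : 0 < γ)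
    (hper : ∀ᵐ t ∂volume, α (t + γ) = α t) {M : CC →L[ℂ] CC} (hM : IsMonodromy α β γ M) :
    IsMonodromy (fun _ => 0) (reducedCoef A β) γ
      (reducedMonodromy (continuous_of_primitive hα hA) γ M) := by
  intro φ x hx hφ θ
  have h1 := hM ((expMul (continuous_of_primitive hα hA)).symm φ) _
    (hx.exp_neg_smul hα hβ hA hγ.le) (fun θ => by
      rw [expMul_symm_apply, hφ, Complex.real_smul]) θ
  rw [reducedMonodromy_apply, ContinuousMap.smul_apply, expMul_apply, h1, smul_eq_mul,
    Complex.real_smul, ← mul_assoc, ← mul_assoc, ← Complex.ofReal_mul, ← Complex.ofReal_mul,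
    ← Real.exp_add, ← Real.exp_add, add_comm γ, primitive_add_period hα hA hper]
  rw [show A γ + A θ + -(A θ + A γ) = 0 by ring]
  simp

lemma reducedCoef_add_period {β : ℝ → ℝ} (hα : LocallyIntegrable α volume)
    (hA : ∀ t, A t = ∫ s in (0 : ℝ)..t, α s) (hper : ∀ᵐ t ∂volume, α (t + γ) = α t)
    (hβper : ∀ᵐ t ∂volume, β (t + γ) = β t) :
    ∀ᵐ t ∂volume, reducedCoef A β (t + γ) = reducedCoef A β t := by
  filter_upwards [hβper] with t ht
  rw [reducedCoef, reducedCoef, ht, primitive_add_period hα hA hper,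
    show t + γ - 1 = (t - 1) + γ by ring, primitive_add_period hα hA hper, add_sub_add_right_eq_sub]

lemma exists_abs_sub_le (hα : LocallyIntegrable α volume)
    (hA : ∀ t, A t = ∫ s in (0 : ℝ)..t, α s) (hγ : 0 < γ)
    (hper : ∀ᵐ t ∂volume, α (t + γ) = α t) : ∃ D, ∀ t, |A t - A (t - 1)| ≤ D := by
  have hc := continuous_of_primitive hα hA
  have hp : Function.Periodic (fun t => A t - A (t - 1)) γ := fun t => by
    simp only
    rw [primitive_add_period hα hA hper, show t + γ - 1 = (t - 1) + γ by ring,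
      primitive_add_period hα hA hper, add_sub_add_right_eq_sub]
  obtain ⟨D, hD⟩ := (isCompact_Icc (a := (0 : ℝ)) (b := γ)).exists_bound_of_continuousOn
    (f := fun t => A t - A (t - 1)) (by fun_prop)
  refine ⟨D, fun t => ?_⟩
  obtain ⟨s, hs, he⟩ := hp.exists_mem_Ico₀ hγ t
  rw [show A t - A (t - 1) = A s - A (s - 1) from he]
  exact hD s ⟨hs.1, hs.2.le⟩

lemma exists_posCoef_reduced {β : ℝ → ℝ} {m : ℕ} {β₁ β₂ : ℝ} (hα : LocallyIntegrable α volume)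
    (hβ : LocallyIntegrable β volume) (hA : ∀ t, A t = ∫ s in (0 : ℝ)..t, α s) (hγ : 0 < γ)
    (hper : ∀ᵐ t ∂volume, α (t + γ) = α t) (hβ₁ : 0 < β₁)
    (hsign : ∀ᵐ t ∂volume, β₁ ≤ (-1 : ℝ) ^ m * β t ∧ (-1 : ℝ) ^ m * β t ≤ β₂) :
    ∃ b₁ b₂, PosCoef (fun t => (-1) ^ m * reducedCoef A β t) b₁ b₂ := by
  have hc := continuous_of_primitive hα hA
  obtain ⟨D, hD⟩ := exists_abs_sub_le hα hA hγ hper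
  refine ⟨β₁ * Real.exp (-D), β₂ * Real.exp D, ?_, by positivity, ?_⟩
  · have h1 : LocallyIntegrable (reducedCoef A β) volume := by
      rw [← locallyIntegrableOn_univ] at hβ ⊢
      have he : Continuous fun t => Real.exp (A t - A (t - 1)) := by fun_prop
      exact hβ.mul_continuousOn he.continuousOn isOpen_univ.isLocallyClosed
    exact h1.smul ((-1 : ℝ) ^ m)
  · filter_upwards [hsign] with t ht
    rw [reducedCoef, ← mul_assoc]
    have := abs_le.1 (hD t)
    have h0 := hβ₁.trans_le ht.1
    exact ⟨mul_le_mul ht.1 (Real.exp_le_exp.2 this.1) (Real.exp_pos _).le h0.le,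
      mul_le_mul ht.2 (Real.exp_le_exp.2 this.2) (Real.exp_pos _).le (h0.le.trans ht.2)⟩

end Primitive

/-- Backward uniqueness: a solution on the line vanishing on a half-line vanishes. -/
lemma eq_zero_of_eq_zero_right {b z : ℝ → ℝ} (hb : LocallyIntegrable b volume)
    (hb0 : ∀ᵐ t ∂volume, b t ≠ 0) (hz : Continuous z)
    (hzb : ∀ τ t, τ ≤ t → z t = z τ - ∫ q in τ..t, b q • z (q - 1))
    {c : ℝ} (h0 : ∀ t, c ≤ t → z t = 0) (t : ℝ) : z t = 0 := by
  have hg : LocallyIntegrable (fun q => b q • z (q - 1)) volume := by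
    rw [← locallyIntegrableOn_univ] at hb ⊢
    exact hb.mul_continuousOn (hz.comp (continuous_sub_right 1)).continuousOn
      isOpen_univ.isLocallyClosed
  have step : ∀ c, (∀ t, c ≤ t → z t = 0) → ∀ t, c - 1 ≤ t → z t = 0 := by
    intro c hc
    have hae : ∀ᵐ q ∂volume.restrict (Set.Ioi c), z (q - 1) = 0 := by
      rw [ae_restrict_iff' measurableSet_Ioi]
      filter_upwards [hb0, LocallyIntegrable.ae_hasDerivAt_integral hg] with q hq hd hcq
      have h1 : HasDerivAt (fun x => ∫ s in c..x, b s • z (s - 1)) 0 q := by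
        refine (hasDerivAt_const q (0 : ℝ)).congr_of_eventuallyEq ?_
        filter_upwards [Ioi_mem_nhds hcq] with x hx
        have := hzb c x (le_of_lt hx)
        rw [hc x (le_of_lt hx), hc c le_rfl] at this
        linarith
      exact (smul_eq_zero.1 ((hd c).unique h1)).resolve_left hq
    have hIoi : Set.EqOn (fun q => z (q - 1)) (fun _ => 0) (Set.Ioi c) :=
      Measure.eqOn_open_of_ae_eq hae isOpen_Ioi (by fun_prop) continuousOn_const
    have hIci : Set.EqOn (fun q => z (q - 1)) (fun _ => 0) (Set.Ici c) := by
      rw [← closure_Ioi]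
      exact hIoi.closure (by fun_prop) continuous_const
    intro t ht
    have := hIci (x := t + 1) (by simpa [sub_le_iff_le_add] using ht)
    simpa using this
  have hn : ∀ n : ℕ, ∀ t, c - n ≤ t → z t = 0 := by
    intro n
    induction n with
    | zero => simpa using h0
    | succ n ih =>
      intro t ht
      refine step _ ih t ?_
      push_cast at ht
      linarith
  obtain ⟨n, hn'⟩ := exists_nat_ge (c - t)
  exact hn n t (by linarith)

lemma IsGlobalSolution.continuous {α β x : ℝ → ℝ} (h : IsGlobalSolution α β x) :
    Continuous x := by
  refine continuous_iff_continuousAt.2 fun t => ?_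
  exact (h (t - 1) (t + 1) (by linarith)).1.continuousAt (Icc_mem_nhds (by linarith) (by linarith))

lemma detOf_sum {m : ℕ} (B : Matrix (Fin m) (Fin m) ℝ) (y : Fin m → ℝ → ℝ) (x : Fin m → ℝ) :
    detOf (fun j t => ∑ i, B j i * y i t) x = B.det * detOf y x := by
  rw [detOf, detOf, ← Matrix.det_mul]
  rfl

/-- Two-sided bounds for the determinant of `m` independent solutions on the line whose initial
segments are real parts of elements of the Perron span. -/
lemma Perron.exists_det_bounds {m : ℕ} {b : ℝ → ℝ} {b₁ b₂ γ Δ : ℝ} {Y : Fin m → ℝ → ℝ}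
    {θ : Fin m → ℝ} (hm : m = 2 ∨ m = 3) (hγ : 0 < γ) (hper : ∀ᵐ t ∂volume, b (t + γ) = b t)
    (ha : PosCoef (fun t => (-1) ^ m * b t) b₁ b₂) (hP : Perron b γ Δ Y θ)
    {y : Fin m → ℝ → ℝ} (hy : ∀ j, Continuous (y j))
    (hyb : ∀ j τ t, τ ≤ t → y j t = y j τ - ∫ q in τ..t, b q • y j (q - 1))
    (hind : LinearIndependent ℝ y)
    (hW : ∀ j, ∃ φ ∈ hP.W, ∀ t : I01, y j t = (φ t).re) :
    ∃ C, ∃ c₁ > 0, ∃ c₂ > 0, ∀ t ∈ Set.Icc 0 γ, ∀ x ∈ TsetR m,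
      c₁ * umFun m x ≤ C * detOf y (fun i => t + x i) ∧
      C * detOf y (fun i => t + x i) ≤ c₂ * umFun m x := by
  have hb := ha.bddCoef
  have hys : ∀ j, Sol b (y j) := fun j => ⟨hy j, fun τ t _ h => hyb j τ t h⟩
  have hB : ∀ j, ∃ d : Fin m → ℝ, ∀ t, -1 ≤ t → y j t = ∑ i, d i * Y i t := by
    intro j
    obtain ⟨φ, hφ, hyφ⟩ := hW j
    obtain ⟨d, hd⟩ := mem_W.1 hφ
    refine ⟨fun i => (d i).re, fun t ht => (hys j).eq_of_eq hb
      (Sol.sum hb Finset.univ fun i _ => (hP.sol i).const_mul hb (d i).re) (fun t ht => ?_) ht⟩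
    rw [hyφ ⟨t, ht⟩, hd ⟨t, ht⟩, Complex.re_sum]
    simp
  choose B hB using hB
  have hdet : (Matrix.of B).det ≠ 0 := by
    intro h
    obtain ⟨v, hv0, hv⟩ := Matrix.exists_vecMul_eq_zero_iff.2 h
    refine hv0 (funext fun j => ?_)
    refine Fintype.linearIndependent_iff.1 hind v (funext fun t => ?_) j
    have hb0 : ∀ᵐ t ∂volume, b t ≠ 0 := by
      filter_upwards [ha.bounds] with t ht h0
      rw [h0, mul_zero] at ht
      exact absurd ht.1 (not_le.2 ha.pos)
    have hz := eq_zero_of_eq_zero_right hb.locInt hb0 (z := fun t => ∑ j, v j * y j t) (c := -1)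
      (by fun_prop) (fun τ t h => ?_) (fun t ht => ?_) t
    · simpa using hz
    · have hi : ∀ j ∈ Finset.univ, IntervalIntegrable (fun q => v j * (b q • y j (q - 1)))
          volume τ t := fun j _ => (hb.intervalIntegrable_smul
            ((hy j).comp (continuous_sub_right 1)) τ t).const_mul (v j)
      have e : ∀ q, b q • ∑ j, v j * y j (q - 1) = ∑ j, v j * (b q • y j (q - 1)) := fun q => by
        simp only [smul_eq_mul, Finset.mul_sum]
        exact Finset.sum_congr rfl fun j _ => by ring
      simp only [e]
      rw [intervalIntegral.integral_finsetSum hi, ← Finset.sum_sub_distrib]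
      refine Finset.sum_congr rfl fun j _ => ?_
      rw [intervalIntegral.integral_const_mul, hyb j τ t h, mul_sub]
    · have e : ∑ j, v j * y j t = ∑ i, (Matrix.vecMul v (Matrix.of B)) i * Y i t := by
        simp only [Matrix.vecMul, dotProduct, Finset.sum_mul, hB _ t ht, Finset.mul_sum,
          Matrix.of_apply, mul_assoc]
        exact Finset.sum_comm
      rw [e, hv]
      simp
  obtain ⟨c₁, hc₁, c₂, hc₂, h⟩ := hP.exists_bounds hm hγ hper ha γ
  refine ⟨(Matrix.of B).det⁻¹, c₁, hc₁, c₂, hc₂, fun t ht x hx => ?_⟩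
  have e : detOf y (fun i => t + x i) = (Matrix.of B).det * detOf Y (fun i => t + x i) := by
    rw [← detOf_sum]
    unfold detOf
    congr 1
    ext j i
    exact hB j _ (by linarith [ht.1, (hx.1 i).1])
  rw [e, inv_mul_cancel_left₀ hdet]
  exact h t ht.1 ht.2 x hx

theorem statement12 (α β : ℝ → ℝ)
    (hα : LocallyIntegrable α volume) (hβ : LocallyIntegrable β volume)
    (γ : ℝ) (hγ : 0 < γ)
    (hαper : ∀ᵐ t ∂volume, α (t + γ) = α t) (hβper : ∀ᵐ t ∂volume, β (t + γ) = β t)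
    (m : ℕ) (hm : m = 2 ∨ m = 3)
    (β₁ β₂ : ℝ) (hβ₁ : 0 < β₁)
    (hsign : ∀ᵐ t ∂volume, β₁ ≤ (-1 : ℝ) ^ m * β t ∧ (-1 : ℝ) ^ m * β t ≤ β₂)
    (M : CC →L[ℂ] CC) (hM : IsMonodromy α β γ M)
    (Λ : ℕ → ℂ) (hΛ : IsOrderedEnum M Λ)
    (x : Fin m → ℝ → ℝ) (hsol : ∀ j, IsGlobalSolution α β (x j))
    (hind : LinearIndependent ℝ x)
    (hH : ∀ j, ∃ ψ ∈ Hspan M Λ m, ∀ θ : I01, x j (θ : ℝ) = (ψ θ).re) :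
    ∃ C C₁ C₂ : ℝ, 0 < C₁ ∧ C₁ ≤ C₂ ∧
      ∀ t ∈ Set.Icc (0 : ℝ) γ, ∀ θ ∈ TsetR m,
        C₁ * umFun m θ ≤ C * (Matrix.of fun i j => x i (t + θ j)).det ∧
        C * (Matrix.of fun i j => x i (t + θ j)).det ≤ C₂ * umFun m θ := by
  set A : ℝ → ℝ := fun t => ∫ s in (0 : ℝ)..t, α s with hAdef
  have hA : ∀ t, A t = ∫ s in (0 : ℝ)..t, α s := fun t => rfl
  have hAc := continuous_of_primitive hα hA
  obtain ⟨b₁, b₂, ha⟩ := exists_posCoef_reduced hα hβ hA hγ hαper hβ₁ hsign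
  have hper := reducedCoef_add_period hα hA hαper hβper
  obtain ⟨Δ, Y, θ, hP⟩ := exists_perron hm hγ hper ha
  have hconj : ∀ φ, reducedMonodromy hAc γ M (expMul hAc φ) =
      (Real.exp (A γ) : ℂ) • expMul hAc (M φ) := fun φ => by
    rw [reducedMonodromy_apply, LinearEquiv.symm_apply_apply]
  have hc0 : (Real.exp (A γ) : ℂ) ≠ 0 := by exact_mod_cast (Real.exp_pos _).ne'
  have hle := hP.Hspan_le hm hγ hper ha (hM.reduced hα hβ hA hγ hαper) (hΛ.conj hc0 hconj)
  have hxc := fun j => (hsol j).continuous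
  obtain ⟨C, c₁, hc₁, c₂, hc₂, hbd⟩ := hP.exists_det_bounds hm hγ hper ha
    (y := fun j t => Real.exp (A t) * x j t) (fun j => by have := hxc j; fun_prop)
    (fun j τ t h => (hsol j τ t h).exp_mul hα hβ hA (hxc j) h)
    (by
      rw [Fintype.linearIndependent_iff] at hind ⊢
      intro v hv
      refine hind v (funext fun t => ?_)
      have h1 := congrFun hv t
      simp only [Finset.sum_apply, Pi.smul_apply, smul_eq_mul, Pi.zero_apply] at h1 ⊢
      have h2 : Real.exp (A t) * ∑ j, v j * x j t = 0 := by
        rw [← h1, Finset.mul_sum]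
        exact Finset.sum_congr rfl fun j _ => by ring
      exact (mul_eq_zero.1 h2).resolve_left (Real.exp_pos _).ne')
    (fun j => by
      obtain ⟨ψ, hψ, hx⟩ := hH j
      refine ⟨expMul hAc ψ, hle (Hspan_conj hc0 hconj hψ), fun t => ?_⟩
      rw [expMul_apply, Complex.re_ofReal_mul, hx])
  obtain ⟨D, hD⟩ := (isCompact_Icc (a := (-1 : ℝ)) (b := γ)).exists_bound_of_continuousOn
    hAc.continuousOn
  refine ⟨C, Real.exp (-D) ^ m * c₁, Real.exp D ^ m * c₂ + Real.exp (-D) ^ m * c₁,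
    by positivity, le_add_of_nonneg_left (by positivity), fun t ht ξ hξ => ?_⟩
  have hu := umFun_nonneg hm hξ
  have hmem : ∀ j, t + ξ j ∈ Set.Icc (-1 : ℝ) γ := fun j =>
    ⟨by linarith [ht.1, (hξ.1 j).1], by linarith [ht.2, (hξ.1 j).2]⟩
  set p : ℝ := ∏ j, Real.exp (-A (t + ξ j)) with hp
  have hdet : (Matrix.of fun i j => x i (t + ξ j)).det =
      p * detOf (fun j t => Real.exp (A t) * x j t) (fun j => t + ξ j) := by
    rw [hp, detOf, ← Matrix.det_mul_row]
    congr 1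
    ext i j
    simp [← mul_assoc, ← Real.exp_add]
  have hpow : ∀ c : ℝ, c ^ m = ∏ _j : Fin m, c := fun c => by simp
  have hp1 : Real.exp (-D) ^ m ≤ p := by
    rw [hp, hpow]
    refine Finset.prod_le_prod (fun _ _ => (Real.exp_pos _).le) fun j _ => ?_
    exact Real.exp_le_exp.2 (neg_le_neg (abs_le.1 (hD _ (hmem j))).2)
  have hp2 : p ≤ Real.exp D ^ m := by
    rw [hp, hpow]
    refine Finset.prod_le_prod (fun _ _ => (Real.exp_pos _).le) fun j _ => ?_
    exact Real.exp_le_exp.2 (neg_le.1 (abs_le.1 (hD _ (hmem j))).1)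
  have hp0 : 0 ≤ p := Finset.prod_nonneg fun _ _ => (Real.exp_pos _).le
  obtain ⟨h1, h2⟩ := hbd t ht ξ hξ
  rw [hdet, mul_left_comm]
  constructor
  · rw [mul_assoc]
    exact mul_le_mul hp1 h1 (by positivity) hp0
  · refine (mul_le_mul_of_nonneg_left h2 hp0).trans ?_
    rw [add_mul, mul_assoc]
    refine (mul_le_mul_of_nonneg_right hp2 (by positivity)).trans (le_add_of_nonneg_right ?_)
    positivity
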